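/- arXiv:2410.15867 — 3 statements merged into one kernel-verified Lean document; each statement's English description precedes it below -/
import Mathlib

section
/- Assume (H1)–(H7) and let (2) be an asymptotic system of (1). Let x be a solution of (1) with bounded initial condition at some t₀ ≥ 0, and let x̂ be a solution of (2) with bounded initial condition at some t̂₀ ≥ 0. Then lim_{t→+∞} |x(t) − x̂(t)| = 0, where |·| is the max norm on ℝ^n. -/
open MeasureTheory Filter

/-- The data of the Cohen--Grossberg system (1), with `n+1` neurons and `P+1` delay blocks. -/
structure CGData (n P : ℕ) where
  a : Fin (n+1) → ℝ → ℝ → ℝ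
  b : Fin (n+1) → ℝ → ℝ → ℝ
  c : Fin (n+1) → Fin (n+1) → Fin (n+1) → Fin (P+1) → ℝ → ℝ
  d : Fin (n+1) → Fin (n+1) → Fin (n+1) → Fin (P+1) → ℝ → ℝ
  I : Fin (n+1) → ℝ → ℝ
  τ : Fin (n+1) → Fin (n+1) → Fin (P+1) → ℝ → ℝ
  σ : Fin (n+1) → Fin (n+1) → Fin (P+1) → ℝ → ℝ
  F : Fin (n+1) → ℝ → ℝ → ℝ
  h : Fin (n+1) → Fin (n+1) → Fin (n+1) → Fin (P+1) → ℝ → ℝ → ℝ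
  f : Fin (n+1) → Fin (n+1) → Fin (n+1) → Fin (P+1) → ℝ → ℝ → ℝ
  g : Fin (n+1) → Fin (n+1) → Fin (P+1) → ℝ → ℝ
  G : Fin (n+1) → Fin (n+1) → Fin (P+1) → ℝ → ℝ
  η : Fin (n+1) → Fin (n+1) → Fin (P+1) → Measure ℝ
  ρ : Fin (n+1) → Fin (n+1) → Fin (P+1) → Measure ℝ

namespace CGData

variable {n P : ℕ}

/-- `U_i(t,x)`. -/
noncomputable def U (S : CGData n P) (x : Fin (n+1) → ℝ → ℝ) (i : Fin (n+1)) (t : ℝ) : ℝ :=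
  ∑ p : Fin (P+1), ∑ j : Fin (n+1), ∑ l : Fin (n+1),
    S.c i j l p t * S.h i j l p (x j (t - S.τ i j p t)) (x l (t - S.σ i l p t))

/-- `V_i(t,x)`. -/
noncomputable def V (S : CGData n P) (x : Fin (n+1) → ℝ → ℝ) (i : Fin (n+1)) (t : ℝ) : ℝ :=
  ∑ p : Fin (P+1), ∑ j : Fin (n+1), ∑ l : Fin (n+1),
    S.d i j l p t * S.f i j l p
      (∫ s in Set.Iic (0:ℝ), S.g i j p (x j (t + s)) ∂(S.η i j p))
      (∫ s in Set.Iic (0:ℝ), S.G i l p (x l (t + s)) ∂(S.ρ i l p))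

/-- Right-hand side of system (1). -/
noncomputable def rhs (S : CGData n P) (x : Fin (n+1) → ℝ → ℝ) (i : Fin (n+1)) (t : ℝ) : ℝ :=
  S.a i t (x i t) * (-(S.b i t (x i t)) + S.F i (S.U x i t) (S.V x i t) + S.I i t)

/-- Standing regularity assumptions on the data (continuity, positivity of `a`,
nonnegativity of the delays, probability measures supported on `(-∞,0]`). -/
def Regular (S : CGData n P) : Prop :=
  (∀ i, ContinuousOn (fun q : ℝ × ℝ => S.a i q.1 q.2) (Set.Ici 0 ×ˢ Set.univ)) ∧
  (∀ i, ∀ t ≥ (0:ℝ), ∀ v, 0 < S.a i t v) ∧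
  (∀ i, ContinuousOn (fun q : ℝ × ℝ => S.b i q.1 q.2) (Set.Ici 0 ×ˢ Set.univ)) ∧
  (∀ i j l p, ContinuousOn (S.c i j l p) (Set.Ici 0)) ∧
  (∀ i j l p, ContinuousOn (S.d i j l p) (Set.Ici 0)) ∧
  (∀ i, ContinuousOn (S.I i) (Set.Ici 0)) ∧
  (∀ i j p, ContinuousOn (S.τ i j p) (Set.Ici 0)) ∧
  (∀ i l p, ContinuousOn (S.σ i l p) (Set.Ici 0)) ∧
  (∀ i j p, ∀ t ≥ (0:ℝ), 0 ≤ S.τ i j p t) ∧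
  (∀ i l p, ∀ t ≥ (0:ℝ), 0 ≤ S.σ i l p t) ∧
  (∀ i, Continuous (fun q : ℝ × ℝ => S.F i q.1 q.2)) ∧
  (∀ i j l p, Continuous (fun q : ℝ × ℝ => S.h i j l p q.1 q.2)) ∧
  (∀ i j l p, Continuous (fun q : ℝ × ℝ => S.f i j l p q.1 q.2)) ∧
  (∀ i j p, Continuous (S.g i j p)) ∧
  (∀ i l p, Continuous (S.G i l p)) ∧
  (∀ i j p, IsProbabilityMeasure (S.η i j p) ∧ S.η i j p (Set.Ioi 0) = 0) ∧
  (∀ i l p, IsProbabilityMeasure (S.ρ i l p) ∧ S.ρ i l p (Set.Ioi 0) = 0)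

/-- A solution of (1) on `ℝ` with bounded initial condition at `t₀`. -/
def IsSolution (S : CGData n P) (t₀ : ℝ) (x : Fin (n+1) → ℝ → ℝ) : Prop :=
  (∀ i, Continuous (x i)) ∧
  (∃ M, ∀ i, ∀ t ≤ t₀, |x i t| ≤ M) ∧
  (∀ i, ∀ t, t₀ < t → HasDerivAt (x i) (S.rhs x i t) t)

/-- Hypothesis (H1): boundedness of the coefficients. -/
def H1 (S : CGData n P) : Prop :=
  (∀ i j l p, ∃ M, ∀ t ≥ (0:ℝ), |S.c i j l p t| ≤ M) ∧
  (∀ i j l p, ∃ M, ∀ t ≥ (0:ℝ), |S.d i j l p t| ≤ M) ∧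
  (∀ i, ∃ M, ∀ t ≥ (0:ℝ), |S.I i t| ≤ M) ∧
  (∀ i, ∀ u : ℝ, ∃ M, ∀ t ≥ (0:ℝ), |S.b i t u| ≤ M)

/-- Hypothesis (H2). -/
def H2 (S : CGData n P) (aL aU : Fin (n+1) → ℝ) (A : Fin (n+1) → ℝ → ℝ) : Prop :=
  (∀ i, 0 < aL i) ∧ (∀ i, aL i ≤ aU i) ∧
  (∀ i, ∀ t ≥ (0:ℝ), ∀ v, aL i ≤ S.a i t v ∧ S.a i t v ≤ aU i) ∧
  (∀ i, ∀ v : ℝ, ∀ t ≥ (0:ℝ),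
    ∃ da, HasDerivAt (fun s => S.a i s v) da t ∧ A i t * (S.a i t v) ^ 2 ≤ da)

/-- Hypothesis (H3). -/
def H3 (S : CGData n P) (β : Fin (n+1) → ℝ → ℝ) : Prop :=
  (∀ i, ContinuousOn (β i) (Set.Ici 0)) ∧
  (∀ i, ∀ t ≥ (0:ℝ), 0 ≤ β i t) ∧
  (∀ i, ∀ t ≥ (0:ℝ), ∀ u v : ℝ, u ≠ v → β i t ≤ (S.b i t u - S.b i t v) / (u - v))

/-- Hypothesis (H4): unbounded delays eventually dominated by `t`. -/
def H4 (S : CGData n P) : Prop :=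
  (∀ i j p, Tendsto (fun t => t - S.τ i j p t) atTop atTop) ∧
  (∀ i l p, Tendsto (fun t => t - S.σ i l p t) atTop atTop)

/-- Hypothesis (H5). -/
def H5 (S : CGData n P)
    (γ1 γ2 μ1 μ2 : Fin (n+1) → Fin (n+1) → Fin (n+1) → Fin (P+1) → ℝ) : Prop :=
  (∀ i j l p, 0 < γ1 i j l p ∧ 0 < γ2 i j l p ∧ 0 < μ1 i j l p ∧ 0 < μ2 i j l p) ∧
  (∀ i j l p u1 u2 v1 v2,
    |S.h i j l p u1 u2 - S.h i j l p v1 v2| ≤ γ1 i j l p * |u1 - v1| + γ2 i j l p * |u2 - v2|) ∧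
  (∀ i j l p u1 u2 v1 v2,
    |S.f i j l p u1 u2 - S.f i j l p v1 v2| ≤ μ1 i j l p * |u1 - v1| + μ2 i j l p * |u2 - v2|)

/-- Hypothesis (H6). -/
def H6 (S : CGData n P) (ξ Ξ : Fin (n+1) → Fin (n+1) → Fin (P+1) → ℝ)
    (ζ ς : Fin (n+1) → ℝ) : Prop :=
  (∀ i j p, 0 < ξ i j p) ∧ (∀ i l p, 0 < Ξ i l p) ∧ (∀ i, 0 < ζ i ∧ 0 < ς i) ∧
  (∀ i j p u v, |S.g i j p u - S.g i j p v| ≤ ξ i j p * |u - v|) ∧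
  (∀ i l p u v, |S.G i l p u - S.G i l p v| ≤ Ξ i l p * |u - v|) ∧
  (∀ i u1 u2 v1 v2, |S.F i u1 u2 - S.F i v1 v2| ≤ ζ i * |u1 - v1| + ς i * |u2 - v2|)

/-- The expression whose `limsup` is required to be negative in hypothesis (H7). -/
noncomputable def H7expr (S : CGData n P) (aL aU : Fin (n+1) → ℝ) (A : Fin (n+1) → ℝ → ℝ)
    (β : Fin (n+1) → ℝ → ℝ)
    (γ1 γ2 μ1 μ2 : Fin (n+1) → Fin (n+1) → Fin (n+1) → Fin (P+1) → ℝ)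
    (ξ Ξ : Fin (n+1) → Fin (n+1) → Fin (P+1) → ℝ) (ζ ς : Fin (n+1) → ℝ)
    (dv : Fin (n+1) → ℝ) (i : Fin (n+1)) (t : ℝ) : ℝ :=
  -(aL i * (β i t + A i t)) +
    ∑ p : Fin (P+1), ∑ j : Fin (n+1), ∑ l : Fin (n+1),
      (ζ i * |S.c i j l p t| *
          (aU j * (dv j / dv i) * γ1 i j l p + aU l * (dv l / dv i) * γ2 i j l p)
        + ς i * |S.d i j l p t| *
          (aU j * (dv j / dv i) * ξ i j p * μ1 i j l p
            + aU l * (dv l / dv i) * Ξ i l p * μ2 i j l p))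

/-- Hypothesis (H7). -/
def H7 (S : CGData n P) (aL aU : Fin (n+1) → ℝ) (A : Fin (n+1) → ℝ → ℝ)
    (β : Fin (n+1) → ℝ → ℝ)
    (γ1 γ2 μ1 μ2 : Fin (n+1) → Fin (n+1) → Fin (n+1) → Fin (P+1) → ℝ)
    (ξ Ξ : Fin (n+1) → Fin (n+1) → Fin (P+1) → ℝ) (ζ ς : Fin (n+1) → ℝ)
    (dv : Fin (n+1) → ℝ) : Prop :=
  (∀ i, 0 < dv i) ∧
  (∀ i, limsup (fun t => S.H7expr aL aU A β γ1 γ2 μ1 μ2 ξ Ξ ζ ς dv i t) atTop < 0)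

/-- The convergence conditions making `Sh` (with data `b̂, ĉ, d̂, Î, τ̂, σ̂` and rate
function `β̂`) an asymptotic system of `S` (with rate function `β`). -/
def IsAsymptoticOf (Sh S : CGData n P) (β βh : Fin (n+1) → ℝ → ℝ) : Prop :=
  Sh.a = S.a ∧ Sh.F = S.F ∧ Sh.h = S.h ∧ Sh.f = S.f ∧ Sh.g = S.g ∧ Sh.G = S.G ∧
  Sh.η = S.η ∧ Sh.ρ = S.ρ ∧
  Sh.H3 βh ∧
  (∀ i, Tendsto (fun t => β i t - βh i t) atTop (nhds 0)) ∧
  (∀ i, ∀ w : ℝ → ℝ, Continuous w → (∃ M, ∀ t, |w t| ≤ M) →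
    Tendsto (fun t => S.b i t (w t) - Sh.b i t (w t)) atTop (nhds 0)) ∧
  (∀ i j l p, Tendsto (fun t => S.c i j l p t - Sh.c i j l p t) atTop (nhds 0)) ∧
  (∀ i j l p, Tendsto (fun t => S.d i j l p t - Sh.d i j l p t) atTop (nhds 0)) ∧
  (∀ i j p, Tendsto (fun t => S.τ i j p t - Sh.τ i j p t) atTop (nhds 0)) ∧
  (∀ i l p, Tendsto (fun t => S.σ i l p t - Sh.σ i l p t) atTop (nhds 0)) ∧
  (∀ i, Tendsto (fun t => S.I i t - Sh.I i t) atTop (nhds 0))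

end CGData

open CGData

open Topology

/-- A continuous function that is bounded up to some time is bounded up to any time. -/
lemma exists_abs_le_of_bounded_Iic {f : ℝ → ℝ} (hf : Continuous f) {t₀ M : ℝ}
    (hM : ∀ s ≤ t₀, |f s| ≤ M) (t : ℝ) : ∃ K, ∀ s ≤ t, |f s| ≤ K := by
  obtain ⟨K, hK⟩ := (isCompact_Icc (a := t₀) (b := t)).exists_bound_of_continuousOn hf.continuousOn
  refine ⟨max M K, fun s hs => ?_⟩
  rcases le_total s t₀ with h | h
  · exact (hM s h).trans (le_max_left _ _)
  · exact (hK s ⟨h, hs⟩).trans (le_max_right _ _)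

/-- Derivative at `t` of the integral of `g s` from the frozen endpoint `x t` to `x s`. -/
lemma hasDerivAt_integral_moving_endpoint {g : ℝ → ℝ → ℝ}
    (hg : Continuous fun q : ℝ × ℝ => g q.1 q.2) {x : ℝ → ℝ} {x' t : ℝ}
    (hx : HasDerivAt x x' t) :
    HasDerivAt (fun s => ∫ v in x t..x s, g s v) (g t (x t) * x') t := by
  have hgs : ∀ s a b, IntervalIntegrable (g s) volume a b := fun s a b =>
    (hg.comp (Continuous.prodMk_right s)).intervalIntegrable a b
  have hlin : HasDerivAt (fun s => g t (x t) * (x s - x t)) (g t (x t) * x') t :=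
    (hx.sub_const _).const_mul _
  have hO : (fun s => x s - x t) =O[𝓝 t] fun s => s - t := hx.isBigO_sub
  have ho : (fun s => (∫ v in x t..x s, g s v) - g t (x t) * (x s - x t))
      =o[𝓝 t] fun s => x s - x t := by
    rw [Asymptotics.isLittleO_iff]
    intro ε hε
    have hcont : Tendsto (fun q : ℝ × ℝ => g q.1 q.2) (𝓝 (t, x t)) (𝓝 (g t (x t))) :=
      hg.tendsto (t, x t)
    obtain ⟨r, hr, hball⟩ := Metric.eventually_nhds_iff.1
      (hcont.eventually (Metric.closedBall_mem_nhds _ hε))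
    filter_upwards [hx.continuousAt.eventually (Metric.ball_mem_nhds _ hr),
      Metric.ball_mem_nhds t hr] with s hxs hs
    have hsub : (∫ v in x t..x s, g s v) - g t (x t) * (x s - x t)
        = ∫ v in x t..x s, (g s v - g t (x t)) := by
      rw [intervalIntegral.integral_sub (hgs _ _ _) intervalIntegrable_const,
        intervalIntegral.integral_const, smul_eq_mul, mul_comm]
    rw [hsub]
    refine intervalIntegral.norm_integral_le_of_norm_le_const fun v hv => ?_
    have hv' : |v - x t| ≤ |x s - x t| := by
      have := Set.abs_sub_left_of_mem_uIcc (Set.uIoc_subset_uIcc hv)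
      exact this
    have : dist ((s, v) : ℝ × ℝ) (t, x t) < r := by
      rw [Prod.dist_eq, max_lt_iff]
      refine ⟨hs, lt_of_le_of_lt ?_ (Metric.mem_ball.1 hxs)⟩
      rw [Real.dist_eq, Real.dist_eq]
      exact hv'
    exact hball this
  have ho' := ho.trans_isBigO hO
  have hzero : HasDerivAt
      (fun s => (∫ v in x t..x s, g s v) - g t (x t) * (x s - x t)) 0 t := by
    rw [hasDerivAt_iff_isLittleO]
    simpa using ho'
  simpa using (hzero.add hlin).congr_of_eventuallyEq (f₁ := fun s => ∫ v in x t..x s, g s v)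
    (Eventually.of_forall fun s => by simp)

/-- A lower bound `α a² ≤ ∂ₜ a` makes `s ↦ 1 / a s v` decrease at rate at least `α`. -/
lemma eventually_inv_sub_inv_le {a : ℝ → ℝ → ℝ} (ha : ∀ s v, 0 < a s v) {t α : ℝ}
    (hα : ∀ᶠ s in 𝓝 t, ∀ v, ∃ da, HasDerivAt (fun r => a r v) da s ∧ α * a s v ^ 2 ≤ da) :
    ∀ᶠ s in 𝓝[<] t, ∀ v, (a t v)⁻¹ - (a s v)⁻¹ ≤ -α * (t - s) := by
  obtain ⟨r, hr, hball⟩ := Metric.eventually_nhds_iff_ball.1 hα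
  filter_upwards [mem_nhdsWithin_of_mem_nhds (Metric.ball_mem_nhds t hr), self_mem_nhdsWithin]
    with s hs hst v
  have hst : s < t := hst
  have hder : ∀ q ∈ Metric.ball t r, ∃ e, HasDerivAt (fun q => (a q v)⁻¹ + α * q) e q ∧ e ≤ 0 := by
    intro q hq
    obtain ⟨da, hda, hle⟩ := hball q hq v
    refine ⟨_, (hda.inv (ha q v).ne').add ((hasDerivAt_id q).const_mul α), ?_⟩
    have : α ≤ da / a q v ^ 2 := by
      rw [le_div_iff₀ (pow_pos (ha q v) 2)]
      exact hle
    rw [neg_div]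
    linarith
  have hanti : AntitoneOn (fun q => (a q v)⁻¹ + α * q) (Metric.ball t r) := by
    refine antitoneOn_of_deriv_nonpos (convex_ball t r) ?_ ?_ ?_
    · intro q hq
      obtain ⟨e, he, -⟩ := hder q hq
      exact he.continuousAt.continuousWithinAt
    · intro q hq
      obtain ⟨e, he, -⟩ := hder q (interior_subset hq)
      exact he.differentiableAt.differentiableWithinAt
    · intro q hq
      obtain ⟨e, he, h0⟩ := hder q (interior_subset hq)
      rwa [he.deriv]
  have := hanti hs (Metric.mem_ball_self hr) hst.le
  simp only at this
  linarith

/-- Upper estimate of the left difference quotients of `∫ v in y..x, 1 / a` along two curves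
whose velocities are `a * X` and `a * Y` at time `t`. -/
lemma eventually_integral_inv_sub_le {a : ℝ → ℝ → ℝ} {x y : ℝ → ℝ} {t X Y α ρ : ℝ}
    (hg : Continuous fun q : ℝ × ℝ => (a q.1 q.2)⁻¹) (ha : ∀ s v, 0 < a s v)
    (hα : ∀ᶠ s in 𝓝 t, ∀ v, ∃ da, HasDerivAt (fun r => a r v) da s ∧ α * a s v ^ 2 ≤ da)
    (hx : HasDerivAt x (a t (x t) * X) t) (hy : HasDerivAt y (a t (y t) * Y) t)
    (hxy : y t ≤ x t) (hρ : X - Y - α * (x t - y t) < ρ) :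
    ∀ᶠ s in 𝓝[<] t, (∫ v in y t..x t, (a t v)⁻¹) - (∫ v in y s..x s, (a s v)⁻¹)
      ≤ ρ * (t - s) := by
  have hgs : ∀ s a' b', IntervalIntegrable (fun v => (a s v)⁻¹) volume a' b' := fun s a' b' =>
    (hg.comp (Continuous.prodMk_right s)).intervalIntegrable a' b'
  have hX := hasDerivAt_integral_moving_endpoint (g := fun s v => (a s v)⁻¹) hg hx
  have hY := hasDerivAt_integral_moving_endpoint (g := fun s v => (a s v)⁻¹) hg hy
  have hXY := (hX.sub hY).hasDerivWithinAt (s := Set.Iio t)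
  simp only [inv_mul_cancel_left₀ (ha t _).ne'] at hXY
  have hslope := (hasDerivWithinAt_iff_tendsto_slope' (by simp)).1 hXY
  have hlt : X - Y < ρ + α * (x t - y t) := by linarith
  filter_upwards [hslope.eventually (gt_mem_nhds hlt), eventually_inv_sub_inv_le ha hα,
    self_mem_nhdsWithin] with s hs hinv hst
  have hst : s < t := hst
  rw [slope_def_field, div_lt_iff_of_neg (by linarith)] at hs
  simp only [Pi.sub_apply, intervalIntegral.integral_same, sub_zero] at hs
  have hsplit : (∫ v in y s..x s, (a s v)⁻¹) = (∫ v in y t..x t, (a s v)⁻¹)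
      + (∫ v in x t..x s, (a s v)⁻¹) - ∫ v in y t..y s, (a s v)⁻¹ := by
    rw [intervalIntegral.integral_add_adjacent_intervals (hgs _ _ _) (hgs _ _ _),
      eq_sub_iff_add_eq', intervalIntegral.integral_add_adjacent_intervals (hgs _ _ _) (hgs _ _ _)]
  have hmono : (∫ v in y t..x t, ((a t v)⁻¹ - (a s v)⁻¹)) ≤ ∫ _ in y t..x t, (-α * (t - s)) :=
    intervalIntegral.integral_mono_on hxy ((hgs _ _ _).sub (hgs _ _ _)) intervalIntegrable_const
      fun v _ => hinv v
  rw [intervalIntegral.integral_sub (hgs _ _ _) (hgs _ _ _), intervalIntegral.integral_const,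
    smul_eq_mul] at hmono
  rw [hsplit]
  nlinarith [hs, hmono]

/-- If no `u i` can attain, to the right of `T`, a running maximum of the whole family that
exceeds `K`, then `K` bounds the family. -/
lemma le_of_no_running_max {ι : Type*} [Finite ι] {u : ι → ℝ → ℝ} (hu : ∀ i, Continuous (u i))
    {T K : ℝ} (hK : ∀ i, ∀ s ≤ T, u i s ≤ K)
    (h : ∀ i t, T < t → K < u i t → (∀ j, ∀ s ≤ t, u j s ≤ u i t) →
      ∀ᶠ s in 𝓝[<] t, u i t < u i s) (i : ι) (t : ℝ) : u i t ≤ K := by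
  by_contra! hlt
  have hTt : T < t := by
    by_contra! h'
    exact (hK i t h').not_gt hlt
  have hmax : ∀ j, ∃ m ∈ Set.Icc T t, ∀ s ∈ Set.Icc T t, u j s ≤ u j m := fun j =>
    isCompact_Icc.exists_isMaxOn (Set.nonempty_Icc.2 hTt.le) (hu j).continuousOn
  choose m hm hmle using hmax
  have : Nonempty ι := ⟨i⟩
  obtain ⟨k, hk⟩ := Finite.exists_max fun j => u j (m j)
  have hKk : K < u k (m k) := hlt.trans_le ((hmle i t ⟨hTt.le, le_rfl⟩).trans (hk i))
  have hTm : T < m k := by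
    by_contra! h'
    exact (hK k _ h').not_gt hKk
  have hrun : ∀ j, ∀ s ≤ m k, u j s ≤ u k (m k) := by
    intro j s hs
    rcases le_total s T with h' | h'
    · exact (hK j s h').trans hKk.le
    · exact (hmle j s ⟨h', hs.trans (hm k).2⟩).trans (hk j)
  obtain ⟨s, hs, hsm⟩ := ((h k (m k) hTm hKk hrun).and self_mem_nhdsWithin).exists
  exact (hrun k s (le_of_lt hsm)).not_gt hs

/-- A continuous function that decreases at a uniform rate whenever it exceeds `q` is eventually
at most `q`. -/
lemma eventually_le_of_left_slope_le {u : ℝ → ℝ} (hu : Continuous u) {T q κ : ℝ} (hκ : 0 < κ)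
    (h : ∀ t, T < t → q < u t → ∀ᶠ s in 𝓝[<] t, u t - u s ≤ -κ * (t - s)) :
    ∀ᶠ t in atTop, u t ≤ q := by
  obtain ⟨t₁, ht₁, hq⟩ : ∃ t₁ ≥ T, u t₁ ≤ q := by
    by_contra! hcon
    have hlin : ∀ t ≥ T, u t + κ / 2 * t ≤ u T + κ / 2 * T := by
      intro t ht
      refine le_of_no_running_max (ι := Unit)
        (u := fun _ t => u (max t T) + κ / 2 * max t T) (T := T) (fun _ => by fun_prop)
        (fun _ s hs => by simp [max_eq_right hs]) ?_ () t |>.trans_eq' (by simp [max_eq_left ht])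
      intro _ r hr _ _
      filter_upwards [h r hr (hcon r hr.le), self_mem_nhdsWithin,
        mem_nhdsWithin_of_mem_nhds (lt_mem_nhds hr)] with s hs hsr hTs
      have hsr : s < r := hsr
      rw [max_eq_left hr.le, max_eq_left (le_of_lt hTs)]
      nlinarith
    have hT := hcon T le_rfl
    have hge : T ≤ T + 2 * (u T - q) / κ := by
      have : 0 ≤ 2 * (u T - q) / κ := by
        apply div_nonneg <;> linarith
      linarith
    have h1 := hlin _ hge
    have h2 := hcon _ hge
    have h3 : κ / 2 * (T + 2 * (u T - q) / κ) = κ / 2 * T + (u T - q) := by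
      field_simp
    linarith
  filter_upwards [eventually_ge_atTop t₁] with t ht
  refine le_of_no_running_max (ι := Unit) (u := fun _ t => u (max t t₁)) (T := t₁)
    (fun _ => by fun_prop) (fun _ s hs => by simpa [max_eq_right hs] using hq) ?_ () t
    |>.trans_eq' (by simp [max_eq_left ht])
  intro _ r hr hqr _
  rw [max_eq_left hr.le] at hqr
  filter_upwards [h r (ht₁.trans_lt hr) hqr, self_mem_nhdsWithin,
    mem_nhdsWithin_of_mem_nhds (lt_mem_nhds hr)] with s hs hsr hTs
  have hsr : s < r := hsr
  rw [max_eq_left hr.le, max_eq_left (le_of_lt hTs)]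
  nlinarith

/-- The numerical constants occurring in (H2), (H5), (H6) and (H7). -/
structure CGConst (n P : ℕ) where
  aL : Fin (n+1) → ℝ
  aU : Fin (n+1) → ℝ
  γ1 : Fin (n+1) → Fin (n+1) → Fin (n+1) → Fin (P+1) → ℝ
  γ2 : Fin (n+1) → Fin (n+1) → Fin (n+1) → Fin (P+1) → ℝ
  μ1 : Fin (n+1) → Fin (n+1) → Fin (n+1) → Fin (P+1) → ℝ
  μ2 : Fin (n+1) → Fin (n+1) → Fin (n+1) → Fin (P+1) → ℝ
  ξ : Fin (n+1) → Fin (n+1) → Fin (P+1) → ℝ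
  Ξ : Fin (n+1) → Fin (n+1) → Fin (P+1) → ℝ
  ζ : Fin (n+1) → ℝ
  ς : Fin (n+1) → ℝ
  dv : Fin (n+1) → ℝ

namespace CGData

variable {n P : ℕ}

/-- The delayed contribution to the expression in (H7). -/
noncomputable def weight (S : CGData n P) (k : CGConst n P) (i : Fin (n+1)) (t : ℝ) : ℝ :=
  ∑ p : Fin (P+1), ∑ j : Fin (n+1), ∑ l : Fin (n+1),
    (k.ζ i * |S.c i j l p t| *
        (k.aU j * (k.dv j / k.dv i) * k.γ1 i j l p + k.aU l * (k.dv l / k.dv i) * k.γ2 i j l p)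
      + k.ς i * |S.d i j l p t| *
        (k.aU j * (k.dv j / k.dv i) * k.ξ i j p * k.μ1 i j l p
          + k.aU l * (k.dv l / k.dv i) * k.Ξ i l p * k.μ2 i j l p))

/-- The Lipschitz bound for the delayed terms in terms of the distances `D j = |x j - y j|`. -/
noncomputable def delayGap (S : CGData n P) (k : CGConst n P) (D : Fin (n+1) → ℝ → ℝ)
    (i : Fin (n+1)) (t : ℝ) : ℝ :=
  ∑ p : Fin (P+1), ∑ j : Fin (n+1), ∑ l : Fin (n+1),
    (k.ζ i * |S.c i j l p t| *
        (k.γ1 i j l p * D j (t - S.τ i j p t) + k.γ2 i j l p * D l (t - S.σ i l p t))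
      + k.ς i * |S.d i j l p t| *
        (k.μ1 i j l p * (k.ξ i j p * ∫ s in Set.Iic (0:ℝ), D j (t + s) ∂(S.η i j p))
          + k.μ2 i j l p * (k.Ξ i l p * ∫ s in Set.Iic (0:ℝ), D l (t + s) ∂(S.ρ i l p))))

/-- The bracket in the right-hand side of (1). -/
noncomputable def bracket (S : CGData n P) (x : Fin (n+1) → ℝ → ℝ) (i : Fin (n+1)) (t : ℝ) : ℝ :=
  -(S.b i t (x i t)) + S.F i (S.U x i t) (S.V x i t) + S.I i t

/-- The distance between `x t` and `y t` in the metric with density `1 / a`, divided by `d`.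
The time in `a` is clamped at `0`, so that this is continuous on all of `ℝ`. -/
noncomputable def wgap (S : CGData n P) (d : ℝ) (i : Fin (n+1)) (x y : ℝ → ℝ) (t : ℝ) : ℝ :=
  |∫ v in y t..x t, (S.a i (max t 0) v)⁻¹| / d

/-- The form in which the hypotheses (H1)-(H7) are used: the expression in (H7) is at most `-δ`
from time `T` on, and the resulting lower bound for the derivative of `a` is continuous in time. -/
structure Stable (S : CGData n P) (k : CGConst n P) (β : Fin (n+1) → ℝ → ℝ) (δ T : ℝ) :
    Prop where
  reg : S.Regular
  aL_pos : ∀ i, 0 < k.aL i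
  a_bounds : ∀ i, ∀ t ≥ (0:ℝ), ∀ v, k.aL i ≤ S.a i t v ∧ S.a i t v ≤ k.aU i
  h3 : S.H3 β
  h4 : S.H4
  h5 : S.H5 k.γ1 k.γ2 k.μ1 k.μ2
  h6 : S.H6 k.ξ k.Ξ k.ζ k.ς
  dv_pos : ∀ i, 0 < k.dv i
  δ_pos : 0 < δ
  T_nonneg : 0 ≤ T
  deriv_a : ∀ i, ∀ t ≥ T, ∀ v, ∃ da, HasDerivAt (fun s => S.a i s v) da t ∧
    ((δ + S.weight k i t) / k.aL i - β i t) * S.a i t v ^ 2 ≤ da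
  c_bdd : ∀ i j l p, S.c i j l p =O[atTop] fun _ => (1:ℝ)
  d_bdd : ∀ i j l p, S.d i j l p =O[atTop] fun _ => (1:ℝ)
  I_bdd : ∀ i, S.I i =O[atTop] fun _ => (1:ℝ)
  b_bdd : ∀ i u, (fun t => S.b i t u) =O[atTop] fun _ => (1:ℝ)

variable {S : CGData n P} {k : CGConst n P} {β : Fin (n+1) → ℝ → ℝ} {δ T : ℝ}

lemma Stable.mono (hS : S.Stable k β δ T) {T' : ℝ} (hT : T ≤ T') : S.Stable k β δ T' :=
  { hS with
    T_nonneg := hS.T_nonneg.trans hT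
    deriv_a := fun i t ht => hS.deriv_a i t (hT.trans ht) }

lemma Stable.aU_pos (hS : S.Stable k β δ T) (i : Fin (n+1)) : 0 < k.aU i :=
  (hS.aL_pos i).trans_le ((hS.a_bounds i 0 le_rfl 0).1.trans (hS.a_bounds i 0 le_rfl 0).2)

lemma Stable.weight_nonneg (hS : S.Stable k β δ T) (i : Fin (n+1)) (t : ℝ) :
    0 ≤ S.weight k i t := by
  have haU := hS.aU_pos
  have hdv := hS.dv_pos
  obtain ⟨hγ, -, -⟩ := hS.h5
  obtain ⟨hξ, hΞ, hζ, -⟩ := hS.h6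
  refine Finset.sum_nonneg fun p _ => Finset.sum_nonneg fun j _ => Finset.sum_nonneg fun l _ => ?_
  obtain ⟨h1, h2, h3, h4⟩ := hγ i j l p
  have := hζ i
  have := hξ i j p
  have := hΞ i l p
  have := haU j
  have := haU l
  have := hdv i
  have := hdv j
  have := hdv l
  obtain ⟨h5, h6⟩ := hζ i
  positivity

lemma continuousOn_weight (hreg : S.Regular) (k : CGConst n P) (i : Fin (n+1)) :
    ContinuousOn (S.weight k i) (Set.Ici 0) := by
  obtain ⟨-, -, -, hc, hd, -⟩ := hreg
  unfold weight
  refine continuousOn_finsetSum _ fun p _ => continuousOn_finsetSum _ fun j _ =>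
    continuousOn_finsetSum _ fun l _ => ?_
  have := hc i j l p
  have := hd i j l p
  fun_prop

lemma Stable.weight_bdd (hS : S.Stable k β δ T) (i : Fin (n+1)) :
    S.weight k i =O[atTop] fun _ => (1:ℝ) := by
  unfold weight
  refine Asymptotics.IsBigO.fun_sum fun p _ => Asymptotics.IsBigO.fun_sum fun j _ =>
    Asymptotics.IsBigO.fun_sum fun l _ => ?_
  have hc := (hS.c_bdd i j l p).norm_left
  have hd := (hS.d_bdd i j l p).norm_left
  simp only [Real.norm_eq_abs] at hc hd
  refine Asymptotics.IsBigO.add ?_ ?_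
  · simpa only [mul_assoc, mul_comm, mul_left_comm] using (hc.const_mul_left (k.ζ i *
      (k.aU j * (k.dv j / k.dv i) * k.γ1 i j l p + k.aU l * (k.dv l / k.dv i) * k.γ2 i j l p)))
  · simpa only [mul_assoc, mul_comm, mul_left_comm] using (hd.const_mul_left (k.ς i *
      (k.aU j * (k.dv j / k.dv i) * k.ξ i j p * k.μ1 i j l p
          + k.aU l * (k.dv l / k.dv i) * k.Ξ i l p * k.μ2 i j l p)))

/-- Bounds on the delayed distances in terms of a single `M` bound `delayGap`. -/
lemma Stable.delayGap_le (hS : S.Stable k β δ T) {D : Fin (n+1) → ℝ → ℝ} {i : Fin (n+1)} {t M : ℝ}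
    (hτ : ∀ j p, D j (t - S.τ i j p t) ≤ k.aU j * k.dv j * M)
    (hσ : ∀ l p, D l (t - S.σ i l p t) ≤ k.aU l * k.dv l * M)
    (hη : ∀ j p, ∫ s in Set.Iic (0:ℝ), D j (t + s) ∂(S.η i j p) ≤ k.aU j * k.dv j * M)
    (hρ : ∀ l p, ∫ s in Set.Iic (0:ℝ), D l (t + s) ∂(S.ρ i l p) ≤ k.aU l * k.dv l * M) :
    S.delayGap k D i t ≤ k.dv i * (S.weight k i t * M) := by
  obtain ⟨hγ, -, -⟩ := hS.h5
  obtain ⟨hξ, hΞ, hζ, -⟩ := hS.h6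
  have hdi := hS.dv_pos i
  unfold delayGap weight
  simp only [Finset.sum_mul, Finset.mul_sum]
  refine Finset.sum_le_sum fun p _ => Finset.sum_le_sum fun j _ => Finset.sum_le_sum fun l _ => ?_
  obtain ⟨h1, h2, h3, h4⟩ := hγ i j l p
  obtain ⟨h5, h6⟩ := hζ i
  have h7 := hξ i j p
  have h8 := hΞ i l p
  calc _ ≤ k.ζ i * |S.c i j l p t| *
        (k.γ1 i j l p * (k.aU j * k.dv j * M) + k.γ2 i j l p * (k.aU l * k.dv l * M))
      + k.ς i * |S.d i j l p t| *
        (k.μ1 i j l p * (k.ξ i j p * (k.aU j * k.dv j * M))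
          + k.μ2 i j l p * (k.Ξ i l p * (k.aU l * k.dv l * M))) := by
        gcongr
        exacts [hτ j p, hσ l p, hη j p, hρ l p]
    _ = _ := by
        field_simp

lemma integrableOn_comp_delay {ν : Measure ℝ} [IsFiniteMeasure ν] {g x : ℝ → ℝ}
    (hg : Continuous g) (hx : Continuous x) {t M : ℝ} (hM : ∀ s ≤ t, |x s| ≤ M) :
    IntegrableOn (fun s => g (x (t + s))) (Set.Iic 0) ν := by
  obtain ⟨C, hC⟩ := (isCompact_Icc (a := -M) (b := M)).exists_bound_of_continuousOn hg.continuousOn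
  refine Integrable.of_bound (by fun_prop) C ?_
  filter_upwards [ae_restrict_mem measurableSet_Iic] with s hs
  exact hC _ (abs_le.1 (hM _ (by linarith [Set.mem_Iic.1 hs])))

lemma abs_integral_comp_delay_sub_le {ν : Measure ℝ} [IsFiniteMeasure ν] {g x y : ℝ → ℝ}
    (hg : Continuous g) (hx : Continuous x) (hy : Continuous y) {t M L : ℝ}
    (hxM : ∀ s ≤ t, |x s| ≤ M) (hyM : ∀ s ≤ t, |y s| ≤ M)
    (hL : ∀ u v, |g u - g v| ≤ L * |u - v|) :
    |(∫ s in Set.Iic (0:ℝ), g (x (t + s)) ∂ν) - ∫ s in Set.Iic (0:ℝ), g (y (t + s)) ∂ν|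
      ≤ L * ∫ s in Set.Iic (0:ℝ), |x (t + s) - y (t + s)| ∂ν := by
  have hxi := integrableOn_comp_delay (ν := ν) hg hx hxM
  have hyi := integrableOn_comp_delay (ν := ν) hg hy hyM
  have hxi' := integrableOn_comp_delay (ν := ν) continuous_id hx hxM
  have hyi' := integrableOn_comp_delay (ν := ν) continuous_id hy hyM
  rw [← integral_sub hxi hyi, ← integral_const_mul]
  refine (abs_integral_le_integral_abs).trans
    (integral_mono (hxi.sub hyi).abs ((hxi'.sub hyi').abs.const_mul L) fun s => hL _ _)

lemma Stable.abs_F_sub_le (hS : S.Stable k β δ T) {x y : Fin (n+1) → ℝ → ℝ}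
    (hx : ∀ i, Continuous (x i)) (hy : ∀ i, Continuous (y i)) {t M : ℝ}
    (hxM : ∀ i, ∀ s ≤ t, |x i s| ≤ M) (hyM : ∀ i, ∀ s ≤ t, |y i s| ≤ M) (i : Fin (n+1)) :
    |S.F i (S.U x i t) (S.V x i t) - S.F i (S.U y i t) (S.V y i t)|
      ≤ S.delayGap k (fun j s => |x j s - y j s|) i t := by
  obtain ⟨ha, hapos, hb, hc, hd, hI, hτ, hσ, hτ0, hσ0, hF, hh, hf, hg, hG, hη, hρ⟩ := hS.reg
  obtain ⟨hγ, hhL, hfL⟩ := hS.h5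
  obtain ⟨hξ, hΞ, hζ, hgL, hGL, hFL⟩ := hS.h6
  obtain ⟨hζi, hςi⟩ := hζ i
  have hU : |S.U x i t - S.U y i t| ≤ ∑ p : Fin (P+1), ∑ j : Fin (n+1), ∑ l : Fin (n+1),
      |S.c i j l p t| * (k.γ1 i j l p * |x j (t - S.τ i j p t) - y j (t - S.τ i j p t)|
        + k.γ2 i j l p * |x l (t - S.σ i l p t) - y l (t - S.σ i l p t)|) := by
    unfold U
    simp only [← Finset.sum_sub_distrib, ← mul_sub]
    refine (Finset.abs_sum_le_sum_abs _ _).trans (Finset.sum_le_sum fun p _ => ?_)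
    refine (Finset.abs_sum_le_sum_abs _ _).trans (Finset.sum_le_sum fun j _ => ?_)
    refine (Finset.abs_sum_le_sum_abs _ _).trans (Finset.sum_le_sum fun l _ => ?_)
    rw [abs_mul]
    gcongr
    exact hhL ..
  have hV : |S.V x i t - S.V y i t| ≤ ∑ p : Fin (P+1), ∑ j : Fin (n+1), ∑ l : Fin (n+1),
      |S.d i j l p t| *
        (k.μ1 i j l p * (k.ξ i j p *
            ∫ s in Set.Iic (0:ℝ), |x j (t + s) - y j (t + s)| ∂(S.η i j p))
          + k.μ2 i j l p * (k.Ξ i l p *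
            ∫ s in Set.Iic (0:ℝ), |x l (t + s) - y l (t + s)| ∂(S.ρ i l p))) := by
    unfold V
    simp only [← Finset.sum_sub_distrib, ← mul_sub]
    refine (Finset.abs_sum_le_sum_abs _ _).trans (Finset.sum_le_sum fun p _ => ?_)
    refine (Finset.abs_sum_le_sum_abs _ _).trans (Finset.sum_le_sum fun j _ => ?_)
    refine (Finset.abs_sum_le_sum_abs _ _).trans (Finset.sum_le_sum fun l _ => ?_)
    obtain ⟨-, -, h3, h4⟩ := hγ i j l p
    have := (hη i j p).1
    have := (hρ i l p).1
    rw [abs_mul]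
    refine mul_le_mul_of_nonneg_left ((hfL ..).trans ?_) (abs_nonneg _)
    gcongr
    · exact abs_integral_comp_delay_sub_le (hg i j p) (hx j) (hy j) (hxM j) (hyM j) (hgL i j p)
    · exact abs_integral_comp_delay_sub_le (hG i l p) (hx l) (hy l) (hxM l) (hyM l) (hGL i l p)
  refine (hFL i _ _ _ _).trans ?_
  refine (add_le_add (mul_le_mul_of_nonneg_left hU hζi.le)
    (mul_le_mul_of_nonneg_left hV hςi.le)).trans_eq ?_
  unfold delayGap
  simp only [Finset.mul_sum, ← Finset.sum_add_distrib, mul_assoc]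

lemma Stable.continuous_inv_a (hS : S.Stable k β δ T) (i : Fin (n+1)) :
    Continuous fun q : ℝ × ℝ => (S.a i (max q.1 0) q.2)⁻¹ := by
  obtain ⟨ha, hapos, -⟩ := hS.reg
  refine Continuous.inv₀ ?_ fun q => (hapos i _ (le_max_right _ _) _).ne'
  exact (ha i).comp_continuous (f := fun q : ℝ × ℝ => (max q.1 0, q.2)) (by fun_prop)
    fun q => ⟨Set.mem_Ici.2 (le_max_right _ _), trivial⟩

lemma wgap_comm (S : CGData n P) (d : ℝ) (i : Fin (n+1)) (x y : ℝ → ℝ) (t : ℝ) :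
    S.wgap d i x y t = S.wgap d i y x t := by
  unfold wgap
  rw [intervalIntegral.integral_symm, abs_neg]

lemma Stable.continuous_wgap (hS : S.Stable k β δ T) (d : ℝ) (i : Fin (n+1)) {x y : ℝ → ℝ}
    (hx : Continuous x) (hy : Continuous y) : Continuous (S.wgap d i x y) := by
  have hg := hS.continuous_inv_a i
  have hprim := intervalIntegral.continuous_parametric_primitive_of_continuous
    (f := fun t v => (S.a i (max t 0) v)⁻¹) (a₀ := 0) (μ := volume) hg
  have hint : ∀ t a b, IntervalIntegrable (fun v => (S.a i (max t 0) v)⁻¹) volume a b :=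
    fun t a b => (hg.comp (Continuous.prodMk_right t)).intervalIntegrable a b
  have heq : S.wgap d i x y = fun t => |(∫ v in (0:ℝ)..x t, (S.a i (max t 0) v)⁻¹)
      - ∫ v in (0:ℝ)..y t, (S.a i (max t 0) v)⁻¹| / d := by
    funext t
    rw [intervalIntegral.integral_interval_sub_left (hint _ _ _) (hint _ _ _)]
    rfl
  rw [heq]
  exact (((hprim.comp (continuous_id.prodMk hx)).sub
    (hprim.comp (continuous_id.prodMk hy))).abs).div_const d

lemma wgap_nonneg (S : CGData n P) {d : ℝ} (hd : 0 < d) (i : Fin (n+1)) (x y : ℝ → ℝ) (t : ℝ) :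
    0 ≤ S.wgap d i x y t := by
  unfold wgap
  positivity

lemma Stable.mul_wgap_le (hS : S.Stable k β δ T) (i : Fin (n+1)) (x y : ℝ → ℝ) (t : ℝ) :
    k.aL i * k.dv i * S.wgap (k.dv i) i x y t ≤ |x t - y t| := by
  have hd := hS.dv_pos i
  have haL := hS.aL_pos i
  have := intervalIntegral.norm_integral_le_of_norm_le_const (a := y t) (b := x t)
    (f := fun v => (S.a i (max t 0) v)⁻¹) (C := (k.aL i)⁻¹) fun v _ => by
      have h := (hS.a_bounds i (max t 0) (le_max_right _ _) v).1
      rw [Real.norm_eq_abs, abs_of_pos (inv_pos.2 (haL.trans_le h))]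
      exact inv_anti₀ haL h
  rw [Real.norm_eq_abs, inv_mul_eq_div, le_div_iff₀ haL] at this
  unfold wgap
  calc _ = |∫ v in y t..x t, (S.a i (max t 0) v)⁻¹| * k.aL i := by field_simp
    _ ≤ _ := this

lemma Stable.abs_sub_le_wgap (hS : S.Stable k β δ T) (i : Fin (n+1)) (x y : ℝ → ℝ) (t : ℝ) :
    |x t - y t| ≤ k.aU i * k.dv i * S.wgap (k.dv i) i x y t := by
  wlog hxy : y t ≤ x t generalizing x y
  · rw [abs_sub_comm, wgap_comm]
    exact this y x (le_of_not_ge hxy)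
  have hd := hS.dv_pos i
  have haU := hS.aU_pos i
  have hg := hS.continuous_inv_a i
  have := intervalIntegral.integral_mono_on (μ := volume) (f := fun _ => (k.aU i)⁻¹) hxy
    intervalIntegrable_const
    ((hg.comp (Continuous.prodMk_right t)).intervalIntegrable (y t) (x t)) fun v _ => by
      have h := hS.a_bounds i (max t 0) (le_max_right _ _) v
      exact inv_anti₀ ((hS.aL_pos i).trans_le h.1) h.2
  rw [intervalIntegral.integral_const, smul_eq_mul] at this
  unfold wgap
  rw [abs_of_nonneg (sub_nonneg.2 hxy)]
  calc x t - y t = k.aU i * ((x t - y t) * (k.aU i)⁻¹) := by field_simp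
    _ ≤ k.aU i * |∫ v in y t..x t, (S.a i (max t 0) v)⁻¹| :=
      mul_le_mul_of_nonneg_left (this.trans (le_abs_self _)) haU.le
    _ = _ := by field_simp

end CGData

namespace CGData

variable {n P : ℕ} {S : CGData n P} {k : CGConst n P} {β : Fin (n+1) → ℝ → ℝ} {δ T : ℝ}

lemma Stable.eventually_wgap_sub_le_of_lt (hS : S.Stable k β δ T) {i : Fin (n+1)} {t : ℝ}
    (ht : T < t) {x y : ℝ → ℝ} {X Y N ρ : ℝ} (hx : HasDerivAt x (S.a i t (x t) * X) t)
    (hy : HasDerivAt y (S.a i t (y t) * Y) t) (hxy : y t < x t)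
    (hXY : X - Y ≤ -β i t * (x t - y t) + N)
    (hρ : -(δ + S.weight k i t) * S.wgap (k.dv i) i x y t + N / k.dv i < ρ) :
    ∀ᶠ s in 𝓝[<] t, S.wgap (k.dv i) i x y t - S.wgap (k.dv i) i x y s ≤ ρ * (t - s) := by
  have hd := hS.dv_pos i
  have haL := hS.aL_pos i
  have ht0 : 0 < t := hS.T_nonneg.trans_lt ht
  have hmax : max t 0 = t := max_eq_left ht0.le
  set W := δ + S.weight k i t with hW
  have hWpos : 0 < W := add_pos_of_pos_of_nonneg hS.δ_pos (hS.weight_nonneg i t)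
  have hlow : W / k.aL i * (x t - y t) ≥ W * (k.dv i * S.wgap (k.dv i) i x y t) := by
    have := hS.mul_wgap_le i x y t
    rw [abs_of_pos (sub_pos.2 hxy)] at this
    rw [ge_iff_le, div_mul_eq_mul_div, le_div_iff₀ haL]
    nlinarith
  have hkey : (X - Y - k.dv i * ρ) / (x t - y t) < W / k.aL i - β i t := by
    rw [div_lt_iff₀ (sub_pos.2 hxy)]
    have h2 : k.dv i * (-W * S.wgap (k.dv i) i x y t + N / k.dv i) < k.dv i * ρ :=
      mul_lt_mul_of_pos_left hρ hd
    have h3 : k.dv i * (N / k.dv i) = N := by field_simp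
    rw [mul_add, h3] at h2
    linarith
  obtain ⟨α, hα1, hα2⟩ := exists_between hkey
  rw [div_lt_iff₀ (sub_pos.2 hxy)] at hα1
  have hmem : Set.Ici (0:ℝ) ∈ 𝓝 t := Ici_mem_nhds ht0
  have hcont : ContinuousAt (fun s => (δ + S.weight k i s) / k.aL i - β i s) t :=
    ((((continuousOn_weight hS.reg k i).continuousAt hmem).const_add δ).div_const _).sub
      ((hS.h3.1 i).continuousAt hmem)
  have hderiv : ∀ᶠ s in 𝓝 t, ∀ v, ∃ da, HasDerivAt (fun r => S.a i (max r 0) v) da s ∧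
      α * S.a i (max s 0) v ^ 2 ≤ da := by
    filter_upwards [hcont.eventually (lt_mem_nhds hα2), lt_mem_nhds ht] with s hs hTs v
    have hs0 : 0 < s := hS.T_nonneg.trans_lt hTs
    obtain ⟨da, hda, hle⟩ := hS.deriv_a i s (le_of_lt hTs) v
    refine ⟨da, hda.congr_of_eventuallyEq ?_, ?_⟩
    · filter_upwards [lt_mem_nhds hs0] with r hr
      rw [max_eq_left (le_of_lt hr)]
    · rw [max_eq_left hs0.le]
      exact (mul_le_mul_of_nonneg_right hs.le (sq_nonneg _)).trans hle
  have hev := eventually_integral_inv_sub_le (a := fun r v => S.a i (max r 0) v) (x := x) (y := y)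
    (X := X) (Y := Y) (ρ := k.dv i * ρ) (hS.continuous_inv_a i)
    (fun s v => hS.reg.2.1 i _ (le_max_right _ _) v) hderiv (by simpa [hmax] using hx)
    (by simpa [hmax] using hy) hxy.le (by linarith)
  filter_upwards [hev] with s hs
  have hpos : 0 ≤ ∫ v in y t..x t, (S.a i (max t 0) v)⁻¹ :=
    intervalIntegral.integral_nonneg hxy.le fun v _ =>
      (inv_pos.2 (hS.reg.2.1 i _ (le_max_right _ _) v)).le
  unfold wgap
  rw [← sub_div, div_le_iff₀ hd, abs_of_nonneg hpos]
  have := le_abs_self (∫ v in y s..x s, (S.a i (max s 0) v)⁻¹)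
  linarith

/-- Left difference quotients of the weighted distance between a solution `x` and a solution `y`
of the system perturbed by `E`. -/
lemma Stable.eventually_wgap_sub_le (hS : S.Stable k β δ T) {x y E : Fin (n+1) → ℝ → ℝ}
    (hxc : ∀ i, Continuous (x i)) (hyc : ∀ i, Continuous (y i)) {t M : ℝ} (ht : T < t)
    (hxM : ∀ i, ∀ s ≤ t, |x i s| ≤ M) (hyM : ∀ i, ∀ s ≤ t, |y i s| ≤ M) {i : Fin (n+1)}
    (hx : HasDerivAt (x i) (S.a i t (x i t) * S.bracket x i t) t)
    (hy : HasDerivAt (y i) (S.a i t (y i t) * (S.bracket y i t - E i t)) t)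
    (hpos : 0 < S.wgap (k.dv i) i (x i) (y i) t) {ρ : ℝ}
    (hρ : -(δ + S.weight k i t) * S.wgap (k.dv i) i (x i) (y i) t
      + (S.delayGap k (fun j s => |x j s - y j s|) i t + |E i t|) / k.dv i < ρ) :
    ∀ᶠ s in 𝓝[<] t, S.wgap (k.dv i) i (x i) (y i) t - S.wgap (k.dv i) i (x i) (y i) s
      ≤ ρ * (t - s) := by
  have hF := abs_le.1 (hS.abs_F_sub_le hxc hyc hxM hyM i)
  have hE := abs_le.1 (le_refl |E i t|)
  have ht0 : 0 ≤ t := hS.T_nonneg.trans ht.le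
  have hne : x i t ≠ y i t := by
    intro h
    simp [wgap, h] at hpos
  have hβ := hS.h3.2.2 i t ht0
  rcases lt_or_gt_of_ne hne with hlt | hlt
  · simp only [wgap_comm S (k.dv i) i (x i) (y i)] at hρ ⊢
    refine hS.eventually_wgap_sub_le_of_lt ht hy hx hlt ?_ hρ
    have := hβ _ _ hlt.ne'
    rw [le_div_iff₀ (sub_pos.2 hlt)] at this
    unfold bracket
    linarith
  · refine hS.eventually_wgap_sub_le_of_lt ht hx hy hlt ?_ hρ
    have := hβ _ _ hlt.ne'
    rw [le_div_iff₀ (sub_pos.2 hlt)] at this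
    unfold bracket
    linarith

lemma setIntegral_Iic_le {ν : Measure ℝ} [IsProbabilityMeasure ν] {D : ℝ → ℝ}
    {t C : ℝ} (hC : 0 ≤ C) (hD : ∀ s ≤ t, D s ≤ C) (hD0 : ∀ s, 0 ≤ D s) :
    ∫ s in Set.Iic (0:ℝ), D (t + s) ∂ν ≤ C := by
  have h : ∫ s in Set.Iic (0:ℝ), D (t + s) ∂ν ≤ ∫ _ in Set.Iic (0:ℝ), C ∂ν := by
    refine integral_mono_of_nonneg (Eventually.of_forall fun s => hD0 _) (integrable_const C) ?_
    filter_upwards [ae_restrict_mem measurableSet_Iic] with s hs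
    exact hD _ (by linarith [Set.mem_Iic.1 hs])
  refine h.trans ?_
  rw [integral_const, smul_eq_mul, measureReal_restrict_apply_univ]
  exact mul_le_of_le_one_left hC measureReal_le_one

/-- Distributed delays forget the past: an eventual bound passes to the delayed averages. -/
lemma eventually_setIntegral_Iic_le {ν : Measure ℝ} [IsProbabilityMeasure ν] {D : ℝ → ℝ}
    (hDc : Continuous D) {C L L' : ℝ} (hL : 0 ≤ L) (hLL' : L < L') (hC : ∀ s, |D s| ≤ C)
    (hD : ∀ᶠ s in atTop, D s ≤ L) :
    ∀ᶠ t in atTop, ∫ s in Set.Iic (0:ℝ), D (t + s) ∂ν ≤ L' := by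
  have hC0 : 0 ≤ C := (abs_nonneg _).trans (hC 0)
  have hbd : ∀ t s, ‖max (D (t + s)) L‖ ≤ C + L := by
    intro t s
    have := abs_le.1 (hC (t + s))
    rw [Real.norm_eq_abs, abs_of_nonneg (hL.trans (le_max_right _ _))]
    exact max_le (by linarith) (by linarith)
  have hlim : Tendsto (fun t => ∫ s in Set.Iic (0:ℝ), max (D (t + s)) L ∂ν) atTop
      (𝓝 (∫ _ in Set.Iic (0:ℝ), L ∂ν)) := by
    refine tendsto_integral_filter_of_dominated_convergence (fun _ => C + L) ?_ ?_
      (integrable_const _) ?_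
    · exact Eventually.of_forall fun t => by fun_prop
    · exact Eventually.of_forall fun t => Eventually.of_forall (hbd t)
    · refine Eventually.of_forall fun s => tendsto_const_nhds.congr' ?_
      filter_upwards [(tendsto_atTop_add_const_right atTop s tendsto_id).eventually hD] with t ht
      exact (max_eq_right ht).symm
  have hlt : ∫ _ in Set.Iic (0:ℝ), L ∂ν < L' := by
    rw [integral_const, smul_eq_mul, measureReal_restrict_apply_univ]
    exact (mul_le_of_le_one_left hL measureReal_le_one).trans_lt hLL'
  filter_upwards [hlim.eventually (gt_mem_nhds hlt)] with t ht
  refine le_trans ?_ ht.le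
  refine integral_mono (Integrable.of_bound (by fun_prop) C (Eventually.of_forall fun s => ?_))
    (Integrable.of_bound (by fun_prop) (C + L) (Eventually.of_forall (hbd t)))
    fun s => le_max_left _ _
  exact hC _

/-- A bounded perturbation of (1) keeps solutions at bounded distance. -/
lemma Stable.exists_abs_sub_le (hS : S.Stable k β δ T) {x y E : Fin (n+1) → ℝ → ℝ}
    (hxc : ∀ i, Continuous (x i)) (hyc : ∀ i, Continuous (y i)) {M C : ℝ}
    (hxM : ∀ i, ∀ s ≤ T, |x i s| ≤ M) (hyM : ∀ i, ∀ s ≤ T, |y i s| ≤ M)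
    (hE : ∀ i, ∀ t > T, |E i t| ≤ C)
    (hx : ∀ i, ∀ t > T, HasDerivAt (x i) (S.a i t (x i t) * S.bracket x i t) t)
    (hy : ∀ i, ∀ t > T, HasDerivAt (y i) (S.a i t (y i t) * (S.bracket y i t - E i t)) t) :
    ∃ K, ∀ i t, |x i t - y i t| ≤ K := by
  have hδ := hS.δ_pos
  set u : Fin (n+1) → ℝ → ℝ := fun i => S.wgap (k.dv i) i (x i) (y i) with hu
  have hu0 : ∀ i t, 0 ≤ u i t := fun i t => S.wgap_nonneg (hS.dv_pos i) i _ _ t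
  obtain ⟨K₁, hK₁⟩ := Finite.exists_le fun i => 2 * M / (k.aL i * k.dv i)
  obtain ⟨K₂, hK₂⟩ := Finite.exists_le fun i => C / k.dv i / δ
  obtain ⟨K₃, hK₃⟩ := Finite.exists_le fun i => k.aU i * k.dv i
  set K := max (max K₁ K₂) 0 with hK
  have hle : ∀ i t, u i t ≤ K := by
    refine le_of_no_running_max (T := T)
      (fun i => hS.continuous_wgap _ i (hxc i) (hyc i)) (fun i s hs => ?_) ?_
    · refine le_trans ?_ ((hK₁ i).trans ((le_max_left _ _).trans (le_max_left _ _)))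
      have hpos : 0 < k.aL i * k.dv i := mul_pos (hS.aL_pos i) (hS.dv_pos i)
      rw [le_div_iff₀' hpos]
      refine (hS.mul_wgap_le i (x i) (y i) s).trans ?_
      have h1 := abs_le.1 (hxM i s hs)
      have h2 := abs_le.1 (hyM i s hs)
      exact abs_le.2 ⟨by linarith, by linarith⟩
    · intro i t ht hKu hrun
      have hdi := hS.dv_pos i
      choose Mx hMx using fun j => exists_abs_le_of_bounded_Iic (hxc j) (hxM j) t
      choose My hMy using fun j => exists_abs_le_of_bounded_Iic (hyc j) (hyM j) t
      obtain ⟨M₁, hM₁⟩ := Finite.exists_le Mx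
      obtain ⟨M₂, hM₂⟩ := Finite.exists_le My
      have hpos : 0 < u i t := (le_max_right _ _).trans_lt hKu
      have ht0 : 0 ≤ t := hS.T_nonneg.trans ht.le
      obtain ⟨-, -, -, -, -, -, -, -, hτ0, hσ0, -, -, -, -, -, hη, hρ⟩ := hS.reg
      have hD : ∀ j, ∀ s ≤ t, |x j s - y j s| ≤ k.aU j * k.dv j * u i t := fun j s hs =>
        (hS.abs_sub_le_wgap j (x j) (y j) s).trans
          (mul_le_mul_of_nonneg_left (hrun j s hs)
            (mul_pos (hS.aU_pos j) (hS.dv_pos j)).le)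
      have hD0 : ∀ j, 0 ≤ k.aU j * k.dv j * u i t := fun j =>
        (mul_pos (mul_pos (hS.aU_pos j) (hS.dv_pos j)) hpos).le
      have hgap : S.delayGap k (fun j s => |x j s - y j s|) i t
          ≤ k.dv i * (S.weight k i t * u i t) := by
        refine hS.delayGap_le (fun j p => hD j _ (by linarith [hτ0 i j p t ht0]))
          (fun l p => hD l _ (by linarith [hσ0 i l p t ht0])) (fun j p => ?_) (fun l p => ?_)
        · have := (hη i j p).1
          exact setIntegral_Iic_le (D := fun s => |x j s - y j s|) (hD0 j) (hD j)
            fun s => abs_nonneg _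
        · have := (hρ i l p).1
          exact setIntegral_Iic_le (D := fun s => |x l s - y l s|) (hD0 l) (hD l)
            fun s => abs_nonneg _
      have hCu : C / k.dv i < δ * u i t := by
        have h1 : C / k.dv i / δ < u i t :=
          ((hK₂ i).trans ((le_max_right _ _).trans (le_max_left _ _))).trans_lt hKu
        rwa [div_lt_iff₀' hδ] at h1
      have hneg : -(δ + S.weight k i t) * u i t
          + (S.delayGap k (fun j s => |x j s - y j s|) i t + |E i t|) / k.dv i < 0 := by
        have h1 : (S.delayGap k (fun j s => |x j s - y j s|) i t + |E i t|) / k.dv i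
            ≤ S.weight k i t * u i t + C / k.dv i := by
          rw [add_div]
          refine add_le_add ?_ (div_le_div_of_nonneg_right (hE i t ht) hdi.le)
          rwa [div_le_iff₀' hdi]
        linarith
      obtain ⟨ρ, hρ1, hρ2⟩ := exists_between hneg
      filter_upwards [hS.eventually_wgap_sub_le hxc hyc ht (M := max M₁ M₂)
        (fun j s hs => (hMx j s hs).trans ((hM₁ j).trans (le_max_left _ _)))
        (fun j s hs => (hMy j s hs).trans ((hM₂ j).trans (le_max_right _ _))) (hx i t ht) (hy i t ht) hpos hρ1,
        self_mem_nhdsWithin] with s hs hst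
      have hst : s < t := hst
      have := mul_neg_of_neg_of_pos hρ2 (sub_pos.2 hst)
      linarith
  refine ⟨K₃ * K, fun i t => (hS.abs_sub_le_wgap i (x i) (y i) t).trans ?_⟩
  exact mul_le_mul (hK₃ i) (hle i t) (hu0 i t)
    ((mul_pos (hS.aU_pos i) (hS.dv_pos i)).le.trans (hK₃ i))

/-- A vanishing perturbation of (1) does not affect the asymptotic behaviour of bounded
solutions. -/
lemma Stable.tendsto_abs_sub (hS : S.Stable k β δ T) {x y E : Fin (n+1) → ℝ → ℝ}
    (hxc : ∀ i, Continuous (x i)) (hyc : ∀ i, Continuous (y i)) {M : ℝ}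
    (hxM : ∀ i s, |x i s| ≤ M) (hyM : ∀ i s, |y i s| ≤ M)
    (hE : ∀ i, Tendsto (E i) atTop (𝓝 0))
    (hx : ∀ i, ∀ t > T, HasDerivAt (x i) (S.a i t (x i t) * S.bracket x i t) t)
    (hy : ∀ i, ∀ t > T, HasDerivAt (y i) (S.a i t (y i t) * (S.bracket y i t - E i t)) t)
    (i : Fin (n+1)) : Tendsto (fun t => |x i t - y i t|) atTop (𝓝 0) := by
  have hδ := hS.δ_pos
  set u : Fin (n+1) → ℝ → ℝ := fun i => S.wgap (k.dv i) i (x i) (y i) with hu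
  have hu0 : ∀ i t, 0 ≤ u i t := fun i t => S.wgap_nonneg (hS.dv_pos i) i _ _ t
  have hDM : ∀ j s, |x j s - y j s| ≤ 2 * M := fun j s => by
    have h1 := abs_le.1 (hxM j s)
    have h2 := abs_le.1 (hyM j s)
    exact abs_le.2 ⟨by linarith, by linarith⟩
  obtain ⟨-, -, -, -, -, -, -, -, -, -, -, -, -, -, -, hη, hρ⟩ := hS.reg
  have hwt : ∃ R, 0 ≤ R ∧ ∀ i, ∀ᶠ t in atTop, S.weight k i t ≤ R := by
    choose c hc using fun i => (hS.weight_bdd i).bound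
    obtain ⟨R, hR⟩ := Finite.exists_le c
    refine ⟨max R 0, le_max_right _ _, fun i => ?_⟩
    filter_upwards [hc i] with t ht
    rw [norm_one, mul_one] at ht
    exact (le_abs_self _).trans (ht.trans ((hR i).trans (le_max_left _ _)))
  obtain ⟨R, hR0, hR⟩ := hwt
  -- eventual bounds `L` can be improved to `θ * L'` for every `L' > L`
  set θ := (R + δ / 2) / (R + δ) with hθ
  have hθ0 : 0 < θ := by positivity
  have hθ1 : θ < 1 := by
    rw [hθ, div_lt_one (by positivity)]
    linarith
  have hθR : (R + δ) * θ = R + δ / 2 := by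
    rw [hθ]
    field_simp
  have himprove : ∀ L L', 0 ≤ L → L < L' → (∀ i, ∀ᶠ t in atTop, u i t ≤ L) →
      ∀ i, ∀ᶠ t in atTop, u i t ≤ θ * L' := by
    intro L L' hL hLL' hev i
    have hL' : 0 < L' := hL.trans_lt hLL'
    have hdi := hS.dv_pos i
    have hAd : ∀ j, 0 < k.aU j * k.dv j := fun j => mul_pos (hS.aU_pos j) (hS.dv_pos j)
    have hDL : ∀ j, ∀ᶠ t in atTop, |x j t - y j t| ≤ k.aU j * k.dv j * L := by
      intro j
      filter_upwards [hev j] with t ht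
      exact (hS.abs_sub_le_wgap j (x j) (y j) t).trans
        (mul_le_mul_of_nonneg_left ht (hAd j).le)
    have hADL : ∀ j, k.aU j * k.dv j * L ≤ k.aU j * k.dv j * L' := fun j =>
      mul_le_mul_of_nonneg_left hLL'.le (hAd j).le
    have hgap : ∀ᶠ t in atTop, S.delayGap k (fun j s => |x j s - y j s|) i t
        ≤ k.dv i * (S.weight k i t * L') := by
      have h1 : ∀ᶠ t in atTop, ∀ j p, |x j (t - S.τ i j p t) - y j (t - S.τ i j p t)|
          ≤ k.aU j * k.dv j * L' := by
        simp only [eventually_all]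
        intro j p
        filter_upwards [(hS.h4.1 i j p).eventually (hDL j)] with t ht
        exact ht.trans (hADL j)
      have h2 : ∀ᶠ t in atTop, ∀ l p, |x l (t - S.σ i l p t) - y l (t - S.σ i l p t)|
          ≤ k.aU l * k.dv l * L' := by
        simp only [eventually_all]
        intro l p
        filter_upwards [(hS.h4.2 i l p).eventually (hDL l)] with t ht
        exact ht.trans (hADL l)
      have hint : ∀ (ν : Measure ℝ) [IsProbabilityMeasure ν] j, ∀ᶠ t in atTop,
          ∫ s in Set.Iic (0:ℝ), |x j (t + s) - y j (t + s)| ∂ν ≤ k.aU j * k.dv j * L' := by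
        intro ν _ j
        exact eventually_setIntegral_Iic_le (D := fun s => |x j s - y j s|)
          ((hxc j).sub (hyc j)).abs (mul_nonneg (hAd j).le hL)
          (mul_lt_mul_of_pos_left hLL' (hAd j)) (fun s => by rw [abs_abs]; exact hDM j s) (hDL j)
      have h3 : ∀ᶠ t in atTop, ∀ j p, ∫ s in Set.Iic (0:ℝ), |x j (t + s) - y j (t + s)| ∂(S.η i j p)
          ≤ k.aU j * k.dv j * L' := by
        simp only [eventually_all]
        intro j p
        have := (hη i j p).1
        exact hint _ j
      have h4 : ∀ᶠ t in atTop, ∀ l p, ∫ s in Set.Iic (0:ℝ), |x l (t + s) - y l (t + s)| ∂(S.ρ i l p)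
          ≤ k.aU l * k.dv l * L' := by
        simp only [eventually_all]
        intro l p
        have := (hρ i l p).1
        exact hint _ l
      filter_upwards [h1, h2, h3, h4] with t h1 h2 h3 h4
      exact hS.delayGap_le h1 h2 h3 h4
    have hEε : ∀ᶠ t in atTop, |E i t| / k.dv i ≤ L' * δ / 8 := by
      have : Tendsto (fun t => |E i t| / k.dv i) atTop (𝓝 0) := by
        simpa using ((hE i).abs).div_const (k.dv i)
      exact this.eventually (ge_mem_nhds (by positivity))
    obtain ⟨T', hT'⟩ := eventually_atTop.1 ((hgap.and hEε).and (hR i))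
    refine eventually_le_of_left_slope_le (hS.continuous_wgap _ i (hxc i) (hyc i)) (T := max T T')
      (κ := L' * δ / 8) (by positivity) fun t ht hq => ?_
    have htT : T < t := (le_max_left _ _).trans_lt ht
    obtain ⟨⟨hg, he⟩, hRt⟩ := hT' t ((le_max_right _ _).trans ht.le)
    have hw := hS.weight_nonneg i t
    refine hS.eventually_wgap_sub_le hxc hyc htT (fun j s _ => hxM j s) (fun j s _ => hyM j s)
      (hx i t htT) (hy i t htT) ((mul_pos hθ0 hL').trans hq) ?_
    rw [add_div]
    have h1 : S.delayGap k (fun j s => |x j s - y j s|) i t / k.dv i ≤ S.weight k i t * L' := by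
      rwa [div_le_iff₀' hdi]
    have h2 : (δ + S.weight k i t) * (θ * L')
        < (δ + S.weight k i t) * S.wgap (k.dv i) i (x i) (y i) t :=
      mul_lt_mul_of_pos_left hq (by linarith)
    have h3 : S.weight k i t * (1 - θ) ≤ R * (1 - θ) :=
      mul_le_mul_of_nonneg_right hRt (by linarith)
    have h4 : (S.weight k i t * (1 - θ) - δ * θ) * L' ≤ -(δ / 2) * L' :=
      mul_le_mul_of_nonneg_right (by nlinarith) hL'.le
    nlinarith [mul_pos hL' hδ]
  set B : Set ℝ := {L | 0 ≤ L ∧ ∀ i, ∀ᶠ t in atTop, u i t ≤ L} with hB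
  have hBne : B.Nonempty := by
    obtain ⟨K, hK⟩ := Finite.exists_le fun i => 2 * M / (k.aL i * k.dv i)
    refine ⟨max K 0, le_max_right _ _, fun i => Eventually.of_forall fun t => ?_⟩
    refine le_trans ?_ ((hK i).trans (le_max_left _ _))
    rw [le_div_iff₀' (mul_pos (hS.aL_pos i) (hS.dv_pos i))]
    exact (hS.mul_wgap_le i (x i) (y i) t).trans (hDM i t)
  have hBbd : BddBelow B := ⟨0, fun L hL => hL.1⟩
  have hinf0 : 0 ≤ sInf B := le_csInf hBne fun L hL => hL.1
  have hinf : sInf B = 0 := by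
    by_contra hne
    have hpos : 0 < sInf B := lt_of_le_of_ne hinf0 (Ne.symm hne)
    have hlt : sInf B < sInf B / θ := by
      rw [lt_div_iff₀ hθ0]
      exact mul_lt_of_lt_one_right hpos hθ1
    obtain ⟨L', hL'1, hL'2⟩ := exists_between hlt
    obtain ⟨L, hL, hLL'⟩ := exists_lt_of_csInf_lt hBne hL'1
    have hmem : θ * L' ∈ B :=
      ⟨(mul_pos hθ0 (hpos.trans hL'1)).le, himprove L L' hL.1 hLL' hL.2⟩
    have := csInf_le hBbd hmem
    rw [lt_div_iff₀' hθ0] at hL'2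
    exact this.not_gt hL'2
  have hulim : Tendsto (u i) atTop (𝓝 0) := by
    rw [tendsto_order]
    refine ⟨fun a ha => Eventually.of_forall fun t => ha.trans_le (hu0 i t), fun a ha => ?_⟩
    obtain ⟨L, hL, hLa⟩ := exists_lt_of_csInf_lt hBne (hinf.trans_lt ha)
    filter_upwards [hL.2 i] with t ht
    exact ht.trans_lt hLa
  refine squeeze_zero (fun t => abs_nonneg _) (fun t => hS.abs_sub_le_wgap i (x i) (y i) t) ?_
  simpa using hulim.const_mul (k.aU i * k.dv i)

end CGData

namespace CGData

variable {n P : ℕ} {S Sh : CGData n P} {k : CGConst n P} {A β βh : Fin (n+1) → ℝ → ℝ} {δ T : ℝ}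

lemma exists_stable (hreg : S.Regular) (h2 : S.H2 k.aL k.aU A) (h3 : S.H3 β) (h4 : S.H4)
    (h5 : S.H5 k.γ1 k.γ2 k.μ1 k.μ2) (h6 : S.H6 k.ξ k.Ξ k.ζ k.ς) (hdv : ∀ i, 0 < k.dv i)
    (hc : ∀ i j l p, S.c i j l p =O[atTop] fun _ => (1:ℝ))
    (hd : ∀ i j l p, S.d i j l p =O[atTop] fun _ => (1:ℝ))
    (hI : ∀ i, S.I i =O[atTop] fun _ => (1:ℝ))
    (hb : ∀ i u, (fun t => S.b i t u) =O[atTop] fun _ => (1:ℝ)) (hδ : 0 < δ)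
    (h7 : ∀ i, ∀ᶠ t in atTop, -(k.aL i * (β i t + A i t)) + S.weight k i t ≤ -δ) :
    ∃ T, S.Stable k β δ T := by
  obtain ⟨T, hT⟩ := eventually_atTop.1 (eventually_all.2 h7)
  obtain ⟨haL, -, hab, hA⟩ := h2
  refine ⟨max T 0, hreg, haL, hab, h3, h4, h5, h6, hdv, hδ, le_max_right _ _, ?_, hc, hd, hI, hb⟩
  intro i t ht v
  obtain ⟨da, hda, hle⟩ := hA i v t ((le_max_right _ _).trans ht)
  refine ⟨da, hda, (mul_le_mul_of_nonneg_right ?_ (sq_nonneg _)).trans hle⟩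
  have := hT t ((le_max_left _ _).trans ht) i
  rw [sub_le_iff_le_add, div_le_iff₀ (haL i)]
  linarith

lemma exists_eventually_le_of_H7 {aL aU : Fin (n+1) → ℝ}
    {γ1 γ2 μ1 μ2 : Fin (n+1) → Fin (n+1) → Fin (n+1) → Fin (P+1) → ℝ}
    {ξ Ξ : Fin (n+1) → Fin (n+1) → Fin (P+1) → ℝ} {ζ ς dv : Fin (n+1) → ℝ}
    (h7 : S.H7 aL aU A β γ1 γ2 μ1 μ2 ξ Ξ ζ ς dv) :
    ∃ δ > 0, ∀ i, ∀ᶠ t in atTop, -(aL i * (β i t + A i t)) +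
      S.weight ⟨aL, aU, γ1, γ2, μ1, μ2, ξ, Ξ, ζ, ς, dv⟩ i t ≤ -δ := by
  have hex : ∀ i, ∃ e < 0, ∀ᶠ t in atTop,
      S.H7expr aL aU A β γ1 γ2 μ1 μ2 ξ Ξ ζ ς dv i t ≤ e := by
    intro i
    have h := h7.2 i
    rw [limsup_eq] at h
    have hne : {e | ∀ᶠ t in atTop, S.H7expr aL aU A β γ1 γ2 μ1 μ2 ξ Ξ ζ ς dv i t ≤ e}.Nonempty := by
      by_contra hemp
      rw [Set.not_nonempty_iff_eq_empty.1 hemp, Real.sInf_empty] at h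
      exact lt_irrefl _ h
    obtain ⟨e, he, he0⟩ := exists_lt_of_csInf_lt hne h
    exact ⟨e, he0, he⟩
  choose e he0 he using hex
  obtain ⟨i₀, hi₀⟩ := Finite.exists_max e
  refine ⟨-e i₀, neg_pos.2 (he0 i₀), fun i => ?_⟩
  filter_upwards [he i] with t ht
  rw [neg_neg]
  exact ht.trans (hi₀ i)

lemma isBigO_one_of_bounded {f : ℝ → ℝ} (h : ∃ M, ∀ t ≥ (0:ℝ), |f t| ≤ M) :
    f =O[atTop] fun _ => (1:ℝ) := by
  obtain ⟨M, hM⟩ := h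
  refine Asymptotics.IsBigO.of_bound M ?_
  filter_upwards [eventually_ge_atTop 0] with t ht
  simpa using hM t ht

lemma isBigO_one_of_tendsto_sub {f g : ℝ → ℝ} (hf : f =O[atTop] fun _ => (1:ℝ))
    (h : Tendsto (fun t => f t - g t) atTop (𝓝 0)) : g =O[atTop] fun _ => (1:ℝ) := by
  simpa using hf.sub (h.isBigO_one ℝ)

lemma tendsto_mul_of_isBigO_one {f g : ℝ → ℝ} (hf : Tendsto f atTop (𝓝 0))
    (hg : g =O[atTop] fun _ => (1:ℝ)) : Tendsto (fun t => f t * g t) atTop (𝓝 0) := by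
  rw [← Asymptotics.isLittleO_one_iff ℝ] at hf ⊢
  simpa using hf.mul_isBigO hg

lemma tendsto_weight_sub
    (hc : ∀ i j l p, Tendsto (fun t => S.c i j l p t - Sh.c i j l p t) atTop (𝓝 0))
    (hd : ∀ i j l p, Tendsto (fun t => S.d i j l p t - Sh.d i j l p t) atTop (𝓝 0))
    (k : CGConst n P) (i : Fin (n+1)) :
    Tendsto (fun t => Sh.weight k i t - S.weight k i t) atTop (𝓝 0) := by
  have habs : ∀ {f g : ℝ → ℝ}, Tendsto (fun t => f t - g t) atTop (𝓝 0) →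
      Tendsto (fun t => |g t| - |f t|) atTop (𝓝 0) := by
    intro f g h
    refine squeeze_zero_norm (fun t => ?_) (by simpa using h.abs)
    rw [Real.norm_eq_abs, abs_sub_comm]
    exact abs_abs_sub_abs_le _ _
  unfold weight
  simp only [← Finset.sum_sub_distrib]
  rw [show 𝓝 (0:ℝ) = 𝓝 (∑ _p : Fin (P+1), ∑ _j : Fin (n+1), ∑ _l : Fin (n+1), (0:ℝ)) by simp]
  refine tendsto_finsetSum _ fun p _ => tendsto_finsetSum _ fun j _ =>
    tendsto_finsetSum _ fun l _ => ?_
  have h := (((habs (hc i j l p)).const_mul (k.ζ i)).mul_const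
      (k.aU j * (k.dv j / k.dv i) * k.γ1 i j l p + k.aU l * (k.dv l / k.dv i) * k.γ2 i j l p)).add
    (((habs (hd i j l p)).const_mul (k.ς i)).mul_const
      (k.aU j * (k.dv j / k.dv i) * k.ξ i j p * k.μ1 i j l p
          + k.aU l * (k.dv l / k.dv i) * k.Ξ i l p * k.μ2 i j l p))
  simp only [mul_zero, zero_mul, add_zero] at h
  refine h.congr fun t => ?_
  ring

/-- The hypotheses pass from a system to its asymptotic systems. -/
lemma exists_stable_of_isAsymptoticOf (hregh : Sh.Regular) (h2 : S.H2 k.aL k.aU A)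
    (hS : S.Stable k β δ T) (hasymp : IsAsymptoticOf Sh S β βh)
    (h7 : ∀ i, ∀ᶠ t in atTop, -(k.aL i * (β i t + A i t)) + S.weight k i t ≤ -δ) :
    ∃ T, Sh.Stable k βh (δ / 2) T := by
  obtain ⟨ha, hF, hh, hf, hg, hG, hη, hρ, h3, hβ, hb, hc, hd, hτ, hσ, hI⟩ := hasymp
  have hδ := hS.δ_pos
  refine exists_stable (A := A) hregh ?_ h3 ⟨fun i j p => ?_, fun i l p => ?_⟩ ?_ ?_ hS.dv_pos
    (fun i j l p => isBigO_one_of_tendsto_sub (hS.c_bdd i j l p) (hc i j l p))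
    (fun i j l p => isBigO_one_of_tendsto_sub (hS.d_bdd i j l p) (hd i j l p))
    (fun i => isBigO_one_of_tendsto_sub (hS.I_bdd i) (hI i))
    (fun i u => isBigO_one_of_tendsto_sub (hS.b_bdd i u)
      (hb i (fun _ => u) continuous_const ⟨|u|, fun _ => le_rfl⟩))
    (half_pos hδ) fun i => ?_
  · simpa only [H2, ha] using h2
  · simpa using (hS.h4.1 i j p).atTop_add (hτ i j p)
  · simpa using (hS.h4.2 i l p).atTop_add (hσ i l p)
  · simpa only [H5, hh, hf] using hS.h5
  · simpa only [H6, hF, hg, hG] using hS.h6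
  · have hlim := ((hβ i).const_mul (k.aL i)).add (tendsto_weight_sub hc hd k i)
    rw [mul_zero, add_zero] at hlim
    filter_upwards [h7 i, hlim.eventually (gt_mem_nhds (half_pos hδ))] with t h1 h2
    linarith

lemma exists_abs_le_of_continuous₂ {f : ℝ → ℝ → ℝ} (hf : Continuous fun q : ℝ × ℝ => f q.1 q.2)
    (M : ℝ) : ∃ C, ∀ u v, |u| ≤ M → |v| ≤ M → |f u v| ≤ C := by
  obtain ⟨C, hC⟩ := ((isCompact_Icc (a := -M) (b := M)).prod
    (isCompact_Icc (a := -M) (b := M))).exists_bound_of_continuousOn hf.continuousOn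
  exact ⟨C, fun u v hu hv => hC (u, v) ⟨abs_le.1 hu, abs_le.1 hv⟩⟩

/-- Averages over the past of a continuous function of a bounded function are bounded. -/
lemma exists_abs_setIntegral_le {g : ℝ → ℝ} (hg : Continuous g) (M : ℝ) :
    ∃ C, ∀ (ν : Measure ℝ), IsProbabilityMeasure ν → ∀ w : ℝ → ℝ, (∀ s, |w s| ≤ M) → ∀ t,
      |∫ s in Set.Iic (0:ℝ), g (w (t + s)) ∂ν| ≤ C := by
  obtain ⟨C, hC⟩ := (isCompact_Icc (a := -M) (b := M)).exists_bound_of_continuousOn hg.continuousOn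
  refine ⟨max C 0, fun ν _ w hw t => ?_⟩
  have := norm_setIntegral_le_of_norm_le_const (μ := ν) (s := Set.Iic (0:ℝ))
    (f := fun s => g (w (t + s))) (C := max C 0) (measure_lt_top _ _)
    fun s _ => (hC _ (abs_le.1 (hw _))).trans (le_max_left _ _)
  exact this.trans (mul_le_of_le_one_right (le_max_right _ _) measureReal_le_one)

lemma exists_abs_h_le (hreg : S.Regular) (i j l : Fin (n+1)) (p : Fin (P+1))
    {w : Fin (n+1) → ℝ → ℝ} {M : ℝ} (hw : ∀ i s, |w i s| ≤ M) :
    ∃ C, ∀ r s, |S.h i j l p (w j r) (w l s)| ≤ C := by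
  obtain ⟨-, -, -, -, -, -, -, -, -, -, -, hh, -⟩ := hreg
  obtain ⟨C, hC⟩ := exists_abs_le_of_continuous₂ (hh i j l p) M
  exact ⟨C, fun r s => hC _ _ (hw _ _) (hw _ _)⟩

lemma exists_abs_f_le (hreg : S.Regular) (i j l : Fin (n+1)) (p : Fin (P+1))
    {w : Fin (n+1) → ℝ → ℝ} {M : ℝ} (hw : ∀ i s, |w i s| ≤ M) :
    ∃ C, ∀ t, |S.f i j l p
      (∫ s in Set.Iic (0:ℝ), S.g i j p (w j (t + s)) ∂(S.η i j p))
      (∫ s in Set.Iic (0:ℝ), S.G i l p (w l (t + s)) ∂(S.ρ i l p))| ≤ C := by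
  obtain ⟨-, -, -, -, -, -, -, -, -, -, -, -, hf, hg, hG, hη, hρ⟩ := hreg
  obtain ⟨C₁, hC₁⟩ := exists_abs_setIntegral_le (hg i j p) M
  obtain ⟨C₂, hC₂⟩ := exists_abs_setIntegral_le (hG i l p) M
  obtain ⟨C, hC⟩ := exists_abs_le_of_continuous₂ (hf i j l p) (max C₁ C₂)
  exact ⟨C, fun t => hC _ _ ((hC₁ _ (hη i j p).1 _ (hw j) t).trans (le_max_left _ _))
    ((hC₂ _ (hρ i l p).1 _ (hw l) t).trans (le_max_right _ _))⟩

lemma Stable.bracket_bdd (hS : S.Stable k β δ T) {w : Fin (n+1) → ℝ → ℝ} {M : ℝ}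
    (hw : ∀ i s, |w i s| ≤ M) (i : Fin (n+1)) :
    S.bracket w i =O[atTop] fun _ => (1:ℝ) := by
  have hU : S.U w i =O[atTop] fun _ => (1:ℝ) := by
    unfold U
    refine Asymptotics.IsBigO.fun_sum fun p _ => Asymptotics.IsBigO.fun_sum fun j _ =>
      Asymptotics.IsBigO.fun_sum fun l _ => ?_
    obtain ⟨C, hC⟩ := exists_abs_h_le hS.reg i j l p hw
    simpa using (hS.c_bdd i j l p).mul (isBigO_one_of_bounded ⟨C, fun t _ => hC
      (t - S.τ i j p t) (t - S.σ i l p t)⟩)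
  have hV : S.V w i =O[atTop] fun _ => (1:ℝ) := by
    unfold V
    refine Asymptotics.IsBigO.fun_sum fun p _ => Asymptotics.IsBigO.fun_sum fun j _ =>
      Asymptotics.IsBigO.fun_sum fun l _ => ?_
    obtain ⟨C, hC⟩ := exists_abs_f_le hS.reg i j l p hw
    simpa using (hS.d_bdd i j l p).mul (isBigO_one_of_bounded ⟨C, fun t _ => hC t⟩)
  have hF : (fun t => S.F i (S.U w i t) (S.V w i t)) =O[atTop] fun _ => (1:ℝ) := by
    have hsub : (fun t => S.F i (S.U w i t) (S.V w i t) - S.F i 0 0) =O[atTop] fun _ => (1:ℝ) := by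
      refine Asymptotics.IsBigO.trans (Asymptotics.IsBigO.of_norm_le fun t => ?_)
        ((hU.norm_left.const_mul_left (k.ζ i)).add (hV.norm_left.const_mul_left (k.ς i)))
      simpa using hS.h6.2.2.2.2.2 i (S.U w i t) (S.V w i t) 0 0
    simpa using hsub.add (Asymptotics.isBigO_const_const (S.F i 0 0) one_ne_zero atTop)
  have hb : (fun t => S.b i t (w i t)) =O[atTop] fun _ => (1:ℝ) := by
    have hmono : ∀ t ≥ (0:ℝ), ∀ u v, u ≤ v → S.b i t u ≤ S.b i t v := by
      intro t ht u v huv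
      rcases huv.eq_or_lt with rfl | huv
      · rfl
      have := (hS.h3.2.1 i t ht).trans (hS.h3.2.2 i t ht v u huv.ne')
      rw [le_div_iff₀ (sub_pos.2 huv), zero_mul] at this
      linarith
    refine Asymptotics.IsBigO.trans (Asymptotics.IsBigO.of_bound 1 ?_)
      ((hS.b_bdd i M).norm_left.add (hS.b_bdd i (-M)).norm_left)
    filter_upwards [eventually_ge_atTop 0] with t ht
    have hwt := abs_le.1 (hw i t)
    have h1 := hmono t ht _ _ hwt.1
    have h2 := hmono t ht _ _ hwt.2
    have h3 := abs_le.1 (le_refl |S.b i t M|)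
    have h4 := abs_le.1 (le_refl |S.b i t (-M)|)
    have h5 := abs_nonneg (S.b i t M)
    have h6 := abs_nonneg (S.b i t (-M))
    simp only [Real.norm_eq_abs, one_mul]
    rw [abs_of_nonneg (add_nonneg h5 h6)]
    exact abs_le.2 ⟨by linarith, by linarith⟩
  exact (hb.neg_left.add hF).add (hS.I_bdd i)

/-- Solutions with bounded initial condition are bounded. -/
lemma Stable.exists_abs_le_of_isSolution (hS : S.Stable k β δ T) {t₀ : ℝ}
    {x : Fin (n+1) → ℝ → ℝ} (hx : S.IsSolution t₀ x) : ∃ M, ∀ i t, |x i t| ≤ M := by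
  obtain ⟨hxc, ⟨M, hM⟩, hxd⟩ := hx
  choose c hc using fun i => (hS.bracket_bdd (w := fun _ _ => 0) (M := 0) (by simp) i).bound
  obtain ⟨C, hC⟩ := Finite.exists_le c
  obtain ⟨T₁, hT₁⟩ := eventually_atTop.1 (eventually_all.2 hc)
  set T' := max (max T t₀) T₁ with hT'
  have hS' := hS.mono (T' := T') ((le_max_left _ _).trans (le_max_left _ _))
  choose N hN using fun i => exists_abs_le_of_bounded_Iic (hxc i) (hM i) T'
  obtain ⟨N', hN'⟩ := Finite.exists_le N
  obtain ⟨K, hK⟩ := hS'.exists_abs_sub_le (x := x) (y := fun _ _ => 0)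
    (E := S.bracket fun _ _ => 0) (M := max N' 0) (C := C) hxc (fun _ => continuous_const)
    (fun i s hs => (hN i s hs).trans ((hN' i).trans (le_max_left _ _))) (by simp)
    (fun i t ht => by
      have := hT₁ t ((le_max_right _ _).trans ht.le) i
      rw [norm_one, mul_one] at this
      exact this.trans (hC i))
    (fun i t ht => hxd i t (((le_max_right _ _).trans (le_max_left _ _)).trans_lt ht))
    (fun i t _ => by simpa using hasDerivAt_const t (0:ℝ))
  exact ⟨K, by simpa using hK⟩

/-- Bounded solutions are Lipschitz for large times. -/
lemma Stable.exists_lipschitz_of_isSolution (hS : S.Stable k β δ T) {t₀ : ℝ}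
    {x : Fin (n+1) → ℝ → ℝ} (hx : S.IsSolution t₀ x) {M : ℝ} (hM : ∀ i t, |x i t| ≤ M)
    (i : Fin (n+1)) :
    ∃ K T', ∀ r ≥ T', ∀ s ≥ T', |x i r - x i s| ≤ K * |r - s| := by
  obtain ⟨-, -, hxd⟩ := hx
  obtain ⟨c, hc⟩ := (hS.bracket_bdd hM i).bound
  obtain ⟨T₁, hT₁⟩ := eventually_atTop.1 hc
  refine ⟨k.aU i * c, max T₁ (max (t₀ + 1) 0), fun r hr s hs => ?_⟩
  refine Convex.norm_image_sub_le_of_norm_hasDerivWithin_le (𝕜 := ℝ) (f' := S.rhs x i)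
    (s := Set.Ici (max T₁ (max (t₀ + 1) 0))) (fun t ht => ?_) (fun t ht => ?_) (convex_Ici _) hs hr
  · have : t₀ + 1 ≤ t := ((le_max_left _ _).trans (le_max_right _ _)).trans ht
    exact (hxd i t (by linarith)).hasDerivWithinAt
  · have h0 : 0 ≤ t := ((le_max_right _ _).trans (le_max_right _ _)).trans ht
    have hb := hT₁ t ((le_max_left _ _).trans ht)
    rw [norm_one, mul_one] at hb
    have ha := hS.a_bounds i t h0 (x i t)
    have ha0 := (hS.aL_pos i).trans_le ha.1
    change ‖S.a i t (x i t) * S.bracket x i t‖ ≤ _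
    rw [norm_mul, Real.norm_eq_abs, abs_of_pos ha0]
    exact mul_le_mul ha.2 hb (norm_nonneg _) (hS.aU_pos i).le

/-- A function that is Lipschitz for large times does not see vanishing changes of the delay. -/
lemma tendsto_comp_delay_sub {z τ τ' : ℝ → ℝ} {K T' : ℝ}
    (hz : ∀ r ≥ T', ∀ s ≥ T', |z r - z s| ≤ K * |r - s|)
    (h : Tendsto (fun t => t - τ t) atTop atTop) (h' : Tendsto (fun t => t - τ' t) atTop atTop)
    (hττ' : Tendsto (fun t => τ t - τ' t) atTop (𝓝 0)) :
    Tendsto (fun t => z (t - τ t) - z (t - τ' t)) atTop (𝓝 0) := by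
  have hlim : Tendsto (fun t => K * |τ t - τ' t|) atTop (𝓝 0) := by
    simpa using hττ'.abs.const_mul K
  refine squeeze_zero_norm' ?_ hlim
  filter_upwards [h.eventually_ge_atTop T', h'.eventually_ge_atTop T'] with t h1 h2
  refine (hz _ h1 _ h2).trans_eq ?_
  rw [sub_sub_sub_cancel_left, abs_sub_comm]

lemma tendsto_bracket_sub (hS : S.Stable k β δ T) {δ' T' : ℝ} (hSh : Sh.Stable k βh δ' T')
    (hasymp : IsAsymptoticOf Sh S β βh) {t₁ : ℝ} {y : Fin (n+1) → ℝ → ℝ}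
    (hy : Sh.IsSolution t₁ y) {M : ℝ} (hM : ∀ i t, |y i t| ≤ M) (i : Fin (n+1)) :
    Tendsto (fun t => S.bracket y i t - Sh.bracket y i t) atTop (𝓝 0) := by
  have hlip := hSh.exists_lipschitz_of_isSolution hy hM
  obtain ⟨ha, hF, hh, hf, hg, hG, hη, hρ, -, -, hb, hc, hd, hτ, hσ, hI⟩ := hasymp
  have hU : Tendsto (fun t => S.U y i t - Sh.U y i t) atTop (𝓝 0) := by
    unfold U
    simp only [hh, ← Finset.sum_sub_distrib]
    rw [show 𝓝 (0:ℝ) = 𝓝 (∑ _p : Fin (P+1), ∑ _j : Fin (n+1), ∑ _l : Fin (n+1), (0:ℝ)) by simp]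
    refine tendsto_finsetSum _ fun p _ => tendsto_finsetSum _ fun j _ =>
      tendsto_finsetSum _ fun l _ => ?_
    obtain ⟨C, hC⟩ := exists_abs_h_le hS.reg i j l p hM
    obtain ⟨K₁, T₁, hK₁⟩ := hlip j
    obtain ⟨K₂, T₂, hK₂⟩ := hlip l
    have hτ' := tendsto_comp_delay_sub hK₁ (hS.h4.1 i j p) (hSh.h4.1 i j p) (hτ i j p)
    have hσ' := tendsto_comp_delay_sub hK₂ (hS.h4.2 i l p) (hSh.h4.2 i l p) (hσ i l p)
    have hhd : Tendsto (fun t => S.h i j l p (y j (t - S.τ i j p t)) (y l (t - S.σ i l p t))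
        - S.h i j l p (y j (t - Sh.τ i j p t)) (y l (t - Sh.σ i l p t))) atTop (𝓝 0) := by
      refine squeeze_zero_norm (fun t => hS.h5.2.1 i j l p _ _ _ _) ?_
      simpa using (hτ'.abs.const_mul (k.γ1 i j l p)).add (hσ'.abs.const_mul (k.γ2 i j l p))
    have hlim := (tendsto_mul_of_isBigO_one (hc i j l p) (isBigO_one_of_bounded
      ⟨C, fun t _ => hC (t - S.τ i j p t) (t - S.σ i l p t)⟩)).add
      (tendsto_mul_of_isBigO_one hhd (hSh.c_bdd i j l p))
    rw [add_zero] at hlim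
    refine hlim.congr fun t => ?_
    ring
  have hV : Tendsto (fun t => S.V y i t - Sh.V y i t) atTop (𝓝 0) := by
    unfold V
    simp only [hf, hg, hG, hη, hρ, ← Finset.sum_sub_distrib, ← sub_mul]
    rw [show 𝓝 (0:ℝ) = 𝓝 (∑ _p : Fin (P+1), ∑ _j : Fin (n+1), ∑ _l : Fin (n+1), (0:ℝ)) by simp]
    refine tendsto_finsetSum _ fun p _ => tendsto_finsetSum _ fun j _ =>
      tendsto_finsetSum _ fun l _ => ?_
    obtain ⟨C, hC⟩ := exists_abs_f_le hS.reg i j l p hM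
    exact tendsto_mul_of_isBigO_one (hd i j l p) (isBigO_one_of_bounded ⟨C, fun t _ => hC t⟩)
  have hFd : Tendsto (fun t => S.F i (S.U y i t) (S.V y i t) - S.F i (Sh.U y i t) (Sh.V y i t))
      atTop (𝓝 0) := by
    refine squeeze_zero_norm (fun t => hS.h6.2.2.2.2.2 i _ _ _ _) ?_
    simpa using (hU.abs.const_mul (k.ζ i)).add (hV.abs.const_mul (k.ς i))
  have hlim := ((hb i (y i) (hy.1 i) ⟨M, hM i⟩).neg.add hFd).add (hI i)
  simp only [neg_zero, add_zero] at hlim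
  refine hlim.congr fun t => ?_
  simp only [bracket, hF]
  ring

end CGData

/-- Theorem 3.3: under (H1)-(H7), every solution of system (1) with bounded initial
condition and every solution of an asymptotic system (2) with bounded initial condition
approach each other in the max norm. -/
theorem convergence_to_asymptotic_system {n P : ℕ} (S Sh : CGData n P)
    (aL aU : Fin (n+1) → ℝ) (A : Fin (n+1) → ℝ → ℝ) (β βh : Fin (n+1) → ℝ → ℝ)
    (γ1 γ2 μ1 μ2 : Fin (n+1) → Fin (n+1) → Fin (n+1) → Fin (P+1) → ℝ)
    (ξ Ξ : Fin (n+1) → Fin (n+1) → Fin (P+1) → ℝ) (ζ ς : Fin (n+1) → ℝ)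
    (dv : Fin (n+1) → ℝ)
    (hreg : S.Regular) (hregh : Sh.Regular)
    (h1 : S.H1) (h2 : S.H2 aL aU A) (h3 : S.H3 β) (h4 : S.H4)
    (h5 : S.H5 γ1 γ2 μ1 μ2) (h6 : S.H6 ξ Ξ ζ ς)
    (h7 : S.H7 aL aU A β γ1 γ2 μ1 μ2 ξ Ξ ζ ς dv)
    (hasymp : IsAsymptoticOf Sh S β βh)
    (t₀ t₁ : ℝ) (ht₀ : 0 ≤ t₀) (ht₁ : 0 ≤ t₁)
    (x y : Fin (n+1) → ℝ → ℝ)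
    (hx : S.IsSolution t₀ x) (hy : Sh.IsSolution t₁ y) :
    Tendsto (fun t => Finset.univ.sup' Finset.univ_nonempty (fun i => |x i t - y i t|))
      atTop (nhds 0) := by
  set k : CGConst n P := ⟨aL, aU, γ1, γ2, μ1, μ2, ξ, Ξ, ζ, ς, dv⟩ with hk
  obtain ⟨δ, hδ, h7'⟩ := exists_eventually_le_of_H7 h7
  obtain ⟨T, hS⟩ := exists_stable (k := k) hreg h2 h3 h4 h5 h6 h7.1
    (fun i j l p => isBigO_one_of_bounded (h1.1 i j l p))
    (fun i j l p => isBigO_one_of_bounded (h1.2.1 i j l p))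
    (fun i => isBigO_one_of_bounded (h1.2.2.1 i))
    (fun i u => isBigO_one_of_bounded (h1.2.2.2 i u)) hδ h7'
  obtain ⟨T', hSh⟩ := exists_stable_of_isAsymptoticOf hregh h2 hS hasymp h7'
  obtain ⟨M₁, hM₁⟩ := hS.exists_abs_le_of_isSolution hx
  obtain ⟨M₂, hM₂⟩ := hSh.exists_abs_le_of_isSolution hy
  have hlim := (hS.mono (T' := max T (max t₀ t₁)) (le_max_left _ _)).tendsto_abs_sub
    (E := fun i t => S.bracket y i t - Sh.bracket y i t) hx.1 hy.1 (M := max M₁ M₂)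
    (fun i s => (hM₁ i s).trans (le_max_left _ _)) (fun i s => (hM₂ i s).trans (le_max_right _ _))
    (tendsto_bracket_sub hS hSh hasymp hy hM₂)
    (fun i t ht => hx.2.2 i t (((le_max_left _ _).trans (le_max_right _ _)).trans_lt ht))
    (fun i t ht => by
      rw [sub_sub_cancel, ← hasymp.1]
      exact hy.2.2 i t (((le_max_right _ _).trans (le_max_right _ _)).trans_lt ht))
  refine squeeze_zero (fun t => ?_) (fun t => ?_)
    (by simpa using tendsto_finsetSum Finset.univ fun i _ => hlim i)
  · exact (abs_nonneg _).trans
      (Finset.le_sup' (fun i => |x i t - y i t|) (Finset.mem_univ 0))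
  · exact Finset.sup'_le _ _ fun i _ => Finset.single_le_sum
      (f := fun i => |x i t - y i t|) (fun j _ => abs_nonneg _) (Finset.mem_univ i)
end

section
/- Assume: (i) for each i there is a continuous β_i : [0,∞) → [0,∞) with (b_i(t,u)−b_i(t,v))/(u−v) ≥ β_i(t) for all t ≥ 0 and u ≠ v; (ii) each c_{ij} is bounded on [0,∞); (iii) each G_i is Lipschitz with constant ς_i > 0; (iv) for each i there are constants 0 < a̲_i ≤ ā_i with a̲_i ≤ a_i(u) ≤ ā_i for all u ∈ ℝ. If there exist d₁,…,d_n > 0 such that for each i, limsup_{t→+∞} [−a̲_i β_i(t) d_i + Σ_{j=1}^{n} ς_i |c_{ij}(t)| ā_j d_j] < 0, then any two solutions x, x̂ of (S) with bounded initial conditions satisfy lim_{t→+∞} |x(t) − x̂(t)| = 0. -/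
open MeasureTheory Filter

/-- Right-hand side of the static Cohen--Grossberg model (S). -/
noncomputable def Srhs (n : ℕ) (a : Fin (n+1) → ℝ → ℝ) (b : Fin (n+1) → ℝ → ℝ → ℝ)
    (c : Fin (n+1) → Fin (n+1) → ℝ → ℝ) (Gf : Fin (n+1) → ℝ → ℝ)
    (K : Fin (n+1) → Fin (n+1) → ℝ → ℝ)
    (x : Fin (n+1) → ℝ → ℝ) (i : Fin (n+1)) (t : ℝ) : ℝ :=
  a i (x i t) * (-(b i t (x i t)) +
    Gf i (∑ j : Fin (n+1), c i j t * ∫ u in Set.Ioi (0:ℝ), x j (t - u) * K i j u))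

/-- A solution of (S) on `ℝ` with bounded initial condition at `t₀`. -/
def SIsSolution (n : ℕ) (a : Fin (n+1) → ℝ → ℝ) (b : Fin (n+1) → ℝ → ℝ → ℝ)
    (c : Fin (n+1) → Fin (n+1) → ℝ → ℝ) (Gf : Fin (n+1) → ℝ → ℝ)
    (K : Fin (n+1) → Fin (n+1) → ℝ → ℝ) (t₀ : ℝ) (x : Fin (n+1) → ℝ → ℝ) : Prop :=
  (∀ i, Continuous (x i)) ∧
  (∃ M, ∀ i, ∀ t ≤ t₀, |x i t| ≤ M) ∧
  (∀ i, ∀ t, t₀ < t → HasDerivAt (x i) (Srhs n a b c Gf K x i t) t)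

/-- Standing regularity assumptions on the data of model (S). -/
def SRegular (n : ℕ) (a : Fin (n+1) → ℝ → ℝ) (b : Fin (n+1) → ℝ → ℝ → ℝ)
    (c : Fin (n+1) → Fin (n+1) → ℝ → ℝ) (Gf : Fin (n+1) → ℝ → ℝ)
    (K : Fin (n+1) → Fin (n+1) → ℝ → ℝ) : Prop :=
  (∀ i, Continuous (a i)) ∧ (∀ i u, 0 < a i u) ∧
  (∀ i, ContinuousOn (fun q : ℝ × ℝ => b i q.1 q.2) (Set.Ici 0 ×ˢ Set.univ)) ∧
  (∀ i j, ContinuousOn (c i j) (Set.Ici 0)) ∧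
  (∀ i, Continuous (Gf i)) ∧
  (∀ i j, ContinuousOn (K i j) (Set.Ici 0)) ∧
  (∀ i j, ∀ u ≥ (0:ℝ), 0 ≤ K i j u) ∧
  (∀ i j, ∫ u in Set.Ioi (0:ℝ), K i j u = 1)

theorem eventually_le_of_deriv_le_neg {f f' : ℝ → ℝ} {T ρ κ : ℝ} (hκ : 0 < κ)
    (hd : ∀ t ≥ T, HasDerivAt f (f' t) t) (h : ∀ t ≥ T, ρ ≤ f t → f' t ≤ -κ) :
    ∀ᶠ t in atTop, f t ≤ ρ := by
  obtain ⟨s, hs, hfs⟩ : ∃ s ≥ T, f s ≤ ρ := by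
    by_contra! hcon
    have hT := hcon T le_rfl
    set r := T + (f T - ρ) / κ with hr
    have hTr : T ≤ r := by
      have : 0 ≤ (f T - ρ) / κ := div_nonneg (by linarith) hκ.le
      linarith
    have key := (convex_Ici T).image_sub_le_mul_sub_of_deriv_le (f := f) (C := -κ)
      (fun t ht => (hd t ht).continuousAt.continuousWithinAt)
      (fun t ht => (hd t (interior_subset ht)).differentiableAt.differentiableWithinAt)
      (fun t ht => by
        have ht' : T ≤ t := interior_subset ht
        rw [(hd t ht').deriv]
        exact h t ht' (hcon t ht').le)
      T (Set.mem_Ici.2 le_rfl) r (Set.mem_Ici.2 hTr) hTr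
    have hrr := hcon r hTr
    have : κ * (r - T) = f T - ρ := by
      rw [hr]; field_simp; ring
    linarith
  filter_upwards [eventually_ge_atTop s] with t ht
  refine image_le_of_deriv_right_lt_deriv_boundary (a := s) (b := t) (f := f) (f' := f')
    (B := fun _ => ρ) (B' := fun _ => 0)
    (fun r hr => (hd r (hs.trans hr.1)).continuousAt.continuousWithinAt)
    (fun r hr => (hd r (hs.trans hr.1)).hasDerivWithinAt) hfs
    (fun r => hasDerivAt_const r ρ) (fun r hr hfr => ?_) (Set.right_mem_Icc.2 ht)
  have := h r (hs.trans hr.1) hfr.ge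
  linarith

theorem HasDerivAt.nonneg_of_forall_lt_le {f : ℝ → ℝ} {f' T t : ℝ} (hf : HasDerivAt f f' t)
    (hT : T < t) (h : ∀ s, T < s → s < t → f s ≤ f t) : 0 ≤ f' := by
  refine ge_of_tendsto (hasDerivAt_iff_tendsto_slope_left_right.1 hf).1 ?_
  filter_upwards [Ioo_mem_nhdsLT hT] with s hs
  rw [slope_def_field]
  exact div_nonneg_of_nonpos (sub_nonpos.2 (h s hs.1 hs.2)) (sub_nonpos.2 hs.2.le)

theorem integrableOn_delay_mul {f k : ℝ → ℝ} {t M : ℝ} (hf : Continuous f)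
    (hM : ∀ s ≤ t, |f s| ≤ M) (hk : IntegrableOn k (Set.Ioi 0)) :
    IntegrableOn (fun u => f (t - u) * k u) (Set.Ioi 0) := by
  refine Integrable.bdd_mul (c := M) hk
    (hf.comp (continuous_const.sub continuous_id)).aestronglyMeasurable ?_
  filter_upwards [ae_restrict_mem measurableSet_Ioi] with u hu
  exact hM _ (by have : (0:ℝ) < u := hu; linarith)

/-- The average of `|f|` over the past of `t`, weighted by the delay kernel `k`. -/
noncomputable def delayAvg (k f : ℝ → ℝ) (t : ℝ) : ℝ :=
  ∫ u in Set.Ioi (0:ℝ), |f (t - u)| * k u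

section Kernel

variable {k : ℝ → ℝ}

theorem delayAvg_le {f : ℝ → ℝ} {t B : ℝ} (hk0 : ∀ u > 0, 0 ≤ k u)
    (hk1 : ∫ u in Set.Ioi (0:ℝ), k u = 1) (h : ∀ s < t, |f s| ≤ B) : delayAvg k f t ≤ B := by
  have hki : IntegrableOn k (Set.Ioi 0) := by
    by_contra hni
    rw [integral_undef hni] at hk1
    exact zero_ne_one hk1
  calc delayAvg k f t ≤ ∫ u in Set.Ioi (0:ℝ), B * k u := by
        refine integral_mono_of_nonneg ?_ (hki.const_mul B) ?_
        · filter_upwards [ae_restrict_mem measurableSet_Ioi] with u hu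
          exact mul_nonneg (abs_nonneg _) (hk0 u hu)
        · filter_upwards [ae_restrict_mem measurableSet_Ioi] with u hu
          have hu' : (0:ℝ) < u := hu
          exact mul_le_mul_of_nonneg_right (h _ (by linarith)) (hk0 u hu)
    _ = B := by rw [integral_const_mul, hk1, mul_one]

theorem eventually_delayAvg_le {f : ℝ → ℝ} {M B C : ℝ} (hk0 : ∀ u > 0, 0 ≤ k u)
    (hk1 : ∫ u in Set.Ioi (0:ℝ), k u = 1) (hf : Continuous f) (hM : ∀ s, |f s| ≤ M)
    (hB : ∀ᶠ s in atTop, |f s| ≤ B) (hBC : B < C) : ∀ᶠ t in atTop, delayAvg k f t ≤ C := by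
  have hki : IntegrableOn k (Set.Ioi 0) := by
    by_contra hni
    rw [integral_undef hni] at hk1
    exact zero_ne_one hk1
  have hint : ∀ t, IntegrableOn (fun u => max |f (t - u)| B * k u) (Set.Ioi 0) := fun t =>
    integrableOn_delay_mul (f := fun s => max |f s| B) (M := max M |B|)
      (hf.abs.max continuous_const) (fun s _ => by
        rw [abs_le]
        refine ⟨?_, max_le_max (hM s) (le_abs_self B)⟩
        have h1 := le_max_right M |B|
        have h2 := le_max_right |f s| B
        have h3 := neg_abs_le B
        linarith) hki
  have hlim : Tendsto (fun t => ∫ u in Set.Ioi (0:ℝ), max |f (t - u)| B * k u) atTop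
      (nhds (∫ u in Set.Ioi (0:ℝ), B * k u)) := by
    refine tendsto_integral_filter_of_dominated_convergence
      (fun u => max M |B| * k u) (.of_forall fun t => (hint t).aestronglyMeasurable)
      (.of_forall fun t => ?_) (hki.const_mul _) ?_
    · filter_upwards [ae_restrict_mem measurableSet_Ioi] with u hu
      rw [Real.norm_eq_abs, abs_mul, abs_of_nonneg (hk0 u hu)]
      refine mul_le_mul_of_nonneg_right ?_ (hk0 u hu)
      rw [abs_le]
      refine ⟨?_, max_le_max (hM _) (le_abs_self B)⟩
      have h1 := le_max_right M |B|
      have h2 := le_max_right |f (t - u)| B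
      have h3 := neg_abs_le B
      linarith
    · refine .of_forall fun u => tendsto_const_nhds.congr' ?_
      have : Tendsto (fun t : ℝ => t - u) atTop atTop := tendsto_atTop_add_const_right _ _ tendsto_id
      filter_upwards [this.eventually hB] with t ht
      rw [max_eq_right ht]
  rw [integral_const_mul, hk1, mul_one] at hlim
  filter_upwards [hlim.eventually_lt_const hBC] with t ht
  refine le_trans ?_ ht.le
  refine integral_mono_of_nonneg ?_ (hint t) ?_
  · filter_upwards [ae_restrict_mem measurableSet_Ioi] with u hu
    exact mul_nonneg (abs_nonneg _) (hk0 u hu)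
  · filter_upwards [ae_restrict_mem measurableSet_Ioi] with u hu
    exact mul_le_mul_of_nonneg_right (le_max_left _ _) (hk0 u hu)

end Kernel

/-- A delayed differential inequality for the moduli of the components of `v`, in which the decay
rates `p` dominate the delayed gains `q` after time `T` by a margin `ε`. -/
structure DominatedDelayIneq {ι : Type*} [Fintype ι] (k : ι → ι → ℝ → ℝ) (v v' p : ι → ℝ → ℝ)
    (q : ι → ι → ℝ → ℝ) (T ε S : ℝ) : Prop where
  kernel_nonneg : ∀ i j, ∀ u > 0, 0 ≤ k i j u
  integral_kernel : ∀ i j, ∫ u in Set.Ioi (0:ℝ), k i j u = 1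
  continuous : ∀ i, Continuous (v i)
  hasDerivAt : ∀ i, ∀ t > T, HasDerivAt (v i) (v' i t) t
  le_of_sign : ∀ i, ∀ t > T, ∀ s : ℝ, s = 1 ∨ s = -1 → 0 ≤ s * v i t →
    s * v' i t ≤ -(p i t * (s * v i t)) + ∑ j, q i j t * delayAvg (k i j) (v j) t
  gain_nonneg : ∀ i j, ∀ t > T, 0 ≤ q i j t
  sum_gain_le : ∀ i, ∀ t > T, ∑ j, q i j t ≤ S
  margin_pos : 0 < ε
  dominated : ∀ i, ∀ t > T, ε + ∑ j, q i j t ≤ p i t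

theorem exists_sign_mul_eq_abs (r : ℝ) : ∃ s : ℝ, (s = 1 ∨ s = -1) ∧ s * r = |r| := by
  rcases le_total 0 r with h | h
  · exact ⟨1, .inl rfl, by rw [one_mul, abs_of_nonneg h]⟩
  · exact ⟨-1, .inr rfl, by rw [abs_of_nonpos h]; ring⟩

theorem sign_mul_le_abs {s : ℝ} (hs : s = 1 ∨ s = -1) (r : ℝ) : s * r ≤ |r| := by
  rcases hs with rfl | rfl
  · simpa using le_abs_self r
  · simpa using neg_le_abs r

namespace DominatedDelayIneq

variable {ι : Type*} [Fintype ι] {k : ι → ι → ℝ → ℝ} {v v' p : ι → ℝ → ℝ} {q : ι → ι → ℝ → ℝ}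
  {T ε S : ℝ}

/-- If the components are below `B` in the delayed average and one of them has modulus at least
`ρ`, it decays. -/
theorem sign_mul_deriv_le (h : DominatedDelayIneq k v v' p q T ε S) {i : ι} {t s ρ B : ℝ}
    (ht : T < t) (hs : s = 1 ∨ s = -1) (hρ : 0 ≤ ρ) (hρB : ρ ≤ B) (hv : ρ ≤ s * v i t)
    (hB : ∀ j, delayAvg (k i j) (v j) t ≤ B) : s * v' i t ≤ -(ε * ρ) + S * (B - ρ) := by
  have h1 := h.le_of_sign i t ht s hs (hρ.trans hv)
  have h2 : ∑ j, q i j t * delayAvg (k i j) (v j) t ≤ (∑ j, q i j t) * B := by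
    rw [Finset.sum_mul]
    exact Finset.sum_le_sum fun j _ => mul_le_mul_of_nonneg_left (hB j) (h.gain_nonneg i j t ht)
  have hq : 0 ≤ ∑ j, q i j t := Finset.sum_nonneg fun j _ => h.gain_nonneg i j t ht
  have hp := h.dominated i t ht
  have h3 : (ε + ∑ j, q i j t) * ρ ≤ p i t * (s * v i t) :=
    mul_le_mul hp hv hρ (by linarith [h.margin_pos])
  have h4 : (∑ j, q i j t) * (B - ρ) ≤ S * (B - ρ) :=
    mul_le_mul_of_nonneg_right (h.sum_gain_le i t ht) (by linarith)
  linarith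

theorem abs_lt_of_forall_le (h : DominatedDelayIneq k v v' p q T ε S) {M : ℝ} (hM : 0 < M)
    (hT : ∀ i, ∀ t ≤ T, |v i t| < M) (i : ι) (t : ℝ) : |v i t| < M := by
  by_contra! hcon
  set A : Set ℝ := {r | T ≤ r ∧ ∃ i, M ≤ |v i r|} with hA
  have hAc : IsClosed A := by
    have : A = Set.Ici T ∩ ⋃ i, {r | M ≤ |v i r|} := by
      ext r; simp [hA]
    rw [this]
    exact isClosed_Ici.inter
      (isClosed_iUnion_of_finite fun i => isClosed_le continuous_const (h.continuous i).abs)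
  have hAb : BddBelow A := ⟨T, fun r hr => hr.1⟩
  have hAn : A.Nonempty := by
    refine ⟨t, ?_, i, hcon⟩
    by_contra! hlt
    exact absurd (hT i t hlt.le) hcon.not_gt
  obtain ⟨hTr, j, hj⟩ := hAc.csInf_mem hAn hAb
  set r := sInf A with hr
  have hlt : T < r := by
    refine lt_of_le_of_ne hTr fun he => ?_
    exact absurd (hT j r he.ge) hj.not_gt
  have hbefore : ∀ l, ∀ s < r, |v l s| < M := by
    intro l s hs
    by_contra! hc
    rcases le_total s T with hsT | hsT
    · exact absurd (hT l s hsT) hc.not_gt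
    · exact absurd (csInf_le hAb ⟨hsT, l, hc⟩) hs.not_ge
  obtain ⟨s, hs, hsv⟩ := exists_sign_mul_eq_abs (v j r)
  have hd := h.sign_mul_deriv_le (i := j) (ρ := M) (B := M) hlt hs hM.le le_rfl
    (by rw [hsv]; exact hj) fun l => delayAvg_le (h.kernel_nonneg j l) (h.integral_kernel j l)
      fun s hs => (hbefore l s hs).le
  have hd0 := ((h.hasDerivAt j r hlt).const_mul s).nonneg_of_forall_lt_le hlt fun z _ hz => by
    rw [hsv]
    exact (sign_mul_le_abs hs _).trans ((hbefore j z hz).le.trans hj)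
  have := mul_pos h.margin_pos hM
  linarith

theorem eventually_abs_le_mul (h : DominatedDelayIneq k v v' p q T ε S) {M B θ : ℝ}
    (hM : ∀ i t, |v i t| ≤ M) (hB : 0 < B) (hev : ∀ i, ∀ᶠ t in atTop, |v i t| ≤ B)
    (hθ0 : 0 ≤ θ) (hθ1 : θ < 1) (hθ : 2 * S * (1 - θ) < ε * θ) (i : ι) :
    ∀ᶠ t in atTop, |v i t| ≤ θ * B := by
  have havg : ∀ᶠ t in atTop, ∀ j, delayAvg (k i j) (v j) t ≤ (2 - θ) * B :=
    eventually_all.2 fun j => eventually_delayAvg_le (h.kernel_nonneg i j) (h.integral_kernel i j)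
      (h.continuous j) (hM j) (hev j) (by nlinarith)
  obtain ⟨R, hR⟩ := eventually_atTop.1 (havg.and (eventually_gt_atTop T))
  have hκ : 0 < (ε * θ - 2 * S * (1 - θ)) * B := mul_pos (by linarith) hB
  have key : ∀ s : ℝ, s = 1 ∨ s = -1 → ∀ᶠ t in atTop, s * v i t ≤ θ * B := fun s hs =>
    eventually_le_of_deriv_le_neg (f' := fun t => s * v' i t) (T := R) hκ
      (fun t ht => (h.hasDerivAt i t (hR t ht).2).const_mul s) fun t ht hv => by
        have := h.sign_mul_deriv_le (hR t ht).2 hs (mul_nonneg hθ0 hB.le)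
          (mul_le_mul_of_nonneg_right (by linarith) hB.le) hv (hR t ht).1
        linarith
  filter_upwards [key 1 (.inl rfl), key (-1) (.inr rfl)] with t h1 h2
  exact abs_le.2 ⟨by linarith, by linarith⟩

theorem tendsto_zero (h : DominatedDelayIneq k v v' p q T ε S) (hS : 0 ≤ S) {M : ℝ}
    (hT : ∀ i, ∀ t ≤ T, |v i t| < M) (i : ι) : Tendsto (v i) atTop (nhds 0) := by
  have hε := h.margin_pos
  have hM : 0 < M := (abs_nonneg _).trans_lt (hT i T le_rfl)
  have hbd : ∀ i t, |v i t| ≤ M := fun i t => (h.abs_lt_of_forall_le hM hT i t).le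
  obtain ⟨θ, hθ0, hθ1, hθ⟩ : ∃ θ : ℝ, 0 < θ ∧ θ < 1 ∧ 2 * S * (1 - θ) < ε * θ := by
    refine ⟨1 - ε / (2 * (ε + 2 * S)), ?_, ?_, ?_⟩
    · rw [sub_pos, div_lt_one (by positivity)]; linarith
    · have : 0 < ε / (2 * (ε + 2 * S)) := by positivity
      linarith
    · have : ε / (2 * (ε + 2 * S)) * (ε + 2 * S) = ε / 2 := by field_simp
      linarith
  have hpow : ∀ m : ℕ, ∀ i, ∀ᶠ t in atTop, |v i t| ≤ θ ^ m * M := by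
    intro m
    induction m with
    | zero => exact fun i => .of_forall fun t => by simpa using hbd i t
    | succ m ih =>
      intro i
      have := h.eventually_abs_le_mul hbd (by positivity) ih hθ0.le hθ1 hθ i
      rwa [← mul_assoc, ← pow_succ'] at this
  rw [Metric.tendsto_nhds]
  intro δ hδ
  have hlim : Tendsto (fun m : ℕ => θ ^ m * M) atTop (nhds (0 * M)) :=
    (tendsto_pow_atTop_nhds_zero_of_lt_one hθ0.le hθ1).mul_const M
  rw [zero_mul] at hlim
  obtain ⟨m, hm⟩ := (hlim.eventually_lt_const hδ).exists
  filter_upwards [hpow m i] with t ht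
  rw [Real.dist_eq, sub_zero]
  exact ht.trans_lt hm

end DominatedDelayIneq

theorem exists_primitive_inv {α : ℝ → ℝ} {L U : ℝ} (hα : Continuous α) (hL : 0 < L)
    (hb : ∀ u, L ≤ α u ∧ α u ≤ U) :
    ∃ A : ℝ → ℝ, (∀ u, HasDerivAt A (α u)⁻¹ u) ∧
      (∀ u v s : ℝ, s = 1 ∨ s = -1 → 0 ≤ s * (A u - A v) →
        L * (s * (A u - A v)) ≤ s * (u - v)) ∧
      ∀ u v, |u - v| ≤ U * |A u - A v| := by
  have hpos : ∀ u, 0 < α u := fun u => hL.trans_le (hb u).1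
  have hU : 0 < U := (hpos 0).trans_le (hb 0).2
  set A : ℝ → ℝ := fun u => ∫ r in (0:ℝ)..u, (α r)⁻¹
  have hA : ∀ u, HasDerivAt A (α u)⁻¹ u := fun u =>
    ((hα.inv₀ fun r => (hpos r).ne').integral_hasStrictDerivAt 0 u).hasDerivAt
  have hlow : Monotone fun u => U * A u - u := by
    have hd : ∀ u, HasDerivAt (fun u => U * A u - u) (U * (α u)⁻¹ - 1) u := fun u =>
      ((hA u).const_mul U).sub (hasDerivAt_id u)
    refine monotone_of_deriv_nonneg (fun u => (hd u).differentiableAt) fun u => ?_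
    rw [(hd u).deriv, sub_nonneg, ← div_eq_mul_inv, one_le_div (hpos u)]
    exact (hb u).2
  have hupp : Monotone fun u => u - L * A u := by
    have hd : ∀ u, HasDerivAt (fun u => u - L * A u) (1 - L * (α u)⁻¹) u := fun u =>
      (hasDerivAt_id u).sub ((hA u).const_mul L)
    refine monotone_of_deriv_nonneg (fun u => (hd u).differentiableAt) fun u => ?_
    rw [(hd u).deriv, sub_nonneg, ← div_eq_mul_inv, div_le_one (hpos u)]
    exact (hb u).1
  refine ⟨A, hA, fun u v s hs h0 => ?_, fun u v => ?_⟩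
  · rcases hs with rfl | rfl <;> rcases le_total v u with h | h
    · have := hupp h; simp only at this; linarith
    · have h1 := hlow h
      have h2 := hupp h
      simp only at h1 h2
      have h3 : A u - A v = 0 := by
        by_contra hne
        have : 0 < U * (A u - A v) := mul_pos hU (lt_of_le_of_ne (by linarith) (Ne.symm hne))
        linarith
      rw [h3]
      have : U * A u = U * A v := by rw [sub_eq_zero.1 h3]
      linarith
    · have h1 := hlow h
      have h2 := hupp h
      simp only at h1 h2
      have h3 : A u - A v = 0 := by
        by_contra hne
        have : 0 < U * (A v - A u) :=
          mul_pos hU (lt_of_le_of_ne (by linarith) fun he => hne (by linarith))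
        linarith
      rw [h3]
      have : U * A u = U * A v := by rw [sub_eq_zero.1 h3]
      linarith
    · have := hupp h; simp only at this; linarith
  · have key : ∀ u v, v ≤ u → |u - v| ≤ U * |A u - A v| := fun u v h => by
      have h1 := hlow h
      simp only at h1
      have h2 := mul_le_mul_of_nonneg_left (le_abs_self (A u - A v)) hU.le
      rw [abs_of_nonneg (sub_nonneg.2 h)]
      linarith
    rcases le_total v u with h | h
    · exact key u v h
    · rw [abs_sub_comm, abs_sub_comm (A u)]
      exact key v u h

theorem Continuous.exists_abs_le_of_le {f : ℝ → ℝ} {t₀ M : ℝ} (hf : Continuous f)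
    (hM : ∀ t ≤ t₀, |f t| ≤ M) (T : ℝ) : ∃ C, ∀ t ≤ T, |f t| ≤ C := by
  obtain ⟨C, hC⟩ := (isCompact_Icc (a := t₀) (b := T)).exists_bound_of_continuousOn hf.continuousOn
  refine ⟨max M C, fun t ht => ?_⟩
  rcases le_total t t₀ with h | h
  · exact (hM t h).trans (le_max_left _ _)
  · exact (hC t ⟨h, ht⟩).trans (le_max_right _ _)

theorem exists_eventually_le_neg_of_limsup_neg {f : ℝ → ℝ} (h : limsup f atTop < 0) :
    ∃ e > 0, ∀ᶠ t in atTop, f t ≤ -e := by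
  rw [limsup_eq] at h
  have hne : {r | ∀ᶠ t in atTop, f t ≤ r}.Nonempty := by
    by_contra hemp
    rw [Set.not_nonempty_iff_eq_empty.1 hemp, Real.sInf_empty] at h
    exact lt_irrefl _ h
  obtain ⟨r, hr, hr0⟩ := exists_lt_of_csInf_lt hne h
  exact ⟨-r, by linarith, by simpa using hr⟩

theorem abs_integral_delay_sub_le {f g h k : ℝ → ℝ} {t Mf Mg Mh C : ℝ} (hf : Continuous f)
    (hg : Continuous g) (hh : Continuous h) (hMf : ∀ s ≤ t, |f s| ≤ Mf)
    (hMg : ∀ s ≤ t, |g s| ≤ Mg) (hMh : ∀ s ≤ t, |h s| ≤ Mh) (hk0 : ∀ u > 0, 0 ≤ k u)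
    (hk : IntegrableOn k (Set.Ioi 0)) (hfg : ∀ s, |f s - g s| ≤ C * |h s|) :
    |(∫ u in Set.Ioi (0:ℝ), f (t - u) * k u) - ∫ u in Set.Ioi (0:ℝ), g (t - u) * k u| ≤
      C * delayAvg k h t := by
  rw [← integral_sub (integrableOn_delay_mul hf hMf hk) (integrableOn_delay_mul hg hMg hk),
    delayAvg, ← integral_const_mul, ← Real.norm_eq_abs]
  refine norm_integral_le_of_norm_le
    ((integrableOn_delay_mul (f := fun s => |h s|) hh.abs
      (fun s hs => by rw [abs_abs]; exact hMh s hs) hk).const_mul C) ?_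
  filter_upwards [ae_restrict_mem measurableSet_Ioi] with u hu
  rw [← sub_mul, norm_mul, Real.norm_eq_abs, Real.norm_of_nonneg (hk0 u hu), ← mul_assoc]
  exact mul_le_mul_of_nonneg_right (hfg _) (hk0 u hu)

/-- Corollary 4.1: global attractivity criterion for the static model (S). -/
theorem static_model_convergence {n : ℕ} (t₀ : ℝ) (ht₀ : 0 ≤ t₀)
    (a : Fin (n+1) → ℝ → ℝ) (b : Fin (n+1) → ℝ → ℝ → ℝ)
    (c : Fin (n+1) → Fin (n+1) → ℝ → ℝ) (Gf : Fin (n+1) → ℝ → ℝ)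
    (K : Fin (n+1) → Fin (n+1) → ℝ → ℝ)
    (hreg : SRegular n a b c Gf K)
    (β : Fin (n+1) → ℝ → ℝ)
    (hβc : ∀ i, ContinuousOn (β i) (Set.Ici 0))
    (hβ0 : ∀ i, ∀ t ≥ (0:ℝ), 0 ≤ β i t)
    (hb : ∀ i, ∀ t ≥ (0:ℝ), ∀ u v : ℝ, u ≠ v → β i t ≤ (b i t u - b i t v) / (u - v))
    (hcbd : ∀ i j, ∃ M, ∀ t ≥ (0:ℝ), |c i j t| ≤ M)
    (ς : Fin (n+1) → ℝ) (hς : ∀ i, 0 < ς i)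
    (hG : ∀ i, ∀ u v : ℝ, |Gf i u - Gf i v| ≤ ς i * |u - v|)
    (aL aU : Fin (n+1) → ℝ) (haL : ∀ i, 0 < aL i)
    (ha : ∀ i, ∀ u : ℝ, aL i ≤ a i u ∧ a i u ≤ aU i)
    (dv : Fin (n+1) → ℝ) (hdv : ∀ i, 0 < dv i)
    (hlim : ∀ i, limsup
      (fun t => -(aL i * β i t * dv i) + ∑ j : Fin (n+1), ς i * |c i j t| * aU j * dv j)
      atTop < 0)
    (x y : Fin (n+1) → ℝ → ℝ)
    (hx : SIsSolution n a b c Gf K t₀ x) (hy : SIsSolution n a b c Gf K t₀ y) :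
    Tendsto (fun t => Finset.univ.sup' Finset.univ_nonempty (fun i => |x i t - y i t|))
      atTop (nhds 0) := by
  obtain ⟨hac, ha0, -, -, -, -, hK0, hK1⟩ := hreg
  obtain ⟨hxc, ⟨Mx, hMx⟩, hxd⟩ := hx
  obtain ⟨hyc, ⟨My, hMy⟩, hyd⟩ := hy
  have haU : ∀ i, 0 < aU i := fun i => (haL i).trans_le ((ha i 0).1.trans (ha i 0).2)
  have hKi : ∀ i j, IntegrableOn (K i j) (Set.Ioi 0) := fun i j => by
    by_contra hni
    have := hK1 i j
    rw [integral_undef hni] at this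
    exact zero_ne_one this
  choose A hAd hAs hAU using fun i => exists_primitive_inv (hac i) (haL i) (ha i)
  choose e he0 he using fun i => exists_eventually_le_neg_of_limsup_neg (hlim i)
  choose C hC using hcbd
  have hC0 : ∀ i j, 0 ≤ C i j := fun i j => (abs_nonneg _).trans (hC i j 0 le_rfl)
  obtain ⟨ε, hεe, hε⟩ : ∃ ε : ℝ, (∀ i, ε ≤ e i / dv i) ∧ 0 < ε := by
    have h1 : ∀ᶠ ε in nhdsWithin (0:ℝ) (Set.Ioi 0), ∀ i, ε ≤ e i / dv i :=
      eventually_all.2 fun i => nhdsWithin_le_nhds (Iic_mem_nhds (div_pos (he0 i) (hdv i)))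
    exact (h1.and self_mem_nhdsWithin).exists
  obtain ⟨T, hT⟩ := eventually_atTop.1 ((eventually_all.2 he).and (eventually_ge_atTop t₀))
  set v : Fin (n+1) → ℝ → ℝ := fun i t => (A i (x i t) - A i (y i t)) / dv i with hv
  have hAc : ∀ i, Continuous (A i) := fun i =>
    continuous_iff_continuousAt.2 fun u => (hAd i u).continuousAt
  have hvc : ∀ i, Continuous (v i) := fun i =>
    (((hAc i).comp (hxc i)).sub ((hAc i).comp (hyc i))).div_const _
  have hxy : ∀ i t, |x i t - y i t| ≤ aU i * dv i * |v i t| := fun i t => by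
    rw [hv, abs_div, abs_of_pos (hdv i)]
    have := hAU i (x i t) (y i t)
    have := (hdv i).ne'
    field_simp
    assumption
  choose Bx hBx using fun i => (hxc i).exists_abs_le_of_le (hMx i)
  choose By hBy using fun i => (hyc i).exists_abs_le_of_le (hMy i)
  have hvL : ∀ i t, |v i t| ≤ |x i t - y i t| / (aL i * dv i) := fun i t => by
    obtain ⟨s, hs, hsv⟩ := exists_sign_mul_eq_abs (A i (x i t) - A i (y i t))
    have h1 := hAs i _ _ s hs (by rw [hsv]; exact abs_nonneg _)
    rw [hsv] at h1
    have h2 := h1.trans (sign_mul_le_abs hs _)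
    rw [hv, abs_div, abs_of_pos (hdv i), div_le_div_iff₀ (hdv i) (mul_pos (haL i) (hdv i))]
    nlinarith [hdv i]
  have hvB : ∀ i t, ∀ s ≤ t, |v i s| ≤ (Bx i t + By i t) / (aL i * dv i) := fun i t s hs =>
    (hvL i s).trans (div_le_div_of_nonneg_right
      ((abs_sub _ _).trans (add_le_add (hBx i t s hs) (hBy i t s hs)))
      (mul_pos (haL i) (hdv i)).le)
  set S : ℝ := ∑ i, ∑ j, ς i * C i j * aU j * dv j / dv i with hS
  have hterm : ∀ i j, 0 ≤ ς i * C i j * aU j * dv j / dv i := fun i j =>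
    div_nonneg (mul_nonneg (mul_nonneg (mul_nonneg (hς i).le (hC0 i j)) (haU j).le) (hdv j).le)
      (hdv i).le
  have hS0 : 0 ≤ S := Finset.sum_nonneg fun i _ => Finset.sum_nonneg fun j _ => hterm i j
  have hineq : DominatedDelayIneq K v
      (fun i t => ((a i (x i t))⁻¹ * Srhs n a b c Gf K x i t -
        (a i (y i t))⁻¹ * Srhs n a b c Gf K y i t) / dv i)
      (fun i t => aL i * β i t) (fun i j t => ς i * |c i j t| * aU j * dv j / dv i) T ε S := by
    refine ⟨fun i j u hu => hK0 i j u hu.le, hK1, hvc, fun i t ht => ?_, fun i t ht s hs hsv => ?_,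
      fun i j t ht => ?_, fun i t ht => ?_, hε, fun i t ht => ?_⟩
    · have ht0 : t₀ < t := (hT T le_rfl).2.trans_lt ht
      exact (((hAd i _).comp t (hxd i t ht0)).sub ((hAd i _).comp t (hyd i t ht0))).div_const _
    · have ht0 : 0 ≤ t := ht₀.trans ((hT t ht.le).2)
      have hd := hdv i
      have hsw : 0 ≤ s * (A i (x i t) - A i (y i t)) := by
        have : s * v i t = s * (A i (x i t) - A i (y i t)) / dv i := by rw [hv]; ring
        rw [this] at hsv
        by_contra! hneg
        exact absurd hsv (div_neg_of_neg_of_pos hneg hd).not_ge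
      have hsx := hAs i _ _ s hs hsw
      have hsx0 : 0 ≤ s * (x i t - y i t) := (mul_nonneg (haL i).le hsw).trans hsx
      have hbs : β i t * (s * (x i t - y i t)) ≤ s * (b i t (x i t) - b i t (y i t)) := by
        by_cases hne : x i t = y i t
        · simp [hne]
        · have h1 := mul_le_mul_of_nonneg_right (hb i t ht0 _ _ hne) hsx0
          have h2 : x i t - y i t ≠ 0 := sub_ne_zero.2 hne
          refine h1.trans_eq ?_
          field_simp
      have hbs' := mul_le_mul_of_nonneg_left hsx (hβ0 i t ht0)
      set X := ∑ j, c i j t * ∫ u in Set.Ioi (0:ℝ), x j (t - u) * K i j u with hX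
      set Y := ∑ j, c i j t * ∫ u in Set.Ioi (0:ℝ), y j (t - u) * K i j u with hY
      have hXY : |X - Y| ≤ ∑ j, |c i j t| * (aU j * dv j * delayAvg (K i j) (v j) t) := by
        rw [hX, hY, ← Finset.sum_sub_distrib]
        refine (Finset.abs_sum_le_sum_abs _ _).trans (Finset.sum_le_sum fun j _ => ?_)
        rw [← mul_sub, abs_mul]
        exact mul_le_mul_of_nonneg_left
          (abs_integral_delay_sub_le (hxc j) (hyc j) (hvc j) (hBx j t) (hBy j t) (hvB j t)
            (fun u hu => hK0 i j u hu.le) (hKi i j) (hxy j)) (abs_nonneg _)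
      have hGs : s * (Gf i X - Gf i Y) ≤
          ς i * ∑ j, |c i j t| * (aU j * dv j * delayAvg (K i j) (v j) t) :=
        (sign_mul_le_abs hs _).trans
          ((hG i X Y).trans (mul_le_mul_of_nonneg_left hXY (hς i).le))
      have hrx : (a i (x i t))⁻¹ * Srhs n a b c Gf K x i t = -(b i t (x i t)) + Gf i X :=
        inv_mul_cancel_left₀ (ha0 i _).ne' _
      have hry : (a i (y i t))⁻¹ * Srhs n a b c Gf K y i t = -(b i t (y i t)) + Gf i Y :=
        inv_mul_cancel_left₀ (ha0 i _).ne' _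
      have hsum : ∑ j, ς i * |c i j t| * aU j * dv j / dv i * delayAvg (K i j) (v j) t =
          (ς i * ∑ j, |c i j t| * (aU j * dv j * delayAvg (K i j) (v j) t)) / dv i := by
        rw [Finset.mul_sum, Finset.sum_div]
        exact Finset.sum_congr rfl fun j _ => by ring
      have hl : s * ((-(b i t (x i t)) + Gf i X - (-(b i t (y i t)) + Gf i Y)) / dv i) =
          (-(s * (b i t (x i t) - b i t (y i t))) + s * (Gf i X - Gf i Y)) / dv i := by ring
      have hr : -(aL i * β i t * (s * v i t)) =
          -(β i t * (aL i * (s * (A i (x i t) - A i (y i t))))) / dv i := by rw [hv]; ring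
      simp only [hrx, hry]
      rw [hl, hr, hsum, ← add_div]
      exact div_le_div_of_nonneg_right (by linarith) hd.le
    · exact div_nonneg (mul_nonneg (mul_nonneg (mul_nonneg (hς i).le (abs_nonneg _)) (haU j).le)
        (hdv j).le) (hdv i).le
    · have ht0 : 0 ≤ t := ht₀.trans ((hT t ht.le).2)
      refine le_trans (Finset.sum_le_sum fun j _ => ?_)
        (Finset.single_le_sum (f := fun i => ∑ j, ς i * C i j * aU j * dv j / dv i)
          (fun i _ => Finset.sum_nonneg fun j _ => hterm i j) (Finset.mem_univ i))
      have h1 := hς i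
      have h2 := haU j
      have h3 := hdv j
      have h4 := hdv i
      have h5 := hC i j t ht0
      gcongr
    · have h1 := (hT t ht.le).1 i
      have hd := hdv i
      have h2 := (le_div_iff₀ hd).1 (hεe i)
      rw [← Finset.sum_div, ← le_sub_iff_add_le', div_le_iff₀ hd]
      linarith
  obtain ⟨M, hM⟩ : ∃ M : ℝ, ∀ i, ∀ t ≤ T, |v i t| < M := by
    obtain ⟨l, hl⟩ := Set.exists_upper_bound_image (Set.univ : Set (Fin (n+1)))
      (fun i => (Bx i T + By i T) / (aL i * dv i)) Set.finite_univ
    exact ⟨(Bx l T + By l T) / (aL l * dv l) + 1, fun i t ht =>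
      ((hvB i T t ht).trans (hl i (Set.mem_univ i))).trans_lt (lt_add_one _)⟩
  have hdiff : ∀ i, Tendsto (fun t => |x i t - y i t|) atTop (nhds 0) := fun i => by
    have h1 := ((hineq.tendsto_zero hS0 hM i).abs).const_mul (aU i * dv i)
    rw [abs_zero, mul_zero] at h1
    exact squeeze_zero (fun _ => abs_nonneg _) (hxy i) h1
  have hsup := Tendsto.finset_sup'_nhds_apply Finset.univ_nonempty
    (fun i (_ : i ∈ (Finset.univ : Finset (Fin (n+1)))) => hdiff i)
  rwa [Finset.sup'_const] at hsup
end

section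
/- Let ω > 0. Assume: (i) for each u ∈ ℝ the map t ↦ b_i(t,u) is ω-periodic and each c_{ij} is ω-periodic; (ii) there are ω-periodic continuous β_i, β_i* : [0,∞) → (0,∞) with β_i(t) ≤ (b_i(t,u)−b_i(t,v))/(u−v) ≤ β_i*(t) for all t ≥ 0 and u ≠ v; (iii) each G_i is Lipschitz with constant ς_i > 0; (iv) there are constants 0 < a̲_i ≤ ā_i with a̲_i ≤ a_i(u) ≤ ā_i for all u ∈ ℝ. If there exist d₁,…,d_n > 0 such that for every t ∈ [0,ω] and every i: a̲_i β_i(t) d_i > Σ_{j=1}^{n} ς_i |c_{ij}(t)| ā_j d_j, then there exists an ω-periodic solution x̃ of (S) (a continuous ω-periodic x̃ : ℝ → ℝ^n, differentiable and satisfying (S) for all t > 0) such that every solution x of (S) with bounded initial condition satisfies lim_{t→+∞} |x(t) − x̃(t)| = 0. -/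
open MeasureTheory Filter

lemma le_of_mul_add_deriv_le {u u' : ℝ → ℝ} {M P s t : ℝ} (hM : 0 < M) (hst : s ≤ t)
    (hc : ContinuousOn u (Set.Icc s t)) (hd : ∀ r ∈ Set.Ioo s t, HasDerivAt u (u' r) r)
    (hb : ∀ r ∈ Set.Ioo s t, M * u r + u' r ≤ P) :
    u t ≤ P / M + Real.exp (-(M * (t - s))) * (u s - P / M) := by
  have hder : ∀ r ∈ Set.Ioo s t, HasDerivAt (fun r => Real.exp (M * (r - s)) * (u r - P / M))
      (Real.exp (M * (r - s)) * (M * u r + u' r - P)) r := by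
    intro r hr
    have h1 : HasDerivAt (fun r => Real.exp (M * (r - s))) (Real.exp (M * (r - s)) * (M * 1)) r :=
      (((hasDerivAt_id r).sub_const s).const_mul M).exp
    refine (h1.mul ((hd r hr).sub_const (P / M))).congr_deriv ?_
    field_simp
    ring
  have hanti : AntitoneOn (fun r => Real.exp (M * (r - s)) * (u r - P / M)) (Set.Icc s t) := by
    refine antitoneOn_of_deriv_nonpos (convex_Icc s t) ?_ ?_ ?_
    · fun_prop
    · rw [interior_Icc]
      exact fun r hr => (hder r hr).differentiableAt.differentiableWithinAt
    · rw [interior_Icc]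
      intro r hr
      rw [(hder r hr).deriv]
      exact mul_nonpos_of_nonneg_of_nonpos (Real.exp_pos _).le (by linarith [hb r hr])
  have h := hanti (Set.left_mem_Icc.2 hst) (Set.right_mem_Icc.2 hst) hst
  simp only [sub_self, mul_zero, Real.exp_zero, one_mul] at h
  have h2 := mul_le_mul_of_nonneg_left h (Real.exp_pos (-(M * (t - s)))).le
  rw [← mul_assoc, ← Real.exp_add, neg_add_cancel, Real.exp_zero, one_mul] at h2
  linarith

lemma abs_le_of_abs_mul_add_deriv_le {u u' : ℝ → ℝ} {M P s t : ℝ} (hM : 0 < M) (hst : s ≤ t)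
    (hc : ContinuousOn u (Set.Icc s t)) (hd : ∀ r ∈ Set.Ioo s t, HasDerivAt u (u' r) r)
    (hb : ∀ r ∈ Set.Ioo s t, |M * u r + u' r| ≤ P) :
    |u t| ≤ P / M + Real.exp (-(M * (t - s))) * (|u s| - P / M) := by
  have he := (Real.exp_pos (-(M * (t - s)))).le
  have h1 := le_of_mul_add_deriv_le hM hst hc hd fun r hr => (abs_le.1 (hb r hr)).2
  have h2 := le_of_mul_add_deriv_le (u := fun r => -u r) (u' := fun r => -u' r) (P := P) hM hst
    hc.neg (fun r hr => (hd r hr).neg) fun r hr => by linarith [(abs_le.1 (hb r hr)).1]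
  have h3 := mul_le_mul_of_nonneg_left (le_abs_self (u s)) he
  have h4 := mul_le_mul_of_nonneg_left (neg_le_abs (u s)) he
  rw [abs_le']
  constructor <;> linarith

lemma tendsto_exp_neg_mul_sub_atBot {M : ℝ} (hM : 0 < M) (t : ℝ) :
    Tendsto (fun s => Real.exp (-(M * (t - s)))) atBot (nhds 0) := by
  refine Real.tendsto_exp_atBot.comp (tendsto_neg_atTop_atBot.comp ?_)
  refine Tendsto.const_mul_atTop hM ?_
  exact (tendsto_atTop_add_const_left atBot t tendsto_neg_atBot_atTop).congr fun s =>
    (sub_eq_add_neg t s).symm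

lemma tendsto_exp_neg_mul_sub_atTop {M : ℝ} (hM : 0 < M) (s : ℝ) :
    Tendsto (fun t => Real.exp (-(M * (t - s)))) atTop (nhds 0) := by
  refine Real.tendsto_exp_atBot.comp (tendsto_neg_atTop_atBot.comp ?_)
  refine Tendsto.const_mul_atTop hM ?_
  simpa [sub_eq_add_neg] using tendsto_atTop_add_const_right atTop (-s) tendsto_id

lemma abs_le_div_of_bounded {u u' : ℝ → ℝ} {M P R : ℝ} (hM : 0 < M)
    (hd : ∀ r, HasDerivAt u (u' r) r) (hR : ∀ r, |u r| ≤ R)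
    (hb : ∀ r, |M * u r + u' r| ≤ P) (t : ℝ) : |u t| ≤ P / M := by
  have hlim : Tendsto (fun s => P / M + Real.exp (-(M * (t - s))) * (R - P / M)) atBot
      (nhds (P / M)) := by
    simpa using ((tendsto_exp_neg_mul_sub_atBot hM t).mul_const (R - P / M)).const_add (P / M)
  refine ge_of_tendsto hlim ((eventually_le_atBot t).mono fun s hs => ?_)
  have h := abs_le_of_abs_mul_add_deriv_le hM hs
    (fun r _ => (hd r).continuousAt.continuousWithinAt) (fun r _ => hd r) fun r _ => hb r
  have h2 := mul_le_mul_of_nonneg_left (sub_le_sub_right (hR s) (P / M))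
    (Real.exp_pos (-(M * (t - s)))).le
  linarith

lemma exists_bounded_hasDerivAt {g : ℝ → ℝ} {M P : ℝ} (hM : 0 < M) (hg : Continuous g)
    (hP : ∀ t, |g t| ≤ P) :
    ∃ u : ℝ → ℝ, (∀ t, HasDerivAt u (g t - M * u t) t) ∧ ∃ R, ∀ t, |u t| ≤ R := by
  have hexp : ∀ t, IntegrableOn (fun s => Real.exp (M * s)) (Set.Iic t) := fun t =>
    integrableOn_exp_mul_Iic hM t
  have hcont : Continuous fun s => Real.exp (M * s) * g s := by fun_prop
  have hint : ∀ t, IntegrableOn (fun s => Real.exp (M * s) * g s) (Set.Iic t) := fun t => by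
    refine ((hexp t).mul_const P).mono' hcont.aestronglyMeasurable (ae_of_all _ fun s => ?_)
    rw [norm_mul, Real.norm_eq_abs, Real.abs_exp]
    exact mul_le_mul_of_nonneg_left (hP s) (Real.exp_pos _).le
  have hF : ∀ t, HasDerivAt (fun t => ∫ s in Set.Iic t, Real.exp (M * s) * g s)
      (Real.exp (M * t) * g t) t := by
    intro t
    have h := (intervalIntegral.integral_hasDerivAt_right (hcont.intervalIntegrable 0 t)
      (hcont.stronglyMeasurableAtFilter _ _) hcont.continuousAt).const_add
        (∫ s in Set.Iic (0 : ℝ), Real.exp (M * s) * g s)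
    refine h.congr_of_eventuallyEq (Eventually.of_forall fun r => ?_)
    have := intervalIntegral.integral_Iic_sub_Iic (hint 0) (hint r)
    simp only
    linarith
  refine ⟨fun t => Real.exp (-(M * t)) * ∫ s in Set.Iic t, Real.exp (M * s) * g s,
    fun t => ?_, P / M, fun t => ?_⟩
  · have h1 : HasDerivAt (fun r => Real.exp (-(M * r))) (Real.exp (-(M * t)) * -(M * 1)) t :=
      (((hasDerivAt_id t).const_mul M).neg).exp
    refine (h1.mul (hF t)).congr_deriv ?_
    rw [← mul_assoc (Real.exp _) (Real.exp _), ← Real.exp_add, neg_add_cancel, Real.exp_zero]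
    ring
  · rw [abs_mul, Real.abs_exp]
    have h1 : |∫ s in Set.Iic t, Real.exp (M * s) * g s| ≤
        ∫ s in Set.Iic t, Real.exp (M * s) * P := by
      refine (Real.norm_eq_abs _).symm.trans_le
        (norm_integral_le_of_norm_le ((hexp t).mul_const P) (ae_of_all _ fun s => ?_))
      rw [norm_mul, Real.norm_eq_abs, Real.abs_exp]
      exact mul_le_mul_of_nonneg_left (hP s) (Real.exp_pos _).le
    rw [integral_mul_const, integral_exp_mul_Iic hM] at h1
    refine (mul_le_mul_of_nonneg_left h1 (Real.exp_pos _).le).trans_eq ?_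
    rw [Real.exp_neg]
    field_simp

lemma integral_abs_comp_sub_mul_le {k δ : ℝ → ℝ} (hk : IntegrableOn k (Set.Ioi 0))
    (hk0 : ∀ u ≥ (0 : ℝ), 0 ≤ k u) (hk1 : ∫ u in Set.Ioi (0 : ℝ), k u = 1) {L t : ℝ}
    (hδ : ∀ r ≤ t, |δ r| ≤ L) : ∫ u in Set.Ioi (0 : ℝ), |δ (t - u)| * k u ≤ L := by
  have h : ∫ u in Set.Ioi (0 : ℝ), |δ (t - u)| * k u ≤ ∫ u in Set.Ioi (0 : ℝ), L * k u := by
    refine integral_mono_of_nonneg ?_ (hk.const_mul L) ?_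
    · filter_upwards [ae_restrict_mem measurableSet_Ioi] with u hu
      exact mul_nonneg (abs_nonneg _) (hk0 u (le_of_lt hu))
    · filter_upwards [ae_restrict_mem measurableSet_Ioi] with u hu
      exact mul_le_mul_of_nonneg_right (hδ _ (sub_le_self t (le_of_lt hu))) (hk0 u (le_of_lt hu))
  rwa [integral_const_mul, hk1, mul_one] at h

lemma eventually_integral_abs_comp_sub_mul_le {k δ : ℝ → ℝ} (hk : IntegrableOn k (Set.Ioi 0))
    (hk0 : ∀ u ≥ (0 : ℝ), 0 ≤ k u) (hk1 : ∫ u in Set.Ioi (0 : ℝ), k u = 1) {L R η : ℝ}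
    (hδc : Continuous δ) (hδ : ∀ r, |δ r| ≤ R) (hL0 : 0 ≤ L) (hη : 0 < η)
    (hL : ∀ᶠ r in atTop, |δ r| ≤ L) :
    ∀ᶠ t in atTop, ∫ u in Set.Ioi (0 : ℝ), |δ (t - u)| * k u ≤ L + η := by
  have hR : 0 ≤ R := (abs_nonneg _).trans (hδ 0)
  have hmeas : ∀ t : ℝ, AEStronglyMeasurable (fun u => max |δ (t - u)| L * k u)
      (volume.restrict (Set.Ioi 0)) := fun t =>
    (Continuous.aestronglyMeasurable (by fun_prop)).mul hk.aestronglyMeasurable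
  have hbd : ∀ t : ℝ, ∀ᵐ u ∂(volume.restrict (Set.Ioi (0 : ℝ))),
      ‖max |δ (t - u)| L * k u‖ ≤ (R + L) * k u := fun t => by
    filter_upwards [ae_restrict_mem measurableSet_Ioi] with u hu
    have hku := hk0 u (le_of_lt hu)
    rw [Real.norm_eq_abs, abs_of_nonneg (mul_nonneg (le_max_of_le_right hL0) hku)]
    exact mul_le_mul_of_nonneg_right
      (max_le ((hδ _).trans (by linarith)) (by linarith)) hku
  have hlim : Tendsto (fun t => ∫ u in Set.Ioi (0 : ℝ), max |δ (t - u)| L * k u) atTop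
      (nhds (∫ u in Set.Ioi (0 : ℝ), L * k u)) := by
    refine tendsto_integral_filter_of_dominated_convergence (fun u => (R + L) * k u)
      (Eventually.of_forall hmeas) (Eventually.of_forall hbd) (hk.const_mul _)
      (ae_of_all _ fun u => ?_)
    refine tendsto_const_nhds.congr' ?_
    have hsh : Tendsto (fun t : ℝ => t - u) atTop atTop := by
      simpa [sub_eq_add_neg] using tendsto_atTop_add_const_right atTop (-u) tendsto_id
    filter_upwards [hsh.eventually hL] with t ht
    rw [max_eq_right ht]
  rw [integral_const_mul, hk1, mul_one] at hlim
  filter_upwards [hlim.eventually_lt_const (lt_add_of_pos_right L hη)] with t ht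
  refine le_trans (integral_mono_of_nonneg ?_ ((hk.const_mul (R + L)).mono' (hmeas t) (hbd t)) ?_)
    ht.le
  · filter_upwards [ae_restrict_mem measurableSet_Ioi] with u hu
    exact mul_nonneg (abs_nonneg _) (hk0 u (le_of_lt hu))
  · filter_upwards [ae_restrict_mem measurableSet_Ioi] with u hu
    exact mul_le_mul_of_nonneg_right (le_max_left _ _) (hk0 u (le_of_lt hu))

/-- A Halanay-type principle with distributed infinite delay: if `D' = -M D + p` and `p` is
dominated by `M - ε` times the present and averaged past sizes of `D`, then `D` decays. -/
theorem tendsto_zero_of_delay_contraction {ι : Type*} [Fintype ι] {k : ι → ι → ℝ → ℝ}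
    (hk : ∀ i j, IntegrableOn (k i j) (Set.Ioi 0)) (hk0 : ∀ i j, ∀ u ≥ (0 : ℝ), 0 ≤ k i j u)
    (hk1 : ∀ i j, ∫ u in Set.Ioi (0 : ℝ), k i j u = 1) {M ε t₀ R : ℝ} (hM : 0 < M) (hε : 0 < ε)
    (hεM : ε ≤ M) {D D' : ι → ℝ → ℝ} (hDc : ∀ i, Continuous (D i))
    (hD0 : ∀ i, ∀ t ≤ t₀, |D i t| ≤ R) (hD' : ∀ i, ∀ t > t₀, HasDerivAt (D i) (D' i t) t)
    (hest : ∀ i, ∀ t > t₀, ∀ L, |D i t| ≤ L →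
      (∀ j, ∫ u in Set.Ioi (0 : ℝ), |D j (t - u)| * k i j u ≤ L) →
      |M * D i t + D' i t| ≤ (M - ε) * L) (i : ι) :
    Tendsto (D i) atTop (nhds 0) := by
  have hR : 0 ≤ R := (abs_nonneg _).trans (hD0 i t₀ le_rfl)
  set q : ℝ := (M - ε) / M with hq
  have hq0 : 0 ≤ q := div_nonneg (by linarith) hM.le
  have hq1 : q < 1 := (div_lt_one hM).2 (by linarith)
  have hbound : ∀ j t, |D j t| ≤ R := by
    intro j T
    obtain ⟨B, hB⟩ : ∃ B, ∀ j, ∀ r ≤ T, |D j r| ≤ max R B := by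
      obtain ⟨B, hB⟩ := (isCompact_Icc (a := t₀) (b := T)).exists_bound_of_continuousOn
        (continuous_pi hDc).continuousOn
      refine ⟨B, fun j r hr => ?_⟩
      rcases le_total r t₀ with h | h
      · exact (hD0 j r h).trans (le_max_left _ _)
      · exact ((norm_le_pi_norm (fun j => D j r) j).trans (hB r ⟨h, hr⟩)).trans (le_max_right _ _)
    have hiter : ∀ m : ℕ, ∀ j, ∀ r ≤ T, |D j r| ≤ max R (q ^ m * B) := by
      intro m
      induction m with
      | zero => simpa using hB
      | succ m ih =>
        intro j r hr
        rcases le_total r t₀ with h | h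
        · exact (hD0 j r h).trans (le_max_left _ _)
        set S := max R (q ^ m * B)
        have h1 := abs_le_of_abs_mul_add_deriv_le (u := D j) (u' := D' j) (P := (M - ε) * S) hM h
          (hDc j).continuousOn (fun s hs => hD' j s hs.1) fun s hs =>
            hest j s hs.1 S (ih j s (hs.2.le.trans hr)) fun l =>
              integral_abs_comp_sub_mul_le (hk j l) (hk0 j l) (hk1 j l) fun r' hr' =>
                ih l r' (hr'.trans (hs.2.le.trans hr))
        have hqS : (M - ε) * S / M = q * S := by rw [hq]; ring
        rw [hqS] at h1
        have he0 := Real.exp_pos (-(M * (r - t₀)))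
        have he1 : Real.exp (-(M * (r - t₀))) ≤ 1 :=
          Real.exp_le_one_iff.2 (neg_nonpos.2 (mul_nonneg hM.le (sub_nonneg.2 h)))
        have h2 := hD0 j t₀ le_rfl
        have hmax : q * S ≤ max R (q ^ (m + 1) * B) := by
          rcases le_total R (q ^ m * B) with h3 | h3
          · simp only [S, max_eq_right h3]
            exact le_max_of_le_right (le_of_eq (by ring))
          · simp only [S, max_eq_left h3]
            exact le_max_of_le_left (mul_le_of_le_one_left hR hq1.le)
        have hRm := le_max_left R (q ^ (m + 1) * B)
        nlinarith [mul_nonneg he0.le (sub_nonneg.2 (h2.trans hRm)),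
          mul_nonneg (sub_nonneg.2 he1) (sub_nonneg.2 hmax)]
    have hlim : Tendsto (fun m : ℕ => max R (q ^ m * B)) atTop (nhds (max R (0 * B))) :=
      tendsto_const_nhds.max ((tendsto_pow_atTop_nhds_zero_of_lt_one hq0 hq1).mul_const B)
    rw [zero_mul, max_eq_left hR] at hlim
    exact ge_of_tendsto hlim (Eventually.of_forall fun m => hiter m j T le_rfl)
  have hstep : ∀ L > 0, (∀ᶠ t in atTop, ∀ j, |D j t| ≤ L) →
      ∀ᶠ t in atTop, ∀ j, |D j t| ≤ (1 + q) / 2 * L := by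
    intro L hL hev
    set η := (1 - q) * L / 4 with hη
    have hη0 : 0 < η := by
      have := mul_pos (sub_pos.2 hq1) hL
      positivity
    have hconv : ∀ᶠ t in atTop, ∀ i j,
        ∫ u in Set.Ioi (0 : ℝ), |D j (t - u)| * k i j u ≤ L + η :=
      eventually_all.2 fun i => eventually_all.2 fun j =>
        eventually_integral_abs_comp_sub_mul_le (hk i j) (hk0 i j) (hk1 i j) (hDc j) (hbound j)
          hL.le hη0 (eventually_all.1 hev j)
    obtain ⟨s, hs⟩ := eventually_atTop.1 ((hev.and hconv).and (eventually_ge_atTop t₀))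
    refine eventually_all.2 fun j => ?_
    have hlim : Tendsto (fun t => (M - ε) * (L + η) / M +
        Real.exp (-(M * (t - s))) * (|D j s| - (M - ε) * (L + η) / M)) atTop
        (nhds ((M - ε) * (L + η) / M)) := by
      simpa using ((tendsto_exp_neg_mul_sub_atTop hM s).mul_const _).const_add _
    have hlt : (M - ε) * (L + η) / M < (1 + q) / 2 * L := by
      have : (M - ε) * (L + η) / M = q * (L + η) := by rw [hq]; ring
      rw [this]
      have h1 : q * η < η := mul_lt_of_lt_one_left hη0 hq1
      have h2 : q * (L + η) = q * L + q * η := by ring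
      have h3 : (1 + q) / 2 * L = q * L + 2 * η := by rw [hη]; ring
      linarith
    filter_upwards [hlim.eventually_lt_const hlt, eventually_ge_atTop s] with t ht hst
    refine (abs_le_of_abs_mul_add_deriv_le (u' := D' j) hM hst (hDc j).continuousOn
      (fun r hr => hD' j r ((hs s le_rfl).2.trans_lt hr.1)) fun r hr => ?_).trans ht.le
    exact hest j r ((hs s le_rfl).2.trans_lt hr.1) _
      (((hs r hr.1.le).1.1 j).trans (by linarith)) ((hs r hr.1.le).1.2 j)
  have hgeom : ∀ m : ℕ, ∀ᶠ t in atTop, ∀ j, |D j t| ≤ ((1 + q) / 2) ^ m * (R + 1) := by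
    intro m
    induction m with
    | zero => exact Eventually.of_forall fun t j => by linarith [hbound j t]
    | succ m ih => simpa only [pow_succ', mul_assoc] using hstep _ (by positivity) ih
  have hlim : Tendsto (fun m : ℕ => ((1 + q) / 2) ^ m * (R + 1)) atTop (nhds 0) := by
    simpa using (tendsto_pow_atTop_nhds_zero_of_lt_one (r := (1 + q) / 2) (by positivity)
      (by linarith)).mul_const (R + 1)
  rw [Metric.tendsto_nhds]
  intro e he
  obtain ⟨m, hm⟩ := (hlim.eventually_lt_const he).exists
  filter_upwards [hgeom m] with t ht
  rw [Real.dist_eq, sub_zero]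
  exact (ht i).trans_lt hm

/-- Existence of a bounded periodic solution for a nonautonomous functional equation satisfying
a one-sided contraction estimate with distributed delays. -/
theorem exists_periodic_of_delay_contraction {ι : Type*} [Fintype ι] {k : ι → ι → ℝ → ℝ}
    (hk : ∀ i j, IntegrableOn (k i j) (Set.Ioi 0)) (hk0 : ∀ i j, ∀ u ≥ (0 : ℝ), 0 ≤ k i j u)
    (hk1 : ∀ i j, ∫ u in Set.Ioi (0 : ℝ), k i j u = 1) {M ε ω : ℝ} (hM : 0 < M) (hε : 0 < ε)
    (hεM : ε ≤ M) {Q : (ι → ℝ → ℝ) → ι → ℝ → ℝ}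
    (hest : ∀ (w v : ι → ℝ → ℝ) (i : ι) (t L : ℝ), (∀ j, Continuous (w j)) →
      (∀ j, Continuous (v j)) → (∃ R, ∀ j, ∀ r ≤ t, |w j r| ≤ R) →
      (∃ R, ∀ j, ∀ r ≤ t, |v j r| ≤ R) → |w i t - v i t| ≤ L →
      (∀ j, ∫ u in Set.Ioi (0 : ℝ), |w j (t - u) - v j (t - u)| * k i j u ≤ L) →
      |M * (w i t - v i t) + (Q w i t - Q v i t)| ≤ (M - ε) * L)
    (hQc : ∀ w : ι → ℝ → ℝ, (∀ j, Continuous (w j)) → (∃ R, ∀ j r, |w j r| ≤ R) →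
      ∀ i, Continuous (Q w i))
    (hQ0 : ∃ R, ∀ i t, |Q 0 i t| ≤ R)
    (hQper : ∀ w i t, Q w i (t + ω) = Q (fun j r => w j (r + ω)) i t) :
    ∃ v : ι → ℝ → ℝ, (∀ i t, HasDerivAt (v i) (Q v i t) t) ∧ (∃ R, ∀ i t, |v i t| ≤ R) ∧
      ∀ i t, v i (t + ω) = v i t := by
  have hest' : ∀ (w v : ι → ℝ → ℝ) (L : ℝ), (∀ j, Continuous (w j)) → (∀ j, Continuous (v j)) →
      (∃ R, ∀ j r, |w j r| ≤ R) → (∃ R, ∀ j r, |v j r| ≤ R) →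
      (∀ j r, |w j r - v j r| ≤ L) → ∀ i t,
      |M * (w i t - v i t) + (Q w i t - Q v i t)| ≤ (M - ε) * L := by
    rintro w v L hw hv ⟨R, hR⟩ ⟨R', hR'⟩ hL i t
    exact hest w v i t L hw hv ⟨R, fun j r _ => hR j r⟩ ⟨R', fun j r _ => hR' j r⟩ (hL i t)
      fun j => integral_abs_comp_sub_mul_le (δ := fun r => w j r - v j r) (hk i j) (hk0 i j)
        (hk1 i j) fun r _ => hL j r
  have hcoord : ∀ w : BoundedContinuousFunction ℝ (ι → ℝ), ∀ j, Continuous fun t => w t j :=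
    fun w j => (continuous_apply j).comp w.continuous
  have hcoordb : ∀ w : BoundedContinuousFunction ℝ (ι → ℝ), ∀ j r, |w r j| ≤ ‖w‖ :=
    fun w j r => (norm_le_pi_norm (w r) j).trans (w.norm_coe_le_norm r)
  have hsol : ∀ w : BoundedContinuousFunction ℝ (ι → ℝ),
      ∃ u : BoundedContinuousFunction ℝ (ι → ℝ), ∀ i t, HasDerivAt (fun r => u r i)
        (M * w t i + Q (fun j r => w r j) i t - M * u t i) t := by
    intro w
    obtain ⟨R0, hR0⟩ := hQ0
    have hb : ∀ i t, |M * w t i + Q (fun j r => w r j) i t| ≤ (M - ε) * ‖w‖ + R0 := by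
      intro i t
      have h := hest' (fun j r => w r j) 0 ‖w‖ (hcoord w) (fun _ => continuous_const)
        ⟨_, hcoordb w⟩ ⟨0, by simp⟩ (by simpa using hcoordb w) i t
      have h2 := hR0 i t
      simp only [Pi.zero_apply, sub_zero] at h
      rw [abs_le] at *
      constructor <;> linarith
    have hc : ∀ i, Continuous fun t => M * w t i + Q (fun j r => w r j) i t := fun i =>
      ((hcoord w i).const_mul M).add (hQc _ (hcoord w) ⟨_, hcoordb w⟩ i)
    choose u hu Ru hRu using fun i => exists_bounded_hasDerivAt hM (hc i) (hb i)
    refine ⟨BoundedContinuousFunction.ofNormedAddCommGroup (fun t i => u i t)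
      (continuous_pi fun i => continuous_iff_continuousAt.2 fun t => (hu i t).continuousAt)
      (∑ i, |Ru i|) fun t => ?_, hu⟩
    refine (pi_norm_le_iff_of_nonneg (Finset.sum_nonneg fun _ _ => abs_nonneg _)).2 fun i => ?_
    exact ((hRu i t).trans (le_abs_self _)).trans
      (Finset.single_le_sum (f := fun i => |Ru i|) (fun _ _ => abs_nonneg _) (Finset.mem_univ i))
  choose T hT using hsol
  have hq0 : 0 ≤ (M - ε) / M := div_nonneg (by linarith) hM.le
  obtain ⟨κ, hκ⟩ : ∃ κ : NNReal, (κ : ℝ) = (M - ε) / M := ⟨⟨_, hq0⟩, rfl⟩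
  have hcontr : ContractingWith κ T := by
    refine ⟨?_, LipschitzWith.of_dist_le_mul fun w v => ?_⟩
    · rw [← NNReal.coe_lt_coe, hκ]
      exact (div_lt_one hM).2 (by linarith)
    · rw [hκ]
      refine (BoundedContinuousFunction.dist_le (mul_nonneg hq0 dist_nonneg)).2 fun t => ?_
      refine (dist_pi_le_iff (mul_nonneg hq0 dist_nonneg)).2 fun i => ?_
      rw [Real.dist_eq]
      have hd : ∀ j r, |w r j - v r j| ≤ dist w v := fun j r =>
        (dist_le_pi_dist (w r) (v r) j).trans (BoundedContinuousFunction.dist_coe_le_dist r)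
      have h := abs_le_div_of_bounded (R := ‖T w‖ + ‖T v‖) (P := (M - ε) * dist w v) hM
        (fun r => (hT w i r).sub (hT v i r))
        (fun r => (abs_sub _ _).trans (add_le_add (hcoordb (T w) i r) (hcoordb (T v) i r)))
        (fun r => ?_) t
      · exact h.trans_eq (by ring)
      · refine le_of_eq_of_le ?_ (hest' (fun j r => w r j) (fun j r => v r j) (dist w v)
          (hcoord w) (hcoord v) ⟨_, hcoordb w⟩ ⟨_, hcoordb v⟩ hd i r)
        congr 1
        simp only [Pi.sub_apply]
        ring
  obtain ⟨w, hw⟩ : ∃ w, T w = w := ⟨_, hcontr.fixedPoint_isFixedPt⟩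
  have hsolw : ∀ i t, HasDerivAt (fun r => w r i) (Q (fun j r => w r j) i t) t := fun i t => by
    have := hT w i t
    rw [hw] at this
    exact this.congr_deriv (by ring)
  refine ⟨fun i t => w t i, hsolw, ⟨_, hcoordb w⟩, fun i t => ?_⟩
  have hiter : ∀ m : ℕ, ∀ i t, |w (t + ω) i - w t i| ≤ ((M - ε) / M) ^ m * (2 * ‖w‖) := by
    intro m
    induction m with
    | zero =>
      intro i t
      have := (abs_sub (w (t + ω) i) (w t i)).trans
        (add_le_add (hcoordb w i (t + ω)) (hcoordb w i t))
      linarith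
    | succ m ih =>
      intro i t
      refine (abs_le_div_of_bounded (u := fun t => w (t + ω) i - w t i)
        (P := (M - ε) * (((M - ε) / M) ^ m * (2 * ‖w‖))) hM
        (fun r => ((hsolw i (r + ω)).comp_add_const r ω).sub (hsolw i r)) (ih i)
        (fun r => ?_) t).trans_eq (by ring)
      rw [hQper]
      exact hest' (fun j r => w (r + ω) j) (fun j r => w r j) _
        (fun j => (hcoord w j).comp (continuous_add_const ω)) (hcoord w)
        ⟨_, fun j r => hcoordb w j (r + ω)⟩ ⟨_, hcoordb w⟩ ih i r
  have hlim : Tendsto (fun m : ℕ => ((M - ε) / M) ^ m * (2 * ‖w‖)) atTop (nhds 0) := by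
    simpa using (tendsto_pow_atTop_nhds_zero_of_lt_one hq0
      ((div_lt_one hM).2 (by linarith))).mul_const (2 * ‖w‖)
  exact sub_eq_zero.1 (abs_nonpos_iff.1
    (ge_of_tendsto hlim (Eventually.of_forall fun m => hiter m i t)))

lemma exists_change_of_variable {a : ℝ → ℝ} {l U d : ℝ} (hac : Continuous a) (hl : 0 < l)
    (ha : ∀ u, l ≤ a u ∧ a u ≤ U) (hd : 0 < d) :
    ∃ A φ : ℝ → ℝ, (∀ x, HasDerivAt A (1 / (d * a x)) x) ∧ (∀ x, φ (A x) = x) ∧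
      (∀ y, HasDerivAt φ (d * a (φ y)) y) ∧
      ∀ y z, ∃ s, l * d ≤ s ∧ s ≤ U * d ∧ φ y - φ z = s * (y - z) := by
  have hapos : ∀ x, 0 < a x := fun x => hl.trans_le (ha x).1
  have hU : 0 < U := (hapos 0).trans_le (ha 0).2
  have hne : ∀ x, d * a x ≠ 0 := fun x => (mul_pos hd (hapos x)).ne'
  have hgc : Continuous fun x => 1 / (d * a x) :=
    continuous_const.div (continuous_const.mul hac) hne
  set A : ℝ → ℝ := fun x => ∫ s in (0 : ℝ)..x, 1 / (d * a s) with hA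
  have hAd : ∀ x, HasDerivAt A (1 / (d * a x)) x := fun x =>
    intervalIntegral.integral_hasDerivAt_right (hgc.intervalIntegrable 0 x)
      (hgc.stronglyMeasurableAtFilter _ _) hgc.continuousAt
  have hAc : Continuous A := continuous_iff_continuousAt.2 fun x => (hAd x).continuousAt
  have hmono : StrictMono A := strictMono_of_deriv_pos fun x => by
    rw [(hAd x).deriv]
    exact one_div_pos.2 (mul_pos hd (hapos x))
  have hmono' : Monotone fun x => A x - 1 / (d * U) * x := by
    refine monotone_of_hasDerivAt_nonneg (f' := fun x => 1 / (d * a x) - 1 / (d * U) * 1)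
      (fun x => (hAd x).sub ((hasDerivAt_id x).const_mul _)) fun x => ?_
    simp only [Pi.zero_apply, mul_one, sub_nonneg]
    exact one_div_le_one_div_of_le (mul_pos hd (hapos x)) (mul_le_mul_of_nonneg_left (ha x).2 hd.le)
  have hA0 : A 0 = 0 := by simp [hA]
  have hdU : 0 < 1 / (d * U) := by positivity
  have hsurj : Function.Surjective A := by
    refine hAc.surjective ?_ ?_
    · refine tendsto_atTop_mono' _ ?_ (tendsto_id.const_mul_atTop hdU)
      filter_upwards [eventually_ge_atTop 0] with x hx
      have := hmono' hx
      simp only [hA0, mul_zero, sub_zero] at this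
      simpa using this
    · refine tendsto_atBot_mono' _ ?_ (tendsto_id.const_mul_atBot hdU)
      filter_upwards [eventually_le_atBot 0] with x hx
      have := hmono' hx
      simp only [hA0, mul_zero, sub_zero] at this
      simpa using this
  let e := hmono.orderIsoOfSurjective A hsurj
  have hinv : ∀ y, A (e.symm y) = y := fun y => e.apply_symm_apply y
  have hφd : ∀ y, HasDerivAt e.symm (d * a (e.symm y)) y := fun y => by
    have := (hAd (e.symm y)).of_local_left_inverse e.symm.continuous.continuousAt
      (one_div_ne_zero (hne _)) (Eventually.of_forall hinv)
    simpa using this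
  have hlt : ∀ y z, y < z →
      ∃ s, l * d ≤ s ∧ s ≤ U * d ∧ e.symm z - e.symm y = s * (z - y) := by
    intro y z hyz
    obtain ⟨c, -, hc⟩ := exists_hasDerivAt_eq_slope e.symm _ hyz
      e.symm.continuous.continuousOn fun r _ => hφd r
    refine ⟨d * a (e.symm c), ?_, ?_, ?_⟩
    · rw [mul_comm]
      exact mul_le_mul_of_nonneg_left (ha _).1 hd.le
    · rw [mul_comm U]
      exact mul_le_mul_of_nonneg_left (ha _).2 hd.le
    · rw [hc, div_mul_cancel₀ _ (sub_pos.2 hyz).ne']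
  refine ⟨A, e.symm, hAd, fun x => e.symm_apply_apply x, hφd, fun y z => ?_⟩
  rcases lt_trichotomy y z with h | rfl | h
  · obtain ⟨s, h1, h2, h3⟩ := hlt y z h
    exact ⟨s, h1, h2, by linarith⟩
  · exact ⟨U * d, mul_le_mul_of_nonneg_right ((ha 0).1.trans (ha 0).2) hd.le, le_rfl, by simp⟩
  · exact hlt z y h

lemma eq_of_add_nat_mul {E : Type*} {f : ℝ → E} {ω : ℝ} (hω : 0 < ω)
    (hf : ∀ t ≥ (0 : ℝ), f (t + ω) = f t) (m : ℕ) {t : ℝ} (ht : 0 ≤ t) :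
    f (t + m * ω) = f t := by
  induction m with
  | zero => simp
  | succ m ih =>
    rw [← ih, ← hf (t + m * ω) (by positivity)]
    congr 1
    push_cast
    ring

lemma eq_comp_toIcoMod {E : Type*} {f : ℝ → E} {ω : ℝ} (hω : 0 < ω)
    (hf : ∀ t ≥ (0 : ℝ), f (t + ω) = f t) {t : ℝ} (ht : 0 ≤ t) : f (toIcoMod hω 0 t) = f t := by
  have h0 := (toIcoMod_mem_Ico' hω t).1
  have h1 : 0 ≤ toIcoDiv hω 0 t := by
    have h2 := (toIcoMod_mem_Ico' hω t).2
    have h3 := toIcoMod_add_toIcoDiv_zsmul hω 0 t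
    rw [zsmul_eq_mul] at h3
    have h4 : (-1 : ℝ) < toIcoDiv hω 0 t := by
      by_contra! h5
      nlinarith
    have : (-1 : ℤ) < toIcoDiv hω 0 t := by exact_mod_cast h4
    linarith
  obtain ⟨m, hm⟩ := Int.eq_ofNat_of_zero_le h1
  rw [← eq_of_add_nat_mul hω hf m h0]
  congr 1
  have h3 := toIcoMod_add_toIcoDiv_zsmul hω 0 t
  rw [zsmul_eq_mul, hm] at h3
  exact_mod_cast h3

lemma continuous_periodic_extension {f : ℝ → ℝ → ℝ} {ω : ℝ} (hω : 0 < ω)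
    (hf : ∀ t ≥ (0 : ℝ), f (t + ω) = f t)
    (hc : ContinuousOn (fun q : ℝ × ℝ => f q.1 q.2) (Set.Ici 0 ×ˢ Set.univ)) :
    Continuous fun q : ℝ × ℝ => f (toIcoMod hω 0 q.1) q.2 := by
  refine continuous_iff_continuousAt.2 fun ⟨t, y⟩ => ?_
  obtain ⟨m, hm⟩ := exists_nat_gt ((1 - t) / ω)
  rw [div_lt_iff₀ hω] at hm
  have hshift : ContinuousAt (fun q : ℝ × ℝ => f (q.1 + m * ω) q.2) (t, y) := by
    have h1 : ContinuousAt (fun q : ℝ × ℝ => f q.1 q.2) (t + m * ω, y) :=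
      hc.continuousAt (prod_mem_nhds (Ici_mem_nhds (by linarith)) univ_mem)
    exact ContinuousAt.comp (x := (t, y)) (f := fun q : ℝ × ℝ => (q.1 + m * ω, q.2)) h1 (by fun_prop)
  refine hshift.congr ?_
  have hev : ∀ᶠ q : ℝ × ℝ in nhds (t, y), t - 1 < q.1 :=
    continuous_fst.continuousAt.eventually (lt_mem_nhds (by simp))
  filter_upwards [hev] with q hq
  rw [← eq_comp_toIcoMod hω hf (by linarith : 0 ≤ q.1 + m * ω), ← nsmul_eq_mul,
    toIcoMod_add_nsmul]

lemma integrableOn_comp_sub_mul {k f : ℝ → ℝ} (hk : IntegrableOn k (Set.Ioi 0))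
    (hf : Continuous f) {R t : ℝ} (hR : ∀ r ≤ t, |f r| ≤ R) :
    IntegrableOn (fun u => f (t - u) * k u) (Set.Ioi 0) := by
  refine (hk.norm.const_mul R).mono' ((Continuous.aestronglyMeasurable (by fun_prop)).mul
    hk.aestronglyMeasurable) ?_
  filter_upwards [ae_restrict_mem measurableSet_Ioi] with u hu
  rw [norm_mul]
  exact mul_le_mul_of_nonneg_right (hR _ (sub_le_self t (le_of_lt hu))) (norm_nonneg _)

lemma continuous_integral_comp_sub_mul {k f : ℝ → ℝ} (hk : IntegrableOn k (Set.Ioi 0))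
    (hf : Continuous f) {R : ℝ} (hR : ∀ r, |f r| ≤ R) :
    Continuous fun t => ∫ u in Set.Ioi (0 : ℝ), f (t - u) * k u := by
  refine continuous_of_dominated (bound := fun u => R * ‖k u‖) (fun t => ?_) (fun t => ?_)
    (hk.norm.const_mul R) (ae_of_all _ fun u => ?_)
  · exact (Continuous.aestronglyMeasurable (by fun_prop)).mul hk.aestronglyMeasurable
  · refine ae_of_all _ fun u => ?_
    rw [norm_mul]
    exact mul_le_mul_of_nonneg_right (hR _) (norm_nonneg _)
  · fun_prop

lemma abs_integral_sub_integral_le {k f g δ : ℝ → ℝ} (hk : IntegrableOn k (Set.Ioi 0))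
    (hk0 : ∀ u ≥ (0 : ℝ), 0 ≤ k u) (hf : Continuous f) (hg : Continuous g) (hδ : Continuous δ)
    {t Rf Rg Rδ κ L : ℝ} (hRf : ∀ r ≤ t, |f r| ≤ Rf) (hRg : ∀ r ≤ t, |g r| ≤ Rg)
    (hRδ : ∀ r ≤ t, |δ r| ≤ Rδ) (hκ : 0 ≤ κ) (hfg : ∀ r, |f r - g r| ≤ κ * |δ r|)
    (hL : ∫ u in Set.Ioi (0 : ℝ), |δ (t - u)| * k u ≤ L) :
    |(∫ u in Set.Ioi (0 : ℝ), f (t - u) * k u) - ∫ u in Set.Ioi (0 : ℝ), g (t - u) * k u| ≤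
      κ * L := by
  rw [← integral_sub (integrableOn_comp_sub_mul hk hf hRf) (integrableOn_comp_sub_mul hk hg hRg)]
  have h : |∫ u in Set.Ioi (0 : ℝ), (f (t - u) * k u - g (t - u) * k u)| ≤
      ∫ u in Set.Ioi (0 : ℝ), κ * (|δ (t - u)| * k u) := by
    refine (Real.norm_eq_abs _).symm.trans_le (norm_integral_le_of_norm_le
      ((integrableOn_comp_sub_mul (f := fun r => |δ r|) hk hδ.abs
        fun r hr => (abs_abs (δ r)).trans_le (hRδ r hr)).const_mul κ) ?_)
    filter_upwards [ae_restrict_mem measurableSet_Ioi] with u hu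
    have hku := hk0 u (le_of_lt hu)
    rw [← sub_mul, norm_mul, Real.norm_eq_abs, Real.norm_eq_abs, abs_of_nonneg hku, ← mul_assoc]
    exact mul_le_mul_of_nonneg_right (hfg _) hku
  rw [integral_const_mul] at h
  exact h.trans (mul_le_mul_of_nonneg_left hL hκ)

lemma exists_uniform_lower_bound {ι : Type*} [Finite ι] [Nonempty ι] {f : ι → ℝ → ℝ} {a b : ℝ}
    (hab : a ≤ b) (hf : ∀ i, ContinuousOn (f i) (Set.Icc a b))
    (hpos : ∀ i, ∀ t ∈ Set.Icc a b, 0 < f i t) :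
    ∃ ε > 0, ∀ i, ∀ t ∈ Set.Icc a b, ε ≤ f i t := by
  choose m hm hmin using fun i =>
    isCompact_Icc.exists_isMinOn (Set.nonempty_Icc.2 hab) (hf i)
  obtain ⟨i₀, hi₀⟩ := Finite.exists_min fun i => f i (m i)
  exact ⟨f i₀ (m i₀), hpos _ _ (hm _), fun i t ht => (hi₀ i).trans (hmin i ht)⟩

lemma exists_uniform_upper_bound {ι : Type*} [Finite ι] [Nonempty ι] {f : ι → ℝ → ℝ} {a b : ℝ}
    (hab : a ≤ b) (hf : ∀ i, ContinuousOn (f i) (Set.Icc a b)) :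
    ∃ B, ∀ i, ∀ t ∈ Set.Icc a b, f i t ≤ B := by
  choose m hm hmax using fun i =>
    isCompact_Icc.exists_isMaxOn (Set.nonempty_Icc.2 hab) (hf i)
  obtain ⟨i₀, hi₀⟩ := Finite.exists_max fun i => f i (m i)
  exact ⟨f i₀ (m i₀), fun i t ht => (hmax i ht).trans (hi₀ i)⟩

lemma abs_mul_sub_add_field_sub_le {ι : Type*} [Fintype ι] {M ε L l U d β βs ς y z s : ℝ}
    {f G φ : ℝ → ℝ} {c κ I J : ι → ℝ} (hd : 0 < d) (hl : 0 < l) (hβ : 0 < β) (hβs : 0 < βs)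
    (hς : 0 < ς) (hs1 : l * d ≤ s) (hs2 : s ≤ U * d) (hs : φ y - φ z = s * (y - z))
    (hf : ∀ u v : ℝ, u ≠ v → β ≤ (f u - f v) / (u - v) ∧ (f u - f v) / (u - v) ≤ βs)
    (hG : ∀ u v : ℝ, |G u - G v| ≤ ς * |u - v|) (hM : U * βs ≤ M)
    (hdom : (∑ j, ς * |c j| * κ j) + ε * d ≤ l * β * d) (hL : |y - z| ≤ L)
    (hIJ : ∀ j, |I j - J j| ≤ κ j * L) :
    |M * (y - z) + (1 / d * (-(f (φ y)) + G (∑ j, c j * I j)) -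
      1 / d * (-(f (φ z)) + G (∑ j, c j * J j)))| ≤ (M - ε) * L := by
  have hL0 : 0 ≤ L := (abs_nonneg _).trans hL
  have hs0 : 0 < s := (mul_pos hl hd).trans_le hs1
  obtain ⟨γ, hγ1, hγ2, hγ⟩ : ∃ γ, β ≤ γ ∧ γ ≤ βs ∧ f (φ y) - f (φ z) = γ * (φ y - φ z) := by
    by_cases h : φ y = φ z
    · obtain ⟨h1, h2⟩ := hf 1 0 one_ne_zero
      exact ⟨β, le_rfl, h1.trans h2, by simp [h]⟩
    · obtain ⟨h1, h2⟩ := hf _ _ h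
      exact ⟨_, h1, h2, (div_mul_cancel₀ _ (sub_ne_zero.2 h)).symm⟩
  have hγ0 : 0 < γ := hβ.trans_le hγ1
  have hGd : |G (∑ j, c j * I j) - G (∑ j, c j * J j)| ≤ (∑ j, ς * |c j| * κ j) * L := by
    refine (hG _ _).trans ?_
    rw [← Finset.sum_sub_distrib, Finset.sum_mul]
    refine (mul_le_mul_of_nonneg_left (Finset.abs_sum_le_sum_abs _ _) hς.le).trans ?_
    rw [Finset.mul_sum]
    refine Finset.sum_le_sum fun j _ => ?_
    rw [← mul_sub, abs_mul]
    refine (mul_le_mul_of_nonneg_left (mul_le_mul_of_nonneg_left (hIJ j) (abs_nonneg (c j)))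
      hς.le).trans_eq (by ring)
  have hrw : M * (y - z) + (1 / d * (-(f (φ y)) + G (∑ j, c j * I j)) -
      1 / d * (-(f (φ z)) + G (∑ j, c j * J j))) =
      (M - γ * (s / d)) * (y - z) + 1 / d * (G (∑ j, c j * I j) - G (∑ j, c j * J j)) := by
    have : f (φ y) = f (φ z) + γ * (s * (y - z)) := by rw [← hs]; linarith
    rw [this]
    ring
  have hsd1 : l ≤ s / d := (le_div_iff₀ hd).2 hs1
  have hsd2 : s / d ≤ U := (div_le_iff₀ hd).2 hs2
  have hlow : β * l ≤ γ * (s / d) := mul_le_mul hγ1 hsd1 hl.le hγ0.le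
  have hup : γ * (s / d) ≤ M := by
    refine le_trans ?_ hM
    rw [mul_comm U]
    exact mul_le_mul hγ2 hsd2 (div_pos hs0 hd).le hβs.le
  have h1 : |(M - γ * (s / d)) * (y - z)| ≤ (M - β * l) * L := by
    rw [abs_mul, abs_of_nonneg (sub_nonneg.2 hup)]
    exact mul_le_mul (by linarith) hL (abs_nonneg _) (by linarith)
  have h2 : |1 / d * (G (∑ j, c j * I j) - G (∑ j, c j * J j))| ≤ (β * l - ε) * L := by
    rw [abs_mul, abs_of_pos (one_div_pos.2 hd), one_div, inv_mul_le_iff₀ hd]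
    refine hGd.trans ((mul_le_mul_of_nonneg_right
      (by linarith : (∑ j, ς * |c j| * κ j) ≤ (β * l - ε) * d) hL0).trans_eq (by ring))
  rw [hrw]
  refine (abs_add_le _ _).trans ((add_le_add h1 h2).trans_eq (by ring))

/-- Corollary 4.2: existence of a globally attractive ω-periodic solution of the
periodic static model (S). -/
theorem static_model_periodic_attractor {n : ℕ} (t₀ : ℝ) (ht₀ : 0 ≤ t₀) (ω : ℝ) (hω : 0 < ω)
    (a : Fin (n+1) → ℝ → ℝ) (b : Fin (n+1) → ℝ → ℝ → ℝ)
    (c : Fin (n+1) → Fin (n+1) → ℝ → ℝ) (Gf : Fin (n+1) → ℝ → ℝ)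
    (K : Fin (n+1) → Fin (n+1) → ℝ → ℝ)
    (hreg : SRegular n a b c Gf K)
    (hbper : ∀ i, ∀ u : ℝ, ∀ t ≥ (0:ℝ), b i (t + ω) u = b i t u)
    (hcper : ∀ i j, ∀ t ≥ (0:ℝ), c i j (t + ω) = c i j t)
    (β βs : Fin (n+1) → ℝ → ℝ)
    (hβc : ∀ i, ContinuousOn (β i) (Set.Ici 0)) (hβsc : ∀ i, ContinuousOn (βs i) (Set.Ici 0))
    (hβpos : ∀ i, ∀ t ≥ (0:ℝ), 0 < β i t) (hβspos : ∀ i, ∀ t ≥ (0:ℝ), 0 < βs i t)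
    (hβper : ∀ i, ∀ t ≥ (0:ℝ), β i (t + ω) = β i t)
    (hβsper : ∀ i, ∀ t ≥ (0:ℝ), βs i (t + ω) = βs i t)
    (hb : ∀ i, ∀ t ≥ (0:ℝ), ∀ u v : ℝ, u ≠ v →
      β i t ≤ (b i t u - b i t v) / (u - v) ∧ (b i t u - b i t v) / (u - v) ≤ βs i t)
    (ς : Fin (n+1) → ℝ) (hς : ∀ i, 0 < ς i)
    (hG : ∀ i, ∀ u v : ℝ, |Gf i u - Gf i v| ≤ ς i * |u - v|)
    (aL aU : Fin (n+1) → ℝ) (haL : ∀ i, 0 < aL i)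
    (ha : ∀ i, ∀ u : ℝ, aL i ≤ a i u ∧ a i u ≤ aU i)
    (dv : Fin (n+1) → ℝ) (hdv : ∀ i, 0 < dv i)
    (hdom : ∀ i, ∀ t ∈ Set.Icc (0:ℝ) ω,
      (∑ j : Fin (n+1), ς i * |c i j t| * aU j * dv j) < aL i * β i t * dv i) :
    ∃ xper : Fin (n+1) → ℝ → ℝ,
      (∀ i, Continuous (xper i)) ∧
      (∀ i, ∀ t : ℝ, xper i (t + ω) = xper i t) ∧
      (∀ i, ∀ t : ℝ, 0 < t → HasDerivAt (xper i) (Srhs n a b c Gf K xper i t) t) ∧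
      (∀ x : Fin (n+1) → ℝ → ℝ, SIsSolution n a b c Gf K t₀ x →
        Tendsto (fun t => Finset.univ.sup' Finset.univ_nonempty
          (fun i => |x i t - xper i t|)) atTop (nhds 0)) := by
  obtain ⟨hac, hapos, hbc, hcc, hGc, hKc, hK0, hK1⟩ := hreg
  have hKint : ∀ i j, IntegrableOn (K i j) (Set.Ioi 0) := fun i j => by
    by_contra h
    exact one_ne_zero ((hK1 i j).symm.trans (integral_undef h))
  have haU : ∀ i, 0 < aU i := fun i => (hapos i 0).trans_le (ha i 0).2
  choose A φ hA hφA hφ hslope using fun i => exists_change_of_variable (hac i) (haL i) (ha i) (hdv i)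
  have hφc : ∀ i, Continuous (φ i) := fun i =>
    continuous_iff_continuousAt.2 fun y => (hφ i y).continuousAt
  have hκ : ∀ i, 0 < aU i * dv i := fun i => mul_pos (haU i) (hdv i)
  have hφup : ∀ i y z, |φ i y - φ i z| ≤ aU i * dv i * |y - z| := fun i y z => by
    obtain ⟨s, h1, h2, h3⟩ := hslope i y z
    rw [h3, abs_mul, abs_of_pos ((mul_pos (haL i) (hdv i)).trans_le h1)]
    exact mul_le_mul_of_nonneg_right h2 (abs_nonneg _)
  have hφlow : ∀ i y z, aL i * dv i * |y - z| ≤ |φ i y - φ i z| := fun i y z => by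
    obtain ⟨s, h1, h2, h3⟩ := hslope i y z
    rw [h3, abs_mul, abs_of_pos ((mul_pos (haL i) (hdv i)).trans_le h1)]
    exact mul_le_mul_of_nonneg_right h1 (abs_nonneg _)
  have hφbdd : ∀ (w : Fin (n+1) → ℝ → ℝ) j R, ∀ r, |w j r| ≤ R →
      |φ j (w j r)| ≤ |φ j 0| + aU j * dv j * R := fun w j R r hr => by
    have h1 := hφup j (w j r) 0
    rw [sub_zero] at h1
    have h2 := abs_sub_abs_le_abs_sub (φ j (w j r)) (φ j 0)
    have h3 := mul_le_mul_of_nonneg_left hr (hκ j).le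
    linarith
  obtain ⟨ε, hε, hεle⟩ := exists_uniform_lower_bound hω.le
    (f := fun i t => (aL i * β i t * dv i - ∑ j, ς i * |c i j t| * aU j * dv j) / dv i)
    (fun i => by
      have h1 := (hβc i).mono (Set.Icc_subset_Ici_self : Set.Icc 0 ω ⊆ _)
      have h2 := fun j => (hcc i j).mono (Set.Icc_subset_Ici_self : Set.Icc 0 ω ⊆ _)
      have h3 : ContinuousOn (fun t => ∑ j, ς i * |c i j t| * aU j * dv j) (Set.Icc 0 ω) :=
        continuousOn_finsetSum _ fun j _ =>
          (((h2 j).abs.const_mul (ς i)).mul_const (aU j)).mul_const (dv j)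
      exact (((h1.const_mul (aL i)).mul_const (dv i)).sub h3).div_const (dv i))
    (fun i t ht => div_pos (sub_pos.2 (hdom i t ht)) (hdv i))
  obtain ⟨B, hB⟩ := exists_uniform_upper_bound hω.le (f := fun i t => aU i * βs i t)
    (fun i => ((hβsc i).mono Set.Icc_subset_Ici_self).const_mul (aU i))
  set M : ℝ := max B ε with hMdef
  have hεM : ε ≤ M := le_max_right _ _
  have hM : 0 < M := hε.trans_le hεM
  set τ : ℝ → ℝ := toIcoMod hω 0 with hτdef
  have hτ : ∀ t, τ t ∈ Set.Icc 0 ω := fun t => Set.Ico_subset_Icc_self (toIcoMod_mem_Ico' hω t)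
  have hτper : ∀ t, τ (t + ω) = τ t := toIcoMod_add_right hω 0
  have hbτ : ∀ i t, 0 ≤ t → b i (τ t) = b i t := fun i t ht =>
    eq_comp_toIcoMod hω (f := b i) (fun t ht => funext fun u => hbper i u t ht) ht
  have hcτ : ∀ i j t, 0 ≤ t → c i j (τ t) = c i j t := fun i j t ht =>
    eq_comp_toIcoMod hω (hcper i j) ht
  have hbτc : ∀ i, Continuous fun q : ℝ × ℝ => b i (τ q.1) q.2 := fun i =>
    continuous_periodic_extension hω (fun t ht => funext fun u => hbper i u t ht) (hbc i)
  have hcτc : ∀ i j, Continuous fun t => c i j (τ t) := fun i j => by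
    have := continuous_periodic_extension (f := fun t _ => c i j t) hω
      (fun t ht => funext fun _ => hcper i j t ht)
      ((hcc i j).comp continuousOn_fst fun q hq => hq.1)
    exact this.comp (continuous_id.prodMk (continuous_const (y := (0 : ℝ))))
  set Q : (Fin (n+1) → ℝ → ℝ) → Fin (n+1) → ℝ → ℝ := fun w i t =>
    1 / dv i * (-(b i (τ t) (φ i (w i t))) +
      Gf i (∑ j, c i j (τ t) * ∫ u in Set.Ioi (0:ℝ), φ j (w j (t - u)) * K i j u)) with hQ
  have hSrhs : ∀ (w : Fin (n+1) → ℝ → ℝ) i t, 0 ≤ t →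
      Srhs n a b c Gf K (fun i t => φ i (w i t)) i t = dv i * a i (φ i (w i t)) * Q w i t := by
    intro w i t ht
    simp only [Srhs, hQ, hbτ i t ht, hcτ i _ t ht]
    have := (hdv i).ne'
    field_simp
  have hest : ∀ (w v : Fin (n+1) → ℝ → ℝ) (i : Fin (n+1)) (t L : ℝ), (∀ j, Continuous (w j)) →
      (∀ j, Continuous (v j)) → (∃ R, ∀ j, ∀ r ≤ t, |w j r| ≤ R) →
      (∃ R, ∀ j, ∀ r ≤ t, |v j r| ≤ R) → |w i t - v i t| ≤ L →
      (∀ j, ∫ u in Set.Ioi (0 : ℝ), |w j (t - u) - v j (t - u)| * K i j u ≤ L) →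
      |M * (w i t - v i t) + (Q w i t - Q v i t)| ≤ (M - ε) * L := by
    rintro w v i t L hw hv ⟨R, hR⟩ ⟨R', hR'⟩ hL hint
    obtain ⟨s, hs1, hs2, hs⟩ := hslope i (w i t) (v i t)
    refine abs_mul_sub_add_field_sub_le (κ := fun j => aU j * dv j) (hdv i) (haL i)
      (hβpos i _ (hτ t).1) (hβspos i _ (hτ t).1) (hς i) hs1 hs2 hs (hb i _ (hτ t).1) (hG i)
      ((hB i _ (hτ t)).trans (le_max_left _ _)) ?_ hL fun j => ?_
    · have h := hεle i _ (hτ t)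
      rw [le_div_iff₀ (hdv i)] at h
      simp only [← mul_assoc]
      linarith
    · exact abs_integral_sub_integral_le (f := fun r => φ j (w j r)) (g := fun r => φ j (v j r))
        (δ := fun r => w j r - v j r) (hKint i j) (hK0 i j) ((hφc j).comp (hw j))
        ((hφc j).comp (hv j)) ((hw j).sub (hv j)) (fun r hr => hφbdd w j R r (hR j r hr))
        (fun r hr => hφbdd v j R' r (hR' j r hr))
        (fun r hr => (abs_sub _ _).trans (add_le_add (hR j r hr) (hR' j r hr))) (hκ j).le
        (fun r => hφup j _ _) (hint j)
  have hQc : ∀ w : Fin (n+1) → ℝ → ℝ, (∀ j, Continuous (w j)) → (∃ R, ∀ j r, |w j r| ≤ R) →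
      ∀ i, Continuous (Q w i) := by
    rintro w hw ⟨R, hR⟩ i
    refine Continuous.const_mul (Continuous.add (Continuous.neg ?_) ((hGc i).comp ?_)) _
    · exact (hbτc i).comp (continuous_id.prodMk ((hφc i).comp (hw i)))
    · exact continuous_finsetSum _ fun j _ => (hcτc i j).mul
        (continuous_integral_comp_sub_mul (f := fun r => φ j (w j r)) (hKint i j)
          ((hφc j).comp (hw j)) fun r => hφbdd w j R r (hR j r))
  have hQper : ∀ w i t, Q w i (t + ω) = Q (fun j r => w j (r + ω)) i t := by
    intro w i t
    simp only [hQ, hτper, sub_add_eq_add_sub]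
  have hQ0 : ∃ R, ∀ i t, |Q 0 i t| ≤ R := by
    have hper : ∀ i, Function.Periodic (Q 0 i) ω := fun i t => hQper 0 i t
    choose R hR using fun i => ((hper i).isBounded_of_continuous hω.ne'
      (hQc 0 (fun _ => continuous_const) ⟨0, by simp⟩ i)).exists_norm_le
    obtain ⟨i₀, hi₀⟩ := Finite.exists_max R
    exact ⟨R i₀, fun i t => (hR i _ ⟨t, rfl⟩).trans (hi₀ i)⟩
  obtain ⟨v, hv, ⟨Rv, hRv⟩, hvper⟩ := exists_periodic_of_delay_contraction hKint hK0 hK1 hM hε hεM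
    hest hQc hQ0 hQper
  have hvc : ∀ i, Continuous (v i) := fun i =>
    continuous_iff_continuousAt.2 fun t => (hv i t).continuousAt
  refine ⟨fun i t => φ i (v i t), fun i => (hφc i).comp (hvc i), fun i t => by simp only [hvper],
    fun i t ht => ?_, ?_⟩
  · rw [hSrhs v i t ht.le]
    exact (hφ i (v i t)).comp t (hv i t)
  rintro x ⟨hxc, ⟨Mx, hMx⟩, hxd⟩
  set w : Fin (n+1) → ℝ → ℝ := fun i t => A i (x i t) with hw
  have hφw : (fun i t => φ i (w i t)) = x := funext fun i => funext fun t => hφA i (x i t)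
  have hφw' : ∀ i t, φ i (w i t) = x i t := fun i t => hφA i (x i t)
  have hwc : ∀ i, Continuous (w i) := fun i =>
    (continuous_iff_continuousAt.2 fun y => (hA i y).continuousAt).comp (hxc i)
  have hwd : ∀ i, ∀ t > t₀, HasDerivAt (w i) (Q w i t) t := by
    intro i t ht
    have h := (hA i (x i t)).comp t (hxd i t ht)
    have h2 := hSrhs w i t (ht₀.trans ht.le)
    rw [hφw, hφw'] at h2
    rw [h2] at h
    refine h.congr_deriv ?_
    have := (mul_pos (hdv i) (hapos i (x i t))).ne'
    rw [← mul_assoc, one_div, inv_mul_cancel₀ this, one_mul]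
  have hwb : ∀ T, ∃ R, ∀ j, ∀ r ≤ T, |w j r| ≤ R := by
    intro T
    obtain ⟨B', hB'⟩ := (isCompact_Icc (a := t₀) (b := T)).exists_bound_of_continuousOn
      (continuous_pi hwc).continuousOn
    obtain ⟨m, hm⟩ : ∃ m, ∀ j, (Mx + |φ j 0|) / (aL j * dv j) ≤ m := by
      obtain ⟨i₀, hi₀⟩ := Finite.exists_max fun j => (Mx + |φ j 0|) / (aL j * dv j)
      exact ⟨_, hi₀⟩
    refine ⟨max m B', fun j r hr => ?_⟩
    rcases le_total r t₀ with h | h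
    · refine le_max_of_le_left (le_trans ?_ (hm j))
      rw [le_div_iff₀ (mul_pos (haL j) (hdv j)), mul_comm]
      have h1 := hφlow j (w j r) 0
      rw [hφw', sub_zero] at h1
      exact h1.trans ((abs_sub _ _).trans (add_le_add_left (hMx j r h) _))
    · exact ((norm_le_pi_norm (fun j => w j r) j).trans (hB' r ⟨h, hr⟩)).trans (le_max_right _ _)
  obtain ⟨Rw, hRw⟩ := hwb t₀
  have hdecay : ∀ i, Tendsto (fun t => w i t - v i t) atTop (nhds 0) := fun i =>
    tendsto_zero_of_delay_contraction hKint hK0 hK1 hM hε hεM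
      (D := fun i t => w i t - v i t) (fun i => (hwc i).sub (hvc i))
      (fun i t ht => (abs_sub _ _).trans (add_le_add (hRw i t ht) (hRv i t)))
      (fun i t ht => (hwd i t ht).sub (hv i t))
      (fun i t _ L hL hint => hest w v i t L hwc hvc (hwb t) ⟨Rv, fun j r _ => hRv j r⟩ hL hint) i
  have hcomp : ∀ i, Tendsto (fun t => |x i t - φ i (v i t)|) atTop (nhds 0) := fun i => by
    refine squeeze_zero (fun t => abs_nonneg _) (fun t => ?_)
      (by simpa using (hdecay i).abs.const_mul (aU i * dv i))
    rw [← hφw' i t]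
    exact hφup i _ _
  simpa only [Finset.sup'_const] using
    Tendsto.finset_sup'_nhds_apply (Finset.univ_nonempty (α := Fin (n+1))) fun i _ => hcomp i
end
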